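/- arXiv:2603.05635 — 4 statements merged into one kernel-verified Lean document; each statement's English description precedes it below -/
import Mathlib

section
/- Let k be a commutative unital ring and let A be a k-algebra that satisfies a proper (monic multilinear) polynomial identity. Suppose A is left primitive, i.e., there exists a simple faithful left A-module. Then either A is a field, or there exists a prime ideal p of k such that, with F the fraction field of k/p, every polynomial identity of A is a polynomial identity of the k-algebra M₂(F) of 2×2 matrices over F. -/
/-- `p` is a polynomial identity of the `k`-algebra `A`: every `k`-algebra
homomorphism from the free associative algebra on countably many variables to
`A` (equivalently, every substitution of elements of `A` for the variables)
sends `p` to `0`. -/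
def IsPolyId (k A : Type*) [CommRing k] [Semiring A] [Algebra k A]
    (p : FreeAlgebra k ℕ) : Prop :=
  ∀ f : ℕ → A, FreeAlgebra.lift k f p = 0

/-- `[x₁,x₂]^m`, the `m`-th power of the commutator of the first two variables
of the free algebra. -/
noncomputable def commPow (k : Type*) [CommRing k] (m : ℕ) : FreeAlgebra k ℕ :=
  (FreeAlgebra.ι k 0 * FreeAlgebra.ι k 1 - FreeAlgebra.ι k 1 * FreeAlgebra.ι k 0) ^ m

/-- `[x₁,x₂][x₃,x₄]⋯[x₂ₘ₋₁,x₂ₘ]`, the product of `m` commutators in `2m`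
distinct variables of the free algebra. -/
noncomputable def commProd (k : Type*) [CommRing k] (m : ℕ) : FreeAlgebra k ℕ :=
  ((List.range m).map (fun i =>
    FreeAlgebra.ι k (2 * i) * FreeAlgebra.ι k (2 * i + 1)
      - FreeAlgebra.ι k (2 * i + 1) * FreeAlgebra.ι k (2 * i))).prod

/-- The standard polynomial `st_d(x₁,…,x_d) = Σ_{σ ∈ S_d} sgn(σ) x_{σ(1)}⋯x_{σ(d)}`
in the free algebra. -/
noncomputable def stPoly (k : Type*) [CommRing k] (d : ℕ) : FreeAlgebra k ℕ :=
  ∑ σ : Equiv.Perm (Fin d),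
    (Equiv.Perm.sign σ : ℤ) •
      ((List.finRange d).map (fun i => FreeAlgebra.ι k ((σ i : Fin d) : ℕ))).prod

/-- `A` satisfies a proper (monic multilinear) polynomial identity: for some
`n ≥ 1` there are coefficients `c σ ∈ k` for the non-identity permutations `σ`
of `{1,…,n}` such that `x₁⋯x_n + Σ_{σ ≠ id} c_σ x_{σ(1)}⋯x_{σ(n)}` is a
polynomial identity of `A`. -/
def SatisfiesProperId (k A : Type*) [CommRing k] [Semiring A] [Algebra k A] : Prop :=
  ∃ n : ℕ, 1 ≤ n ∧ ∃ c : Equiv.Perm (Fin n) → k,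
    IsPolyId k A
      (((List.finRange n).map (fun i => FreeAlgebra.ι k (i : ℕ))).prod
        + ∑ σ ∈ Finset.univ.erase (1 : Equiv.Perm (Fin n)),
            c σ • ((List.finRange n).map (fun i => FreeAlgebra.ι k ((σ i : Fin n) : ℕ))).prod)

/-- `a` is strongly nilpotent: every sequence `s` with `s 0 = a` and
`s (n+1) ∈ s n • A • s n` is eventually zero. -/
def IsStronglyNilpotent {A : Type*} [Ring A] (a : A) : Prop :=
  ∀ s : ℕ → A, s 0 = a → (∀ n, ∃ x : A, s (n + 1) = s n * x * s n) →
    ∃ N, ∀ n ≥ N, s n = 0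


universe u v

open scoped Classical in
theorem pp_density {R M : Type*} [Ring R] [AddCommGroup M] [Module R M] [IsSimpleModule R M]
    {ι : Type*} [Finite ι] (v : ι → M) (hv : LinearIndependent (Module.End R M) v) (w : ι → M) :
    ∃ r : R, ∀ i, r • v i = w i := by
  have := Fintype.ofFinite ι
  let b := Module.Basis.extend hv.linearIndepOn_id
  have hinj := hv.injective
  obtain ⟨f, hf⟩ : ∃ f : Module.End (Module.End R M) M, ∀ i, f (v i) = w i := by
    refine ⟨b.constr ℕ (fun x => if h : ∃ i, v i = x.1 then w h.choose else 0), fun i => ?_⟩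
    have hm : v i ∈ hv.linearIndepOn_id.extend (Set.subset_univ _) :=
      Module.Basis.subset_extend _ ⟨i, rfl⟩
    have hb : b ⟨v i, hm⟩ = v i := Module.Basis.extend_apply_self _ _
    have h : ∃ j, v j = v i := ⟨i, rfl⟩
    conv_lhs => rw [← hb]
    rw [Module.Basis.constr_basis]
    simp only [h, dif_pos]
    rw [hinj h.choose_spec]
  obtain ⟨r, hr⟩ := jacobson_density f (Finset.univ.image v)
  exact ⟨r, fun i => by rw [← hr _ (by simp), hf]⟩

open scoped Classical in
theorem pp_M2 (k : Type*) (B : Type*) [CommRing k] [Ring B] [Algebra k B]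
    (M : Type*) [AddCommGroup M] [Module B M] [IsSimpleModule B M] (v : Fin 2 → M)
    (hv : LinearIndependent (Module.End B M) v) :
    ∃ p : Ideal k, p.IsPrime ∧
        ∀ q : FreeAlgebra k ℕ, IsPolyId k B q →
          IsPolyId k (Matrix (Fin 2) (Fin 2) (FractionRing (k ⧸ p))) q := by
  let φ : k →+* Subring.center (Module.End B M) :=
    { toFun := fun c => ⟨{ toFun := fun m => algebraMap k B c • m
                           map_add' := fun x y => smul_add _ _ _
                           map_smul' := fun b x => by
                            simp only [← mul_smul, RingHom.id_apply, Algebra.commutes] }, by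
                          rw [Subring.mem_center_iff]
                          intro g
                          ext m
                          simp⟩
      map_one' := by ext; simp
      map_mul' := fun x y => by ext m; simp only [map_mul, mul_smul]; rfl
      map_zero' := by ext; simp
      map_add' := fun x y => by ext; simp [add_smul] }
  have hφ : ∀ c m, (φ c : Module.End B M) m = algebraMap k B c • m := fun c m => rfl
  let p := RingHom.ker φ
  have hp : p.IsPrime := RingHom.ker_isPrime φ
  refine ⟨p, hp, fun q hq f => ?_⟩
  let ψ : k ⧸ p →+* Subring.center (Module.End B M) := RingHom.kerLift φ
  have hψ : Function.Injective ψ := RingHom.kerLift_injective φ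
  let θ : FractionRing (k ⧸ p) →+* Subring.center (Module.End B M) := IsFractionRing.lift hψ
  have hθ : ∀ c : k, θ (algebraMap k _ c) = φ c := by
    intro c
    rw [IsScalarTower.algebraMap_apply k (k ⧸ p) (FractionRing (k ⧸ p))]
    exact IsFractionRing.lift_algebraMap hψ _
  let e : FractionRing (k ⧸ p) → Module.End B M := fun x => (θ x : Module.End B M)
  have eadd : ∀ x y m, e (x + y) m = e x m + e y m := by intro x y m; simp [e]
  have emul : ∀ x y m, e (x * y) m = e x (e y m) := by intro x y m; simp [e]
  have ezero : ∀ m, e 0 m = 0 := by intro m; simp [e]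
  have eone : ∀ m, e 1 m = m := by intro m; simp [e]
  choose b hb using fun n => pp_density v hv (fun j => ∑ i, e (f n i j) (v i))
  have key : ∀ q : FreeAlgebra k ℕ, ∀ j, FreeAlgebra.lift k b q • v j =
      ∑ i, e (FreeAlgebra.lift k f q i j) (v i) := by
    intro q
    induction q using FreeAlgebra.induction with
    | grade0 c =>
      intro j
      simp only [AlgHom.commutes]
      have := hφ c (v j)
      rw [← hθ] at this
      rw [← this]
      fin_cases j <;> simp [Matrix.algebraMap_matrix_apply, Fin.sum_univ_two, e]
    | grade1 n => intro j; simpa using hb n j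
    | mul x y hx hy =>
      intro j
      simp only [map_mul, mul_smul, hy, Matrix.mul_apply, Fin.sum_univ_two, eadd, emul, smul_add, ← map_smul, hx, map_add]
      have comm : ∀ x y m, e x (e y m) = e y (e x m) := fun x y m => by
        rw [← emul, mul_comm, emul]
      simp only [comm (FreeAlgebra.lift k f y _ _)]
      abel
    | add x y hx hy =>
      intro j
      simp only [map_add, add_smul, hx, hy, Matrix.add_apply, eadd, Finset.sum_add_distrib]
  have hz := fun j => key q j
  rw [hq b] at hz
  ext i j
  have h1 := Fintype.linearIndependent_iff.1 hv (fun i => e (FreeAlgebra.lift k f q i j))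
    (by simpa using (hz j).symm) i
  have h2 : θ (FreeAlgebra.lift k f q i j) = 0 := Subtype.ext h1
  have := θ.injective (h2.trans (map_zero θ).symm)
  simpa using this

theorem ppAct_comm {D N : Type*} [DivisionRing D] [Monoid N] (g : N →* Dᵐᵒᵖ) (x : D) (y : N) :
    Commute (Module.toAddMonoidEnd D D x)
      (((Module.toAddMonoidEnd Dᵐᵒᵖ D : Dᵐᵒᵖ →* AddMonoid.End D).comp g) y) := by
  ext z
  exact smul_comm x (g y) z

theorem pp_mul_apply {D : Type*} [AddCommGroup D] (f g : AddMonoid.End D) (x : D) :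
    (f * g) x = f (g x) := rfl

/-- left multiplication by coefficients, right multiplication by the monoid -/
noncomputable def ppAct {D N : Type*} [DivisionRing D] [Monoid N] (g : N →* Dᵐᵒᵖ) :
    MonoidAlgebra D N →+* AddMonoid.End D :=
  MonoidAlgebra.liftNCRingHom (Module.toAddMonoidEnd D D)
    ((Module.toAddMonoidEnd Dᵐᵒᵖ D : Dᵐᵒᵖ →* AddMonoid.End D).comp g) (ppAct_comm g)

theorem ppAct_single {D N : Type*} [DivisionRing D] [Monoid N] (g : N →* Dᵐᵒᵖ) (n : N) (d x : D) :
    ppAct g (MonoidAlgebra.single n d) x = d * x * (g n).unop := by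
  unfold ppAct
  rw [MonoidAlgebra.liftNCRingHom_single, pp_mul_apply]
  exact (mul_assoc d x _).symm

theorem ppAct_add {D N : Type*} [DivisionRing D] [Monoid N] (g : N →* Dᵐᵒᵖ)
    (a b : MonoidAlgebra D N) (x : D) : ppAct g (a + b) x = ppAct g a x + ppAct g b x := by
  rw [map_add]; rfl

theorem pp_simple {D B : Type*} [DivisionRing D] [Ring B] [Module B D] (i : D → B)
    (hi : ∀ d x, i d • x = d * x) : IsSimpleModule B D := by
  rw [isSimpleModule_iff_toSpanSingleton_surjective]
  refine ⟨inferInstance, fun x hx y => ⟨i (y * x⁻¹), ?_⟩⟩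
  simp [hi, hx]

theorem pp_end {D B : Type*} [DivisionRing D] [Ring B] [Module B D] (i : D → B)
    (hi : ∀ d x, i d • x = d * x) (g : Module.End B D) (x : D) : g x = x * g 1 := by
  rw [← hi, ← map_smul, hi, mul_one]

open scoped Classical in
theorem pp_dens {D N : Type*} [DivisionRing D] [Monoid N] (g : N →* Dᵐᵒᵖ)
    {ι : Type*} [Fintype ι] (v : ι → D)
    (hv : ∀ c : ι → D, (∀ i n, c i * (g n).unop = (g n).unop * c i) → ∑ i, v i * c i = 0 →
      ∀ i, c i = 0) (w : ι → D) :
    ∃ b, ∀ i, ppAct g b (v i) = w i := by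
  let _ : Module (MonoidAlgebra D N) D := Module.compHom D (ppAct g)
  have hs : ∀ b : MonoidAlgebra D N, ∀ x : D, b • x = ppAct g b x := fun b x => rfl
  have hi : ∀ d x : D, (MonoidAlgebra.single (1 : N) d) • x = d * x := by
    intro d x; rw [hs, ppAct_single]; simp
  have := pp_simple _ hi
  apply pp_density v
  rw [Fintype.linearIndependent_iff]
  intro e he
  have he' := hv (fun i => e i 1) (fun i n => ?_) ?_
  · intro i
    ext x
    rw [pp_end _ hi, he' i]; simp
  · have h1 := map_smul (e i) (MonoidAlgebra.single n (1 : D)) 1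
    rw [hs, hs, ppAct_single, ppAct_single, pp_end _ hi] at h1
    simpa using h1.symm
  · rw [← he]
    refine Finset.sum_congr rfl fun i _ => ?_
    rw [← pp_end _ hi]; rfl

theorem pp_indep {D : Type*} [DivisionRing D] {ι : Type*} [Fintype ι] (l d : ι → D)
    (hl : LinearIndependent (Subring.center D) l) (h : ∀ y, ∑ s, d s * y * l s = 0) :
    ∀ s, d s = 0 := by
  classical
  intro s
  obtain ⟨b, hb⟩ := pp_dens (MonoidHom.id Dᵐᵒᵖ) l (by
    intro c hc hsum
    have := Fintype.linearIndependent_iff.1 hl (fun i => ⟨c i, by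
      rw [Subring.mem_center_iff]
      intro x
      exact (hc i (MulOpposite.op x)).symm⟩) (by
        rw [← hsum]
        refine Finset.sum_congr rfl fun i _ => ?_
        have := hc i (MulOpposite.op (l i))
        simpa [Subring.smul_def] using this)
    intro i
    exact congrArg Subtype.val (this i)) (Pi.single s 1)
  have key : ∀ b y, ∑ t, d t * y * ppAct (MonoidHom.id Dᵐᵒᵖ) b (l t) = 0 := by
    intro b y
    induction b using MonoidAlgebra.induction_linear with
    | zero => simp
    | add f g hf hg =>
      simp only [ppAct_add, mul_add, Finset.sum_add_distrib, hf, hg, add_zero]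
    | single n a =>
      simp only [ppAct_single]
      have := h (y * a)
      calc _ = (∑ s, d s * (y * a) * l s) * ((MonoidHom.id Dᵐᵒᵖ) n).unop := by
            rw [Finset.sum_mul]; simp only [mul_assoc]
        _ = 0 := by rw [this, zero_mul]
  have := key b 1
  simp only [hb] at this
  simpa [Pi.single_apply] using this

/-- value of the proper multilinear identity with left coefficients -/
def PPId {D : Type*} [Ring D] (n : ℕ) (c : Equiv.Perm (Fin n) → D) (x : Fin n → D) : D :=
  (List.ofFn x).prod +
    ∑ σ ∈ Finset.univ.erase (1 : Equiv.Perm (Fin n)), c σ * (List.ofFn (fun i => x (σ i))).prod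

/-- the identity as a multilinear map -/
noncomputable def PPIdM {D : Type*} [Ring D] (n : ℕ) (c : Equiv.Perm (Fin n) → D) :
    MultilinearMap ℤ (fun _ : Fin n => D) D :=
  MultilinearMap.mkPiAlgebraFin ℤ n D +
    ∑ σ ∈ Finset.univ.erase (1 : Equiv.Perm (Fin n)),
      (LinearMap.mulLeft ℤ (c σ)).compMultilinearMap
        ((MultilinearMap.mkPiAlgebraFin ℤ n D).domDomCongr σ)

theorem PPIdM_apply {D : Type*} [Ring D] (n : ℕ) (c : Equiv.Perm (Fin n) → D) (x : Fin n → D) :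
    PPIdM n c x = PPId n c x := by
  simp [PPIdM, PPId]

theorem pp_prod_single {D N : Type*} [Ring D] [CommMonoid N] (n : ℕ) (l : Fin n → N)
    (d : Fin n → D) :
    (List.ofFn (fun i => MonoidAlgebra.single (l i) (d i))).prod =
      MonoidAlgebra.single (∏ i, l i) (List.ofFn d).prod := by
  induction n with
  | zero => simp [MonoidAlgebra.one_def]
  | succ n ih =>
    rw [List.ofFn_succ, List.prod_cons, ih, MonoidAlgebra.single_mul_single, Fin.prod_univ_succ,
      List.ofFn_succ, List.prod_cons]

theorem pp_PI_monoidAlgebra {D N : Type*} [Ring D] [CommMonoid N] (n : ℕ)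
    (c : Equiv.Perm (Fin n) → D) (h : ∀ x, PPId n c x = 0) (b : Fin n → MonoidAlgebra D N) :
    PPId n (fun σ => MonoidAlgebra.single (1 : N) (c σ)) b = 0 := by
  have hb : b = fun i => ∑ l ∈ (b i).coeff.support, MonoidAlgebra.single l ((b i).coeff l) := by
    funext i
    exact (MonoidAlgebra.sum_coeff_single (b i)).symm
  rw [← PPIdM_apply, hb]
  classical
  rw [MultilinearMap.map_sum_finset]
  refine Finset.sum_eq_zero fun r _ => ?_
  rw [PPIdM_apply, PPId, pp_prod_single]
  have : ∀ σ : Equiv.Perm (Fin n), MonoidAlgebra.single (1 : N) (c σ) *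
      (List.ofFn (fun i => MonoidAlgebra.single (r (σ i)) ((b (σ i)).coeff (r (σ i))))).prod =
      MonoidAlgebra.single (∏ i, r i) (c σ * (List.ofFn (fun i => (b (σ i)).coeff (r (σ i)))).prod) := by
    intro σ
    rw [pp_prod_single, MonoidAlgebra.single_mul_single, one_mul, Equiv.prod_comp σ r]
  simp only [this]
  have h2 := h (fun i => (b i).coeff (r i))
  have h3 := congrArg (MonoidAlgebra.singleAddHom (R := D) (∏ i, r i)) h2
  rw [PPId, map_add, map_sum, map_zero] at h3
  exact h3

theorem pp_chain {D : Type*} [AddCommGroup D] (n : ℕ) (T : Fin n → AddMonoid.End D)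
    (v : Fin (n + 1) → D)
    (h : ∀ i j, T i (v j) = if j = i.succ then v i.castSucc else 0) :
    (List.ofFn T).prod (v (Fin.last n)) = v 0 := by
  induction n with
  | zero => simp
  | succ n ih =>
    have h2 := ih (fun i => T i.succ) (fun i => v i.succ) (by
      intro i j
      rw [h]
      simp [Fin.succ_inj]
      )
    rw [List.ofFn_succ, List.prod_cons]
    have : v (Fin.last (n+1)) = (fun i : Fin (n+1) => v i.succ) (Fin.last n) := by simp
    rw [pp_mul_apply, this, h2, h]
    simp

theorem pp_chain_perm {D : Type*} [AddCommGroup D] (n : ℕ) (T : Fin n → AddMonoid.End D)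
    (v : Fin (n + 1) → D) (σ : Fin n → Fin n) (hσ : σ ≠ id)
    (h : ∀ i j, T i (v j) = if j = i.succ then v i.castSucc else 0) :
    (List.ofFn (fun i => T (σ i))).prod (v (Fin.last n)) = 0 := by
  have key : ∀ m (τ : Fin m → Fin n) (hm : m ≤ n), (∃ i : Fin m, (τ i : ℕ) + m ≠ n + i) →
      (List.ofFn (fun i => T (τ i))).prod (v (Fin.last n)) = 0 := by
    intro m
    induction m with
    | zero => rintro τ _ ⟨i, _⟩; exact i.elim0
    | succ m ih =>
      intro τ hm hi
      rw [List.ofFn_succ, List.prod_cons, pp_mul_apply]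
      by_cases h2 : ∃ i : Fin m, (τ i.succ : ℕ) + m ≠ n + i
      · rw [ih (fun i => τ i.succ) (by omega) h2, map_zero]
      · push Not at h2
        have h3 : ∀ m (τ : Fin m → Fin n) (hm : m ≤ n), (∀ i, (τ i : ℕ) + m = n + i) →
            (List.ofFn (fun i => T (τ i))).prod (v (Fin.last n)) = v ⟨n - m, by omega⟩ := by
          intro m
          induction m with
          | zero => intro τ _ _; simp; rfl
          | succ m ih =>
            intro τ hm hi
            rw [List.ofFn_succ, List.prod_cons, pp_mul_apply,
              ih (fun i => τ i.succ) (by omega) (by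
                intro i; have := hi i.succ; simp at this; omega), h]
            have h0 := hi 0
            simp at h0
            rw [if_pos (by ext; simp; omega)]
            congr 1
            ext; simp; omega
        rw [h3 m (fun i => τ i.succ) (by omega) h2, h, if_neg]
        intro h4
        have h5 := congrArg Fin.val h4
        simp at h5
        obtain ⟨i, hi⟩ := hi
        induction i using Fin.cases with
        | zero => simp at hi; omega
        | succ i => have := h2 i; simp at hi; omega
  refine key n σ le_rfl ?_
  by_contra hc
  push Not at hc
  exact hσ (by ext i; have := hc i; simp; omega)

theorem pp_sum_apply {D ι : Type*} [AddCommGroup D] (s : Finset ι) (f : ι → AddMonoid.End D)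
    (x : D) : (∑ i ∈ s, f i) x = ∑ i ∈ s, f i x :=
  map_sum (⟨⟨fun f : AddMonoid.End D => f x, rfl⟩, fun _ _ => rfl⟩ : AddMonoid.End D →+ D) f s

theorem pp_bound {D N : Type*} [DivisionRing D] [CommMonoid N] (g : N →* Dᵐᵒᵖ) (n : ℕ)
    (c : Equiv.Perm (Fin n) → D) (h : ∀ x, PPId n c x = 0) (v : Fin (n + 1) → D)
    (hd : ∀ w : Fin (n + 1) → D, ∃ b, ∀ i, ppAct g b (v i) = w i) : v 0 = 0 := by
  choose b hb using fun i : Fin n => hd (fun j => if j = i.succ then v i.castSucc else 0)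
  have h1 := congrArg (fun b => ppAct g b (v (Fin.last n))) (pp_PI_monoidAlgebra n c h b)
  have h2 : ∀ σ : Fin n → Fin n, ppAct g (List.ofFn (fun i => b (σ i))).prod =
      (List.ofFn (fun i => (fun j => ppAct g (b j)) (σ i))).prod := by
    intro σ
    rw [map_list_prod, List.map_ofFn]; rfl
  have h3 := h2 id
  simp only [id] at h3
  simp only [PPId, map_add, map_sum, map_mul, h2, map_zero] at h1
  have h4 : ((List.ofFn (fun i => ppAct g (b i))).prod (v (Fin.last n))) + ∑ σ ∈ Finset.univ.erase (1 : Equiv.Perm (Fin n)),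
      (ppAct g (MonoidAlgebra.single 1 (c σ))) ((List.ofFn (fun i => (fun j => ppAct g (b j)) (σ i))).prod (v (Fin.last n))) = 0 := by
    rw [← Finset.sum_congr rfl fun σ _ => pp_mul_apply _ _ _, ← pp_sum_apply]
    exact h1
  rw [pp_chain n (fun i => ppAct g (b i)) v hb, Finset.sum_eq_zero, add_zero] at h4
  · exact h4
  · intro σ hs
    rw [pp_chain_perm n (fun i => ppAct g (b i)) v σ _ hb, map_zero]
    intro h5
    simp at hs
    exact hs (Equiv.ext fun i => congrFun h5 i)

theorem pp_max {D : Type*} [DivisionRing D] :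
    ∃ L : Subring D, (∀ x ∈ L, ∀ y ∈ L, x * y = y * x) ∧
      ∀ x, (∀ y ∈ L, x * y = y * x) → x ∈ L := by
  obtain ⟨S, hS⟩ := zorn_subset {S : Set D | ∀ x ∈ S, ∀ y ∈ S, x * y = y * x} (by
    intro c hc hch
    refine ⟨⋃₀ c, ?_, fun s hs => Set.subset_sUnion_of_mem hs⟩
    rintro x ⟨s, hs, hx⟩ y ⟨t, ht, hy⟩
    rcases hch.total hs ht with h | h
    · exact hc ht x (h hx) y hy
    · exact hc hs x hx y (h hy))
  have hmax : ∀ x, (∀ y ∈ S, x * y = y * x) → x ∈ S := by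
    intro x hx
    have := hS.2 (y := insert x S) (by
      rintro a (rfl | ha) b (rfl | hb)
      · rfl
      · exact hx b hb
      · exact (hx a ha).symm
      · exact hS.1 a ha b hb) (Set.subset_insert x S)
    exact this (Set.mem_insert x S)
  have hmem : ∀ x, x ∈ Subring.centralizer S ↔ x ∈ S := by
    intro x
    rw [Subring.mem_centralizer_iff]
    exact ⟨fun h => hmax x fun y hy => (h y hy).symm, fun h y hy => hS.1 y hy x h⟩
  refine ⟨Subring.centralizer S, ?_, ?_⟩
  · intro x hx y hy
    exact hS.1 x ((hmem x).1 hx) y ((hmem y).1 hy)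
  · intro x hx
    exact (hmem x).2 (hmax x fun y hy => hx y ((hmem y).2 hy))

open scoped Classical in
theorem pp_span {D : Type*} [DivisionRing D] (n : ℕ)
    (c : Equiv.Perm (Fin n) → D) (h : ∀ x, PPId n c x = 0) (L : Subring D)
    (hL : ∀ x ∈ L, ∀ y ∈ L, x * y = y * x) (hL' : ∀ x, (∀ y ∈ L, x * y = y * x) → x ∈ L) :
    ∃ (m : ℕ) (e : Fin m → D), ∀ y, ∃ a : Fin m → L, y = ∑ t, e t * a t := by
  let _ : CommRing L := { (inferInstance : Ring L) with
    mul_comm := fun x y => Subtype.ext (hL x x.2 y y.2) }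
  let g : L →* Dᵐᵒᵖ :=
    { toFun := fun l => MulOpposite.op (l : D)
      map_one' := rfl
      map_mul' := fun x y => by
        rw [← MulOpposite.op_mul, ← Subring.coe_mul, mul_comm] }
  let _ : Module (MonoidAlgebra D L) D := Module.compHom D (ppAct g)
  have hs : ∀ b : MonoidAlgebra D L, ∀ x : D, b • x = ppAct g b x := fun b x => rfl
  have hi : ∀ d x : D, (MonoidAlgebra.single (1 : L) d) • x = d * x := by
    intro d x; rw [hs, ppAct_single]; simp
  have := pp_simple _ hi
  have hrank : Module.rank (Module.End (MonoidAlgebra D L) D) D ≤ n := by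
    apply rank_le
    intro s hsi
    by_contra hcard
    push Not at hcard
    obtain ⟨f⟩ : Nonempty (Fin (n + 1) ↪ s) := by
      apply Function.Embedding.nonempty_of_card_le
      simpa using hcard
    have hv := hsi.comp f f.injective
    have := pp_bound g n c h _ (fun w => pp_density _ hv w)
    exact hv.ne_zero 0 this
  have hfin : Module.Finite (Module.End (MonoidAlgebra D L) D) D :=
    Module.rank_lt_aleph0_iff.1 (hrank.trans_lt (Cardinal.natCast_lt_aleph0))
  let b := Module.finBasis (Module.End (MonoidAlgebra D L) D) D
  refine ⟨_, b, fun y => ⟨fun t => ⟨b.repr y t 1, ?_⟩, ?_⟩⟩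
  · apply hL'
    intro l hl
    have h1 := map_smul (b.repr y t) (MonoidAlgebra.single (⟨l, hl⟩ : L) (1 : D)) 1
    rw [hs, hs, ppAct_single, ppAct_single, pp_end _ hi] at h1
    simpa [g] using h1.symm
  · conv_lhs => rw [← b.sum_repr y]
    refine Finset.sum_congr rfl fun t _ => ?_
    exact pp_end _ hi _ _

theorem pp_finite {D : Type*} [DivisionRing D] (n : ℕ)
    (c : Equiv.Perm (Fin n) → D) (h : ∀ x, PPId n c x = 0) (hZ : Finite (Subring.center D)) :
    Finite D := by
  obtain ⟨L, hL, hL'⟩ := pp_max (D := D)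
  obtain ⟨m, e, he⟩ := pp_span n c h L hL hL'
  let K : Submodule (Subring.center D) D :=
    { carrier := L
      add_mem' := fun ha hb => L.add_mem ha hb
      zero_mem' := L.zero_mem
      smul_mem' := fun z x hx => by
        refine L.mul_mem (hL' _ fun y _ => ?_) hx
        exact (Subring.mem_center_iff.1 z.2 y).symm }
  have hrank : Module.rank (Subring.center D) K ≤ m := by
    apply rank_le
    intro s hs
    have hl : LinearIndependent (Subring.center D) (fun i : s => ((i : K) : D)) :=
      hs.map' K.subtype (Submodule.ker_subtype K)
    let W : (s → D) →ₗ[D] (Fin m → D) :=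
      { toFun := fun d t => ∑ i, d i * e t * ((i : K) : D)
        map_add' := fun x y => by ext t; simp [add_mul, Finset.sum_add_distrib]
        map_smul' := fun a x => by ext t; simp [Finset.mul_sum, mul_assoc] }
    have hW : Function.Injective W := by
      rw [← LinearMap.ker_eq_bot, LinearMap.ker_eq_bot']
      intro d hd
      funext i
      refine pp_indep _ d hl ?_ i
      intro y
      obtain ⟨a, rfl⟩ := he y
      have h1 : ∀ t, ∑ i, d i * e t * ((i : K) : D) = 0 := fun t => congrFun hd t
      calc _ = ∑ t, (∑ i, d i * e t * ((i : K) : D)) * a t := by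
            simp only [Finset.mul_sum, Finset.sum_mul]
            rw [Finset.sum_comm]
            refine Finset.sum_congr rfl fun t _ => Finset.sum_congr rfl fun i _ => ?_
            have := hL (a t) (a t).2 ((i : K) : D) (i : K).2
            simp only [mul_assoc, this]
        _ = 0 := Finset.sum_eq_zero fun t _ => by rw [h1, zero_mul]
    have := LinearMap.finrank_le_finrank_of_injective hW
    simpa using this
  have hfin : Module.Finite (Subring.center D) K :=
    Module.rank_lt_aleph0_iff.1 (hrank.trans_lt (Cardinal.natCast_lt_aleph0))
  have : Finite K := Module.finite_of_finite (Subring.center D)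
  have : Finite L := this
  refine Finite.of_surjective (fun a : Fin m → L => ∑ t, e t * (a t : D)) fun y => ?_
  obtain ⟨a, ha⟩ := he y
  exact ⟨a, ha.symm⟩

open Polynomial in
theorem pp_poly_zero {D : Type*} [DivisionRing D] [Infinite (Subring.center D)] (p : D[X])
    (h : ∀ z : Subring.center D, p.eval (z : D) = 0) : p = 0 := by
  let b := Module.Basis.ofVectorSpace (Subring.center D) D
  ext j
  rw [coeff_zero]
  apply b.ext_elem
  intro t
  let P : (Subring.center D)[X] :=
    ∑ i ∈ Finset.range (p.natDegree + 1), monomial i (b.coord t (p.coeff i))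
  have hP : P = 0 := by
    apply Polynomial.funext
    intro z
    have h1 := congrArg (b.coord t) (h z)
    rw [eval_eq_sum_range, map_sum, map_zero] at h1
    rw [eval_zero, eval_finsetSum, ← h1]
    refine Finset.sum_congr rfl fun i _ => ?_
    have : p.coeff i * (z : D) ^ i = z ^ i • p.coeff i := by
      rw [Subring.smul_def]
      exact Subring.mem_center_iff.1 (z ^ i).2 _
    rw [this, map_smul, eval_monomial, smul_eq_mul, mul_comm]
  have h2 := congrArg (fun P => coeff P j) hP
  simp only [P, finsetSum_coeff, coeff_monomial, coeff_zero] at h2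
  rw [Finset.sum_ite_eq'] at h2
  split_ifs at h2 with h3
  · simpa using h2
  · rw [coeff_eq_zero_of_natDegree_lt (by simpa using h3)]

open Polynomial in
theorem pp_poly_id (k : Type*) {D : Type*} [CommRing k] [DivisionRing D] [Algebra k D]
    [Infinite (Subring.center D)] (q : FreeAlgebra k ℕ) (hq : IsPolyId k D q) :
    IsPolyId k D[X] q := by
  intro f
  apply pp_poly_zero
  intro z
  let ev : D[X] →ₐ[k] D := Polynomial.eval₂AlgHom (AlgHom.id k D) (z : D)
    (fun a => Subring.mem_center_iff.1 z.2 a)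
  have h1 : ev (FreeAlgebra.lift k f q) = FreeAlgebra.lift k (fun n => ev (f n)) q := by
    rw [← AlgHom.comp_apply]
    congr 1
    ext n
    simp
  have h2 : ev (FreeAlgebra.lift k f q) = (FreeAlgebra.lift k f q).eval (z : D) := rfl
  rw [← h2, h1]
  exact hq _

open Polynomial in
open scoped Classical in
theorem pp_infinite (k : Type*) {D : Type*} [CommRing k] [DivisionRing D] [Algebra k D]
    [Infinite (Subring.center D)] (a b : D) (hab : a * b ≠ b * a) :
    ∃ p : Ideal k, p.IsPrime ∧
        ∀ q : FreeAlgebra k ℕ, IsPolyId k D q →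
          IsPolyId k (Matrix (Fin 2) (Fin 2) (FractionRing (k ⧸ p))) q := by
  let φ : D[X] →+* AddMonoid.End D := eval₂RingHom' (Module.toAddMonoidEnd D D)
    (AddMonoidHom.mulRight a) (fun x => by
      ext z
      exact (mul_assoc x z a).symm)
  have hC : ∀ d x, φ (C d) x = d * x := fun d x => by
    have : φ (C d) = Module.toAddMonoidEnd D D d := eval₂_C _ _
    rw [this]; rfl
  have hX : ∀ x, φ X x = x * a := fun x => by
    have : φ X = AddMonoidHom.mulRight a := eval₂_X _ _
    rw [this]; rfl
  let _ : Module D[X] D := Module.compHom D φ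
  have hs : ∀ (p : D[X]) (x : D), p • x = φ p x := fun p x => rfl
  have hi : ∀ d x : D, (C d : D[X]) • x = d * x := hC
  have := pp_simple _ hi
  obtain ⟨p, hp, h⟩ := pp_M2 k D[X] D ![1, b] (by
    rw [Fintype.linearIndependent_iff]
    intro g hg
    have hcomm : ∀ i, a * g i 1 = g i 1 * a := by
      intro i
      have h1 := map_smul (g i) (X : D[X]) (1 : D)
      rw [hs, hs, hX, hX, pp_end _ hi, one_mul] at h1
      exact h1
    have h1 : g 0 1 + b * g 1 1 = 0 := by
      rw [Fin.sum_univ_two] at hg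
      rw [← hg, ← pp_end _ hi]; rfl
    have h2 : g 1 1 = 0 := by
      by_contra hne
      apply hab
      have hb : b = - g 0 1 * (g 1 1)⁻¹ := by
        rw [eq_mul_inv_iff_mul_eq₀ hne]
        exact eq_neg_of_add_eq_zero_right h1
      have c0 : Commute a (g 0 1) := hcomm 0
      have c1 : Commute a (g 1 1) := hcomm 1
      rw [hb]
      exact (c0.neg_right).mul_right (c1.inv_right₀)
    have h3 : g 0 1 = 0 := by simpa [h2] using h1
    intro i
    ext x
    rw [pp_end _ hi]
    fin_cases i <;> simp [h2, h3])
  exact ⟨p, hp, fun q hq => h q (pp_poly_id k q hq)⟩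

theorem pp_divisionRing (k : Type*) {D : Type*} [CommRing k] [DivisionRing D] [Algebra k D]
    (hPI : SatisfiesProperId k D) (a b : D) (hab : a * b ≠ b * a) :
    ∃ p : Ideal k, p.IsPrime ∧
        ∀ q : FreeAlgebra k ℕ, IsPolyId k D q →
          IsPolyId k (Matrix (Fin 2) (Fin 2) (FractionRing (k ⧸ p))) q := by
  cases finite_or_infinite (Subring.center D) with
  | inr h => exact pp_infinite k a b hab
  | inl h =>
    exfalso
    obtain ⟨n, -, c, hc⟩ := hPI
    have hfin : Finite D := by
      refine pp_finite n (fun σ => algebraMap k D (c σ)) (fun x => ?_) h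
      have h1 := hc (fun j => if hj : j < n then x ⟨j, hj⟩ else 0)
      have h2 : ∀ (g : ℕ → FreeAlgebra k ℕ), List.map g (do
          let a ← List.finRange n
          pure (a : ℕ)) = List.map (fun i : Fin n => g i) (List.finRange n) := by
        intro g
        have h3 : List.flatMap (fun a : Fin n => [(a : ℕ)]) (List.finRange n) =
            List.map (fun a : Fin n => (a : ℕ)) (List.finRange n) :=
          List.flatMap_pure_eq_map _ _
        simp only [List.bind_eq_flatMap, List.pure_def, h3, List.map_map, Function.comp_def]
      rw [h2] at h1
      rw [PPId, ← h1, map_add, map_sum, map_list_prod, List.map_map, List.ofFn_eq_map]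
      congr 1
      · simp [Function.comp_def]
      · refine Finset.sum_congr rfl fun σ _ => ?_
        rw [map_smul, map_list_prod, List.map_map, List.ofFn_eq_map, Algebra.smul_def]
        simp [Function.comp_def]
    obtain ⟨hf⟩ : Nonempty (IsField D) := ⟨Finite.isDomain_to_isField D⟩
    exact hab (hf.mul_comm a b)

theorem primitive_PI_field_or_M2
    (k : Type u) (A : Type v) [CommRing k] [Ring A] [Algebra k A]
    (hPI : SatisfiesProperId k A)
    (hprim : ∃ (M : Type v) (_ : AddCommGroup M) (_ : Module A M),
      IsSimpleModule A M ∧ FaithfulSMul A M) :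
    IsField A ∨
      ∃ p : Ideal k, p.IsPrime ∧
        ∀ q : FreeAlgebra k ℕ, IsPolyId k A q →
          IsPolyId k (Matrix (Fin 2) (Fin 2) (FractionRing (k ⧸ p))) q := by
  classical
  obtain ⟨M, _, _, hM, hfaith⟩ := hprim
  by_cases hv : ∃ v : Fin 2 → M, LinearIndependent (Module.End A M) v
  · obtain ⟨v, hv⟩ := hv
    exact Or.inr (pp_M2 k A M v hv)
  have := IsSimpleModule.nontrivial A M
  obtain ⟨x, hx⟩ := exists_ne (0 : M)
  have hspan : ∀ y : M, ∃ e : Module.End A M, e x = y := by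
    intro y
    by_contra hy
    push Not at hy
    exact hv ⟨![x, y], (LinearIndependent.pair_iff' hx).2 hy⟩
  have hsimple : IsSimpleModule A A := by
    refine IsSimpleModule.congr (N := M) (LinearEquiv.ofBijective (LinearMap.toSpanSingleton A M x)
      ⟨?_, IsSimpleModule.toSpanSingleton_surjective A hx⟩)
    rw [← LinearMap.ker_eq_bot, LinearMap.ker_eq_bot']
    intro a ha
    apply hfaith.eq_of_smul_eq_smul (α := M)
    intro y
    obtain ⟨e, rfl⟩ := hspan y
    rw [← map_smul]
    have : a • x = 0 := ha
    rw [this, map_zero, zero_smul]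
  obtain ⟨hnt, hu⟩ := isSimpleModule_self_iff_isUnit.1 hsimple
  by_cases hcomm : ∀ a b : A, a * b = b * a
  · left
    exact { exists_pair_ne := hnt.1, mul_comm := hcomm,
            mul_inv_cancel := fun {a} ha => by
              obtain ⟨u, rfl⟩ := hu a ha
              exact ⟨(u⁻¹ : Aˣ), by simp⟩ }
  · right
    push Not at hcomm
    obtain ⟨a, b, hab⟩ := hcomm
    let _ : DivisionRing A := DivisionRing.ofIsUnitOrEqZero
      (fun a => (em (a = 0)).symm.imp_left (hu a))
    exact pp_divisionRing k hPI a b hab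
end

section
/- Let k be a commutative unital ring and let A be a k-algebra that satisfies a proper (monic multilinear) polynomial identity. If for no m ≥ 1 the polynomial [x₁,x₂]^m is a polynomial identity of A, then there exists a prime ideal p of k such that, with F the fraction field of k/p, every polynomial identity of A is a polynomial identity of the k-algebra M₂(F) of 2×2 matrices over F (i.e., M₂(F) belongs to the variety generated by A). -/
universe u v


section helpers

theorem lift_natural {k A B : Type*} [CommRing k] [Semiring A] [Algebra k A] [Semiring B] [Algebra k B]
    {X : Type*} (φ : A →ₐ[k] B) (f : X → A) (q : FreeAlgebra k X) :
    φ (FreeAlgebra.lift k f q) = FreeAlgebra.lift k (fun i => φ (f i)) q := by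
  have : φ.comp (FreeAlgebra.lift k f) = FreeAlgebra.lift k (fun i => φ (f i)) := by
    ext x; simp
  rw [← this]; rfl

theorem IsPolyId.of_injective {k A B : Type*} [CommRing k] [Semiring A] [Algebra k A] [Semiring B]
    [Algebra k B] {q : FreeAlgebra k ℕ} (φ : A →ₐ[k] B) (hφ : Function.Injective φ)
    (h : IsPolyId k B q) : IsPolyId k A q := by
  intro f
  apply hφ
  rw [lift_natural, h, map_zero]

theorem IsPolyId.range {k A B : Type*} [CommRing k] [Semiring A] [Algebra k A] [Semiring B]
    [Algebra k B] {q : FreeAlgebra k ℕ} (φ : A →ₐ[k] B)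
    (h : IsPolyId k A q) : IsPolyId k φ.range q := by
  intro f
  choose g hg using fun i => (f i).2
  have : f = fun i => φ.rangeRestrict (g i) := by
    funext i; apply Subtype.ext; exact (hg i).symm
  rw [this, ← lift_natural, h, map_zero]

theorem IsPolyId.pi {k A : Type*} [CommRing k] [Semiring A] [Algebra k A] {ι : Type*}
    {q : FreeAlgebra k ℕ} (h : IsPolyId k A q) : IsPolyId k (ι → A) q := by
  intro f
  funext i
  have := lift_natural (Pi.evalAlgHom k (fun _ : ι => A) i) f q
  rw [h] at this
  exact this

/-- Field of endomorphisms and density. -/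
theorem exists_field_dense {k : Type u} {R : Type*} {V : Type v} [CommRing k] [Ring R] [Algebra k R]
    [AddCommGroup V] [Module R V] [Module k V] [IsScalarTower k R V] [IsSimpleModule R V]
    (hcomm : ∀ x y : Module.End R V, x * y = y * x) :
    ∃ (K : Type v) (_ : Field K) (_ : Algebra k K) (_ : Module K V),
      IsScalarTower k K V ∧ (∀ (r : R) (x : K) (v : V), r • x • v = x • r • v) ∧
      (∀ (n : ℕ) (v : Fin n → V), LinearIndependent K v → ∀ w : Fin n → V,
        ∃ r : R, ∀ i, r • v i = w i) ∧ (Finite V → Finite K) := by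
  classical
  have : SMulCommClass R k V := ⟨fun r a v => by
    rw [← algebraMap_smul R a v, ← algebraMap_smul R a (r • v), smul_smul, smul_smul,
      Algebra.commutes]⟩
  let fld : Field (Module.End R V) :=
    { (inferInstance : DivisionRing (Module.End R V)) with mul_comm := hcomm }
  refine ⟨Module.End R V, fld, inferInstance, inferInstance, inferInstance, ?_, ?_, ?_⟩
  · intro r x v
    exact (map_smul x r v).symm
  · intro n v hv w
    have hv' : LinearIndependent (Module.End R V) v := hv
    obtain ⟨f, hf⟩ : ∃ f : Module.End (Module.End R V) V, ∀ i, f (v i) = w i := by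
      let b := Module.Basis.span hv'
      obtain ⟨g, hg⟩ := LinearMap.exists_extend (b.constr ℕ w)
      refine ⟨g, fun i => ?_⟩
      have h1 : (b i : V) = v i := congrArg Subtype.val (Module.Basis.span_apply hv' i)
      rw [← h1]
      have := congrArg (fun l => l (b i)) hg
      simpa using this
    obtain ⟨r, hr⟩ := jacobson_density f (Finset.univ.image v)
    exact ⟨r, fun i => by rw [← hr (v i) (by simp), hf]⟩
  · intro hV
    exact Finite.of_injective (fun f : Module.End R V => (f : V → V)) DFunLike.coe_injective

/-- From density and two independent vectors to `M₂(K)`. -/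
theorem matrix_of_dense {k R V K : Type*} [CommRing k] [Ring R] [Algebra k R]
    [AddCommGroup V] [Module R V] [Module k V] [IsScalarTower k R V]
    [Field K] [Algebra k K] [Module K V] [IsScalarTower k K V]
    (hc : ∀ (r : R) (x : K) (v : V), r • x • v = x • r • v)
    (hd : ∀ (n : ℕ) (v : Fin n → V), LinearIndependent K v → ∀ w : Fin n → V,
        ∃ r : R, ∀ i, r • v i = w i) {n : ℕ}
    (v : Fin n → V) (hv : LinearIndependent K v) (q : FreeAlgebra k ℕ) (hq : IsPolyId k R q) :
    IsPolyId k (Matrix (Fin n) (Fin n) K) q := by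
  intro f
  choose e he using fun i => hd n v hv (fun j => ∑ l, f i l j • v l)
  have key : ∀ q : FreeAlgebra k ℕ, ∀ j,
      (FreeAlgebra.lift k e q) • v j = ∑ l, (FreeAlgebra.lift k f q) l j • v l := by
    intro q
    induction q using FreeAlgebra.induction with
    | grade0 r =>
      intro j
      simp only [AlgHom.commutes, algebraMap_smul, Matrix.algebraMap_matrix_apply, ite_smul,
        zero_smul, Finset.sum_ite_eq', Finset.mem_univ, if_true]
    | grade1 x =>
      intro j
      simpa using he x j
    | mul a b ha hb =>
      intro j
      rw [map_mul, map_mul, mul_smul, hb, Finset.smul_sum]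
      simp_rw [hc, ha, Finset.smul_sum, Matrix.mul_apply, Finset.sum_smul, smul_smul]
      rw [Finset.sum_comm]
      refine Finset.sum_congr rfl fun l _ => Finset.sum_congr rfl fun m _ => ?_
      rw [mul_comm]
    | add a b ha hb =>
      intro j
      rw [map_add, map_add, add_smul, ha, hb, ← Finset.sum_add_distrib]
      simp [add_smul]
  ext l j
  have h1 := key q j
  rw [hq, zero_smul] at h1
  exact (Fintype.linearIndependent_iff.1 hv _ h1.symm) l

theorem exists_prime_of_field {k : Type u} {K : Type v} [CommRing k] [Field K] [Algebra k K] :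
    ∃ p : Ideal k, p.IsPrime ∧ ∀ q : FreeAlgebra k ℕ,
      IsPolyId k (Matrix (Fin 2) (Fin 2) K) q →
        IsPolyId k (Matrix (Fin 2) (Fin 2) (FractionRing (k ⧸ p))) q := by
  refine ⟨RingHom.ker (algebraMap k K), RingHom.ker_isPrime _, fun q hq => ?_⟩
  set p := RingHom.ker (algebraMap k K) with hp
  have : p.IsPrime := RingHom.ker_isPrime _
  let g : (k ⧸ p) →ₐ[k] K := Ideal.Quotient.liftₐ p (Algebra.ofId k K) (fun a ha => ha)
  have hg : Function.Injective g := by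
    rw [injective_iff_map_eq_zero]
    intro x hx
    obtain ⟨a, rfl⟩ := Ideal.Quotient.mk_surjective x
    rw [Ideal.Quotient.eq_zero_iff_mem]
    exact hx
  let G : FractionRing (k ⧸ p) →ₐ[k] K := IsFractionRing.liftAlgHom (g := g) hg
  exact hq.of_injective G.mapMatrix
    (Matrix.map_injective G.toRingHom.injective)

/-- A non-commutative action forces two independent vectors. -/
theorem exists_indep_pair {R V K : Type*} [Ring R]
    [AddCommGroup V] [Module R V]
    [Field K] [Module K V]
    (hc : ∀ (r : R) (x : K) (v : V), r • x • v = x • r • v)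
    (a b : R) (v : V) (hv : (a * b - b * a) • v ≠ 0) :
    ∃ w : Fin 2 → V, LinearIndependent K w := by
  by_contra hno
  have hv0 : v ≠ 0 := by rintro rfl; simp at hv
  have hr : ∀ r : R, ∃ x : K, r • v = x • v := by
    intro r
    by_contra hx
    push Not at hx
    apply hno
    refine ⟨![v, r • v], ?_⟩
    rw [LinearIndependent.pair_iff' hv0]
    intro x h; exact hx x h.symm
  obtain ⟨x, hx⟩ := hr a
  obtain ⟨y, hy⟩ := hr b
  apply hv
  rw [sub_smul, mul_smul, mul_smul, hx, hy, hc, hc, hx, hy, smul_smul, smul_smul, mul_comm, sub_self]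

end helpers

section helpers2

theorem simple_module_M2 {k : Type u} {R : Type*} {V : Type v} [CommRing k] [Ring R] [Algebra k R]
    [AddCommGroup V] [Module R V] [Module k V] [IsScalarTower k R V] [IsSimpleModule R V]
    (hcomm : ∀ x y : Module.End R V, x * y = y * x)
    (a b : R) (v : V) (hv : (a * b - b * a) • v ≠ 0) :
    ∃ p : Ideal k, p.IsPrime ∧ ∀ q : FreeAlgebra k ℕ, IsPolyId k R q →
        IsPolyId k (Matrix (Fin 2) (Fin 2) (FractionRing (k ⧸ p))) q := by
  obtain ⟨K, _, _, _, _, hc, hd, _⟩ := exists_field_dense (k := k) hcomm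
  obtain ⟨w, hw⟩ := exists_indep_pair hc a b v hv
  obtain ⟨p, hp, hpq⟩ := exists_prime_of_field (k := k) (K := K)
  exact ⟨p, hp, fun q hq => hpq q (matrix_of_dense hc hd w hw q hq)⟩

theorem finite_algebra_M2 {k : Type u} {G : Type v} [CommRing k] [Ring G] [Algebra k G] [Finite G]
    (a b : G) (hn : ¬ IsNilpotent (a * b - b * a)) :
    ∃ p : Ideal k, p.IsPrime ∧ ∀ q : FreeAlgebra k ℕ, IsPolyId k G q →
        IsPolyId k (Matrix (Fin 2) (Fin 2) (FractionRing (k ⧸ p))) q := by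
  classical
  have hJ : a * b - b * a ∉ Ideal.jacobson (⊥ : Ideal G) := by
    intro hmem
    obtain ⟨n, hnil⟩ := IsArtinianRing.isNilpotent_jacobson_bot (R := G)
    apply hn
    refine ⟨n, ?_⟩
    have := Ideal.pow_mem_pow hmem n
    rw [hnil] at this
    exact this
  rw [Ideal.jacobson, Ideal.mem_sInf] at hJ
  push Not at hJ
  obtain ⟨M, ⟨-, hM⟩, hcM⟩ := hJ
  have : IsSimpleModule G (G ⧸ (M : Submodule G G)) := by
    rw [isSimpleModule_iff_isCoatom]
    exact hM.out
  have hfin : Finite (G ⧸ (M : Submodule G G)) :=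
    Finite.of_surjective _ (Submodule.mkQ_surjective (M : Submodule G G))
  have hfin2 : Finite (Module.End G (G ⧸ (M : Submodule G G))) :=
    Finite.of_injective (fun f : Module.End G (G ⧸ (M : Submodule G G)) =>
      (f : (G ⧸ (M : Submodule G G)) → (G ⧸ (M : Submodule G G)))) DFunLike.coe_injective
  refine simple_module_M2 (k := k) (V := G ⧸ (M : Submodule G G)) (fun x y => ?_) a b
    (Submodule.Quotient.mk 1) ?_
  · exact (littleWedderburn (Module.End G (G ⧸ (M : Submodule G G)))).mul_comm x y
  · rw [← Submodule.Quotient.mk_smul, Ne, Submodule.Quotient.mk_eq_zero]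
    simpa using hcM

/-- Reduction of two matrices over a field, finite over the image of `k`, to a finite field. -/
theorem matrices_M2 {k : Type u} {K : Type v} [CommRing k] [Field K] [Algebra k K]
    (hfin : Finite (algebraMap k K).range) {r : ℕ} (a b : Matrix (Fin r) (Fin r) K)
    (hn : ¬ IsNilpotent (a * b - b * a)) :
    ∃ p : Ideal k, p.IsPrime ∧ ∀ q : FreeAlgebra k ℕ,
      (∀ w : ℕ → FreeAlgebra k Bool,
        FreeAlgebra.lift k (fun i => cond i a b) (FreeAlgebra.lift k w q) = 0) →
        IsPolyId k (Matrix (Fin 2) (Fin 2) (FractionRing (k ⧸ p))) q := by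
  classical
  let F := (algebraMap k K).range
  have hF : IsField F := Finite.isDomain_to_isField F
  let _ : Field F := hF.toField
  let s : Set K := Set.range (fun ij : Fin r × Fin r => a ij.1 ij.2) ∪
    Set.range (fun ij : Fin r × Fin r => b ij.1 ij.2)
  have hs : s.Finite := (Set.finite_range _).union (Set.finite_range _)
  let L := Algebra.adjoin F s
  have hLft : Algebra.FiniteType F L :=
    (Subalgebra.fg_iff_finiteType _).1 (Subalgebra.fg_def.2 ⟨s, hs, rfl⟩)
  let _ : Algebra k F := ((algebraMap k K).rangeRestrict).toAlgebra
  have : IsScalarTower k F K := IsScalarTower.of_algebraMap_eq (fun x => rfl)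
  let _ : Algebra k L := ((algebraMap F L).comp (algebraMap k F)).toAlgebra
  have : IsScalarTower k F L := IsScalarTower.of_algebraMap_eq (fun x => rfl)
  let ι : L →ₐ[k] K := { L.val.toRingHom with commutes' := fun x => rfl }
  have hι : Function.Injective ι := Subtype.val_injective
  let a0 : Matrix (Fin r) (Fin r) L := fun i j =>
    ⟨a i j, Algebra.subset_adjoin (Or.inl ⟨(i, j), rfl⟩)⟩
  let b0 : Matrix (Fin r) (Fin r) L := fun i j =>
    ⟨b i j, Algebra.subset_adjoin (Or.inr ⟨(i, j), rfl⟩)⟩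
  have ha0 : ι.mapMatrix a0 = a := by ext i j; rfl
  have hb0 : ι.mapMatrix b0 = b := by ext i j; rfl
  let c0 := a0 * b0 - b0 * a0
  have hc0 : ι.mapMatrix c0 = a * b - b * a := by simp only [c0, map_sub, map_mul, ha0, hb0]
  have hne : c0 ^ r ≠ 0 := by
    intro h0
    apply hn
    refine ⟨r, ?_⟩
    rw [← hc0, ← map_pow, h0, map_zero]
  obtain ⟨i, j, hij⟩ : ∃ i j, (c0 ^ r) i j ≠ 0 := by
    by_contra hcon
    push Not at hcon
    exact hne (by ext i j; simp [hcon])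
  have hJac : IsJacobsonRing L := isJacobsonRing_of_finiteType (A := F)
  have hbot : Ideal.jacobson (⊥ : Ideal L) = ⊥ :=
    hJac.out ((Ideal.isPrime_bot (α := L)).isRadical)
  have hnot : (c0 ^ r) i j ∉ Ideal.jacobson (⊥ : Ideal L) := by
    rw [hbot]; simpa using hij
  rw [Ideal.jacobson, Ideal.mem_sInf] at hnot
  push Not at hnot
  obtain ⟨m, ⟨-, hm⟩, hcm⟩ := hnot
  let _ : Field (L ⧸ m) := Ideal.Quotient.field m
  have hft : Algebra.FiniteType F (L ⧸ m) := inferInstance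
  have hfinm : Module.Finite F (L ⧸ m) := finite_of_finite_type_of_isJacobsonRing F (L ⧸ m)
  have : Finite (L ⧸ m) := Module.finite_of_finite F
  let π : L →ₐ[k] (L ⧸ m) := Ideal.Quotient.mkₐ k m
  let Q : Bool → Matrix (Fin r) (Fin r) (L ⧸ m) := fun i => cond i (π.mapMatrix a0) (π.mapMatrix b0)
  let φ : FreeAlgebra k Bool →ₐ[k] Matrix (Fin r) (Fin r) (L ⧸ m) := FreeAlgebra.lift k Q
  have hcnil : ¬ IsNilpotent (π.mapMatrix c0) := by
    intro hnil
    have h1 : (π.mapMatrix c0) ^ r = 0 := by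
      have := Matrix.isNilpotent_charpoly_sub_pow_of_isNilpotent hnil
      have h2 := this.eq_zero
      have h3 := Matrix.aeval_self_charpoly (π.mapMatrix c0)
      rw [sub_eq_zero] at h2
      rw [h2] at h3
      simpa using h3
    apply hcm
    rw [← map_pow] at h1
    have := congrFun (congrFun h1 i) j
    exact Ideal.Quotient.eq_zero_iff_mem.1 this
  have hfinG : Finite φ.range := Subtype.finite
  let A' : φ.range := φ.rangeRestrict (FreeAlgebra.ι k true)
  let B' : φ.range := φ.rangeRestrict (FreeAlgebra.ι k false)
  have hA' : (A' : Matrix (Fin r) (Fin r) (L ⧸ m)) = π.mapMatrix a0 := by simp [A', φ, Q]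
  have hB' : (B' : Matrix (Fin r) (Fin r) (L ⧸ m)) = π.mapMatrix b0 := by simp [B', φ, Q]
  obtain ⟨p, hp, hpq⟩ := finite_algebra_M2 (k := k) A' B' (by
    intro hnil
    apply hcnil
    have := hnil.map φ.range.val
    rw [map_sub, map_mul, map_mul] at this
    simp only [c0, map_sub, map_mul]
    rw [← hA', ← hB']
    exact this)
  refine ⟨p, hp, fun q hq => hpq q fun f => ?_⟩
  choose w hw using fun i => (f i).2
  have hf : f = fun i => φ.rangeRestrict (w i) := by
    funext i; apply Subtype.ext; exact (hw i).symm
  rw [hf, ← lift_natural]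
  have h0 := hq w
  set u := FreeAlgebra.lift k w q
  have h1 : FreeAlgebra.lift k (fun i : Bool => cond i a0 b0) u = 0 := by
    apply Matrix.map_injective hι
    have := lift_natural ι.mapMatrix (fun i : Bool => cond i a0 b0) u
    have e : (fun i : Bool => ι.mapMatrix (cond i a0 b0)) = fun i : Bool => cond i a b := by
      funext i; cases i <;> simp only [cond, ha0, hb0]
    rw [e, h0] at this
    exact this.trans (map_zero ι.mapMatrix).symm
  have h2 := lift_natural π.mapMatrix (fun i : Bool => cond i a0 b0) u
  have e : (fun i : Bool => π.mapMatrix (cond i a0 b0)) = Q := by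
    funext i; cases i <;> rfl
  rw [h1, map_zero, e] at h2
  apply Subtype.ext
  exact h2.symm

end helpers2

section helpers3

/-- The monic multilinear polynomial. -/
noncomputable def properPoly (k : Type*) [CommRing k] (n : ℕ) (c : Equiv.Perm (Fin n) → k) :
    FreeAlgebra k ℕ :=
  ((List.finRange n).map (fun i => FreeAlgebra.ι k (i : ℕ))).prod
        + ∑ σ ∈ Finset.univ.erase (1 : Equiv.Perm (Fin n)),
            c σ • ((List.finRange n).map (fun i => FreeAlgebra.ι k ((σ i : Fin n) : ℕ))).prod

theorem lift_properPoly {k A : Type*} [CommRing k] [Ring A] [Algebra k A] (n : ℕ)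
    (c : Equiv.Perm (Fin n) → k) (e : ℕ → A) :
    FreeAlgebra.lift k e (properPoly k n c) =
      ((List.finRange n).map (fun i : Fin n => e (i : ℕ))).prod
        + ∑ σ ∈ Finset.univ.erase (1 : Equiv.Perm (Fin n)),
            c σ • ((List.finRange n).map (fun i => e ((σ i : Fin n) : ℕ))).prod := by
  have h1 : (List.finRange n >>= fun a : Fin n => pure (a : ℕ)) =
      (List.finRange n).map (fun a : Fin n => (a : ℕ)) :=
    List.flatMap_pure_eq_map _ _
  simp only [properPoly, map_add, map_list_prod, map_sum, map_smul, List.map_map]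
  rw [h1]
  simp only [List.map_map, Function.comp_def, FreeAlgebra.lift_ι_apply]

theorem staircase_list {R V : Type*} [Ring R] [AddCommGroup V] [Module R V] (n : ℕ)
    (v : ℕ → V) (e : ℕ → R) (he : ∀ i, ∀ j ≤ n, e i • v j = if j = i + 1 then v i else 0)
    (l : List ℕ) : ∀ j ≤ n, (l.map e).prod • v j ≠ 0 →
      l.length ≤ j ∧ l = List.range' (j - l.length) l.length := by
  induction l using List.reverseRecOn with
  | nil => intro j hj _; simp
  | append_singleton l x ih =>
    intro j hj h
    rw [List.map_append, List.prod_append, List.map_singleton, List.prod_singleton, mul_smul,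
      he x j hj] at h
    by_cases hx : j = x + 1
    · rw [if_pos hx] at h
      obtain ⟨h1, h2⟩ := ih x (by omega) h
      refine ⟨by simp; omega, ?_⟩
      have h3 : j - (l ++ [x]).length = x - l.length := by simp; omega
      rw [h3, List.length_append, List.length_singleton, List.range'_concat, ← h2]
      congr 2
      omega
    · rw [if_neg hx, smul_zero] at h
      exact absurd rfl h

theorem staircase {k R V K : Type*} [CommRing k] [Ring R] [Algebra k R]
    [AddCommGroup V] [Module R V] [Module k V] [IsScalarTower k R V]
    [Field K] [Module K V]
    (hd : ∀ (n : ℕ) (v : Fin n → V), LinearIndependent K v → ∀ w : Fin n → V,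
        ∃ r : R, ∀ i, r • v i = w i) (n : ℕ) (c : Equiv.Perm (Fin n) → k)
    (hg : IsPolyId k R (properPoly k n c)) (v : Fin (n + 1) → V)
    (hv : LinearIndependent K v) : False := by
  classical
  let v' : ℕ → V := fun j => if h : j < n + 1 then v ⟨j, h⟩ else 0
  choose e he using fun i : ℕ =>
    hd (n + 1) v hv (fun j => if (j : ℕ) = i + 1 then v' i else 0)
  have he' : ∀ i, ∀ j ≤ n, e i • v' j = if j = i + 1 then v' i else 0 := by
    intro i j hj
    have := he i ⟨j, by omega⟩
    simp only [v', dif_pos (show j < n + 1 by omega)]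
    exact this
  have h0 := hg e
  rw [lift_properPoly] at h0
  have h1 : ∀ m ≤ n, ((List.range m).map e).prod • v' m = v' 0 := by
    intro m
    induction m with
    | zero => intro _; simp
    | succ m ih =>
      intro hm
      rw [List.range_succ, List.map_append, List.prod_append, List.map_singleton,
        List.prod_singleton, mul_smul, he' m _ hm, if_pos rfl, ih (by omega)]
  have h2 : ∀ σ ∈ Finset.univ.erase (1 : Equiv.Perm (Fin n)),
      (c σ • ((List.finRange n).map (fun i => e ((σ i : Fin n) : ℕ))).prod) • v' n = 0 := by
    intro σ hσ
    rw [smul_assoc]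
    by_contra hne
    have hne' := right_ne_zero_of_smul hne
    have h3 : (List.finRange n).map (fun i => e ((σ i : Fin n) : ℕ)) =
        ((List.finRange n).map (fun i => ((σ i : Fin n) : ℕ))).map e := by
      simp [Function.comp_def]
    rw [h3] at hne'
    obtain ⟨-, h4⟩ := staircase_list n v' e he' _ n le_rfl hne'
    apply (Finset.mem_erase.1 hσ).1
    ext i
    have h5 := congrArg (fun l => l[(i : ℕ)]?) h4
    simpa using h5
  have h3 : ((List.finRange n).map (fun i : Fin n => e (i : ℕ))).prod • v' n = v' 0 := by
    rw [← h1 n le_rfl, ← List.map_coe_finRange_eq_range, List.map_map]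
    rfl
  have h4 := congrArg (fun x => x • v' n) h0
  simp only [add_smul, Finset.sum_smul, zero_smul] at h4
  rw [Finset.sum_eq_zero h2, h3, add_zero] at h4
  simp only [v', dif_pos (Nat.succ_pos n)] at h4
  exact hv.ne_zero _ h4

theorem list_prod_mul_of_commute {W ι : Type*} [Ring W] (b c : ι → W)
    (h : ∀ i j, Commute (b i) (c j)) (l : List ι) :
    (l.map (fun i => b i * c i)).prod = (l.map b).prod * (l.map c).prod := by
  induction l with
  | nil => simp
  | cons x l ih =>
    have h1 : Commute (c x) (l.map b).prod := by
      apply Commute.list_prod_right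
      intro y hy
      obtain ⟨z, -, rfl⟩ := List.mem_map.1 hy
      exact (h z x).symm
    simp only [List.map_cons, List.prod_cons, ih]
    rw [mul_assoc, mul_assoc, ← mul_assoc (c x), h1.eq, mul_assoc]

theorem multilinear_extend {k W : Type*} [CommRing k] [Ring W] [Algebra k W]
    (H C : Set W) (n : ℕ) (c : Equiv.Perm (Fin n) → k)
    (hH : ∀ f : ℕ → W, (∀ i, f i ∈ H) → FreeAlgebra.lift k f (properPoly k n c) = 0)
    (h1 : (1 : W) ∈ H)
    (hHC : ∀ x ∈ H, ∀ y ∈ C, Commute x y) (hCC : ∀ x ∈ C, ∀ y ∈ C, Commute x y)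
    (e : ℕ → W) (he : ∀ i, ∃ S : Finset (H × C), e i = ∑ x ∈ S, (x.1 : W) * (x.2 : W)) :
    FreeAlgebra.lift k e (properPoly k n c) = 0 := by
  classical
  choose S hS using he
  let P : MultilinearMap k (fun _ : Fin n => W) W := MultilinearMap.mkPiAlgebraFin k n W
  let Gm : MultilinearMap k (fun _ : Fin n => W) W :=
    P + ∑ σ ∈ Finset.univ.erase (1 : Equiv.Perm (Fin n)), c σ • P.domDomCongr σ
  have hGm : ∀ f : Fin n → W, Gm f = ((List.finRange n).map f).prod
      + ∑ σ ∈ Finset.univ.erase (1 : Equiv.Perm (Fin n)),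
        c σ • ((List.finRange n).map (fun i => f (σ i))).prod := by
    intro f
    simp [Gm, P, List.ofFn_eq_map]
  have hlift : ∀ f : ℕ → W, FreeAlgebra.lift k f (properPoly k n c) = Gm (fun i => f i) := by
    intro f
    rw [lift_properPoly, hGm]
  rw [hlift]
  simp_rw [hS]
  rw [MultilinearMap.map_sum_finset]
  refine Finset.sum_eq_zero fun r _ => ?_
  have hcomm : ∀ i j, Commute ((r i).1 : W) ((r j).2 : W) := fun i j =>
    hHC _ (r i).1.2 _ (r j).2.2
  have hperm : ∀ σ : Equiv.Perm (Fin n),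
      ((List.finRange n).map (fun i => ((r (σ i)).1 : W) * ((r (σ i)).2 : W))).prod =
      ((List.finRange n).map (fun i => ((r (σ i)).1 : W))).prod *
        ((List.finRange n).map (fun i => ((r i).2 : W))).prod := by
    intro σ
    rw [list_prod_mul_of_commute (fun i => ((r (σ i)).1 : W)) (fun i => ((r (σ i)).2 : W))
      (fun i j => hcomm _ _)]
    congr 1
    apply List.Perm.prod_eq'
    · rw [← List.ofFn_eq_map, ← List.ofFn_eq_map]
      exact Equiv.Perm.ofFn_comp_perm σ (fun i => ((r i).2 : W))
    · rw [List.pairwise_map]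
      rw [List.pairwise_iff_getElem]
      intros
      exact hCC _ (r _).2.2 _ (r _).2.2
  have h0 := hH (fun i => if h : i < n then ((r ⟨i, h⟩).1 : W) else 1) (by
    intro i
    by_cases h : i < n
    · simp only [dif_pos h]; exact (r ⟨i, h⟩).1.2
    · simp only [dif_neg h]; exact h1)
  rw [hlift, hGm] at h0
  simp only [Fin.is_lt, dif_pos, Fin.eta] at h0
  have hp1 := hperm 1
  simp only [Equiv.Perm.one_apply] at hp1
  rw [hGm, hp1]
  simp_rw [hperm]
  simp only [← smul_mul_assoc]
  rw [← Finset.sum_mul, ← add_mul]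
  rw [h0, zero_mul]

theorem exists_evHom {k H W : Type*} [CommRing k] [Ring H] [Algebra k H] [Ring W] [Algebra k W]
    (φ : H →ₐ[k] W) (z : W) (hz : ∀ x, Commute (φ x) z) :
    ∃ ev : Polynomial H →ₐ[k] W, (∀ x, ev (Polynomial.C x) = φ x) ∧ ev Polynomial.X = z ∧
      ∀ P, ev P = ∑ j ∈ P.support, φ (P.coeff j) * z ^ j := by
  refine ⟨Polynomial.eval₂AlgHom φ z hz, ?_, ?_, ?_⟩
  · intro x; simp
  · simp
  · intro P
    simp [Polynomial.eval₂_eq_sum, Polynomial.sum]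

theorem polynomial_isPolyId {k V K H : Type*} [CommRing k]
    [AddCommGroup V] [Module k V]
    [Field K] [Algebra k K] [Module K V] [IsScalarTower k K V]
    (hinf : (Set.range (algebraMap k K)).Infinite) [Ring H] [Algebra k H]
    (φ : H →ₐ[k] Module.End k V) (hφ : Function.Injective φ)
    (q : FreeAlgebra k ℕ) (hq : IsPolyId k H q) :
    IsPolyId k (Polynomial H) q := by
  intro f
  set P := FreeAlgebra.lift k f q with hP
  have h1 : ∀ a : k, ∑ j ∈ P.support, a ^ j • P.coeff j = 0 := by
    intro a
    obtain ⟨ev, -, -, hev⟩ := exists_evHom (AlgHom.id k H) (algebraMap k H a)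
      (fun x => (Algebra.commutes a x).symm)
    have h2 : ev P = 0 := by rw [hP, lift_natural, hq]
    rw [← h2, hev]
    refine Finset.sum_congr rfl fun j _ => ?_
    rw [← map_pow, ← Algebra.commutes, ← Algebra.smul_def]
    rfl
  refine Polynomial.ext fun j => ?_
  rw [Polynomial.coeff_zero]
  apply hφ
  rw [map_zero]
  refine LinearMap.ext fun v => ?_
  simp only [LinearMap.zero_apply]
  rw [← Module.forall_dual_apply_eq_zero_iff K]
  intro ℓ
  let Q : Polynomial K := ∑ j ∈ P.support, Polynomial.C (ℓ (φ (P.coeff j) v)) *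
    Polynomial.X ^ j
  have hQ : Q = 0 := by
    apply Polynomial.eq_zero_of_infinite_isRoot
    refine hinf.mono ?_
    rintro _ ⟨a, rfl⟩
    have h4 := congrArg (fun h : H => ℓ (φ h v)) (h1 a)
    simp only [LinearMap.sum_apply, map_sum, LinearMap.zero_apply, map_zero] at h4
    simp only [Set.mem_ofPred_eq, Polynomial.IsRoot, Q, Polynomial.eval_finsetSum,
      Polynomial.eval_mul, Polynomial.eval_C, Polynomial.eval_pow, Polynomial.eval_X]
    rw [← h4]
    refine Finset.sum_congr rfl fun j _ => ?_
    rw [map_smul, LinearMap.smul_apply, ← algebraMap_smul K (a ^ j), map_smul,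
      smul_eq_mul, map_pow, mul_comm]
  have h5 := congrArg (fun p => p.coeff j) hQ
  simp only [Q, Polynomial.finsetSum_coeff, Polynomial.coeff_C_mul, Polynomial.coeff_X_pow,
    Polynomial.coeff_zero, mul_ite, mul_one, mul_zero] at h5
  rw [Finset.sum_ite_eq] at h5
  by_cases hj : j ∈ P.support
  · rwa [if_pos hj] at h5
  · rw [Polynomial.notMem_support_iff.1 hj]
    simp

/-- A polynomial involves only finitely many variables. -/
theorem finite_vars {k : Type*} [CommRing k] (q : FreeAlgebra k ℕ) :
    ∃ N : ℕ, ∀ q' ∈ ({q} : Set (FreeAlgebra k ℕ)),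
      q' ∈ Algebra.adjoin k (FreeAlgebra.ι k '' {i | i < N}) := by
  simp only [Set.mem_singleton_iff, forall_eq]
  induction q using FreeAlgebra.induction with
  | grade0 r => exact ⟨0, Subalgebra.algebraMap_mem _ r⟩
  | grade1 x => exact ⟨x + 1, Algebra.subset_adjoin ⟨x, by simp, rfl⟩⟩
  | mul a b ha hb =>
    obtain ⟨N, hN⟩ := ha
    obtain ⟨M, hM⟩ := hb
    have mono : ∀ {s t : ℕ}, s ≤ t → Algebra.adjoin k (FreeAlgebra.ι k '' {i | i < s}) ≤
        Algebra.adjoin k (FreeAlgebra.ι k '' {i | i < t}) := fun h =>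
      Algebra.adjoin_mono (Set.image_mono fun i (hi : i < _) => lt_of_lt_of_le hi h)
    exact ⟨max N M, mul_mem (mono (le_max_left N M) hN) (mono (le_max_right N M) hM)⟩
  | add a b ha hb =>
    obtain ⟨N, hN⟩ := ha
    obtain ⟨M, hM⟩ := hb
    have mono : ∀ {s t : ℕ}, s ≤ t → Algebra.adjoin k (FreeAlgebra.ι k '' {i | i < s}) ≤
        Algebra.adjoin k (FreeAlgebra.ι k '' {i | i < t}) := fun h =>
      Algebra.adjoin_mono (Set.image_mono fun i (hi : i < _) => lt_of_lt_of_le hi h)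
    exact ⟨max N M, add_mem (mono (le_max_left N M) hN) (mono (le_max_right N M) hM)⟩

theorem lift_congr_vars {k A : Type*} [CommRing k] [Ring A] [Algebra k A] (q : FreeAlgebra k ℕ) :
    ∃ N : ℕ, ∀ f g : ℕ → A, (∀ i < N, f i = g i) →
      FreeAlgebra.lift k f q = FreeAlgebra.lift k g q := by
  obtain ⟨N, hN⟩ := finite_vars q
  refine ⟨N, fun f g hfg => ?_⟩
  have h1 : Algebra.adjoin k (FreeAlgebra.ι k '' {i | i < N}) ≤
      AlgHom.equalizer (FreeAlgebra.lift k f) (FreeAlgebra.lift k g) := by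
    rw [Algebra.adjoin_le_iff]
    rintro _ ⟨i, hi, rfl⟩
    change FreeAlgebra.lift k f _ = FreeAlgebra.lift k g _
    simpa using hfg i hi
  exact h1 (hN q rfl)

theorem isPolyId_extend {k V K : Type*} [CommRing k]
    [AddCommGroup V] [Module k V]
    [Field K] [Algebra k K] [Module K V] [IsScalarTower k K V]
    (hinf : (Set.range (algebraMap k K)).Infinite)
    (H : Subalgebra k (Module.End k V)) (C : Set (Module.End k V))
    (hHC : ∀ x ∈ H, ∀ y ∈ C, Commute x y) (hCC : ∀ x ∈ C, ∀ y ∈ C, Commute x y)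
    (q : FreeAlgebra k ℕ) (hq : IsPolyId k H q) 
    (e : ℕ → Module.End k V)
    (he : ∀ i, ∃ S : Finset (H × C), e i = ∑ x ∈ S, (x.1 : Module.End k V) * (x.2 : Module.End k V)) :
    FreeAlgebra.lift k e q = 0 := by
  classical
  have key : ∀ Y : Finset (Module.End k V), (Y : Set (Module.End k V)) ⊆ C →
      ∃ H' : Subalgebra k (Module.End k V), H ≤ H' ∧ (Y : Set (Module.End k V)) ⊆ H' ∧
        (∀ x ∈ H', ∀ y ∈ C, Commute x y) ∧ IsPolyId k H' q := by
    intro Y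
    induction Y using Finset.induction_on with
    | empty => intro _; exact ⟨H, le_rfl, by simp, hHC, hq⟩
    | insert z Y _ ih =>
      intro hY
      rw [Finset.coe_insert, Set.insert_subset_iff] at hY
      obtain ⟨H₁, hle, hY1, hcm, hq1⟩ := ih hY.2
      obtain ⟨ev, ev1, ev2, ev3⟩ := exists_evHom H₁.val z (fun x => hcm x x.2 z hY.1)
      have hle1 : H₁ ≤ ev.range := fun x hx =>
        ⟨Polynomial.C ⟨x, hx⟩, ev1 ⟨x, hx⟩⟩
      refine ⟨ev.range, hle.trans hle1, ?_, ?_,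
        (polynomial_isPolyId hinf H₁.val Subtype.val_injective q hq1).range ev⟩
      · rw [Finset.coe_insert, Set.insert_subset_iff]
        exact ⟨⟨Polynomial.X, ev2⟩, hY1.trans hle1⟩
      · rintro _ ⟨p, rfl⟩ y hy
        change Commute (ev p) y
        rw [ev3]
        refine Commute.sum_left _ _ _ fun j _ => ?_
        exact (hcm _ (p.coeff j).2 y hy).mul_left ((hCC z hY.1 y hy).pow_left j)
  choose S hS using he
  obtain ⟨N, hN⟩ := lift_congr_vars (A := Module.End k V) q
  obtain ⟨H', hle, hY, -, hq'⟩ := key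
    ((Finset.range N).biUnion fun i => (S i).image fun x => (x.2 : Module.End k V)) (by
      intro y hy
      simp only [Finset.coe_biUnion, Set.mem_iUnion, Finset.coe_image, Set.mem_image] at hy
      obtain ⟨i, _, x, _, rfl⟩ := hy
      exact x.2.2)
  have hmem : ∀ i < N, e i ∈ H' := by
    intro i hi
    rw [hS]
    refine sum_mem fun x hx => mul_mem (hle x.1.2) (hY ?_)
    simp only [Finset.coe_biUnion, Set.mem_iUnion, Finset.coe_image, Set.mem_image]
    exact ⟨i, by simpa using hi, x, hx, rfl⟩
  let e' : ℕ → H' := fun i => if h : i < N then ⟨e i, hmem i h⟩ else 0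
  rw [hN e (fun i => H'.val (e' i)) (fun i hi => by simp [e', hi]), ← lift_natural, hq', map_zero]

end helpers3

section helpers4

theorem exists_simple {k : Type u} {B : Type v} [CommRing k] [Ring B] [Algebra k B] (c : B)
    (hc : ¬ IsNilpotent c) :
    ∃ (V : Type v) (_ : AddCommGroup V) (_ : Module k V) (ρ : B →ₐ[k] Module.End k V)
      (t : Module.End k V) (v : V), v ≠ 0 ∧ (ρ c * t) v = v ∧ (∀ b, Commute (ρ b) t) ∧
      ∀ N : AddSubgroup V, (∀ b, ∀ x ∈ N, ρ b x ∈ N) → (∀ x ∈ N, t x ∈ N) → N = ⊥ ∨ N = ⊤ := by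
  let I : Ideal (Polynomial B) := Ideal.span {1 - Polynomial.C c * Polynomial.X}
  have hI : I ≠ ⊤ := by
    intro hI
    rw [Ideal.eq_top_iff_one, Ideal.mem_span_singleton'] at hI
    obtain ⟨u, hu⟩ := hI
    have h0 : u.coeff 0 = 1 := by
      have := congrArg (fun p => p.coeff 0) hu
      simpa [mul_sub, ← mul_assoc] using this
    have h1 : ∀ n, u.coeff (n + 1) = u.coeff n * c := by
      intro n
      have := congrArg (fun p => p.coeff (n + 1)) hu
      simp only [mul_sub, ← mul_assoc, mul_one, Polynomial.coeff_sub, Polynomial.coeff_mul_X,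
        Polynomial.coeff_mul_C, Polynomial.coeff_one, Nat.succ_ne_zero, if_false] at this
      exact sub_eq_zero.1 this
    have h2 : ∀ n, u.coeff n = c ^ n := by
      intro n
      induction n with
      | zero => simpa using h0
      | succ n ih => rw [h1, ih, pow_succ]
    apply hc
    refine ⟨u.natDegree + 1, ?_⟩
    rw [← h2]
    exact Polynomial.coeff_eq_zero_of_natDegree_lt (Nat.lt_succ_self _)
  obtain ⟨M, hM, hIM⟩ := Ideal.exists_le_maximal I hI
  let M' : Submodule (Polynomial B) (Polynomial B) := M
  let V := Polynomial B ⧸ M'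
  have hsimple : IsSimpleModule (Polynomial B) V := by
    rw [isSimpleModule_iff_isCoatom]
    exact hM.out
  let σ : Polynomial B →ₐ[k] Module.End k V := Algebra.lsmul k k V
  have hσ : ∀ p x, σ p x = p • x := fun p x => rfl
  refine ⟨V, inferInstance, inferInstance, σ.comp (Polynomial.CAlgHom), σ Polynomial.X,
    M'.mkQ 1, ?_, ?_, ?_, ?_⟩
  · rw [Submodule.mkQ_apply, Ne, Submodule.Quotient.mk_eq_zero]
    exact fun h => hM.ne_top ((Ideal.eq_top_iff_one _).2 h)
  · have h3 : (1 - Polynomial.C c * Polynomial.X : Polynomial B) ∈ M :=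
      hIM (Ideal.subset_span rfl)
    have h4 : M'.mkQ (1 - Polynomial.C c * Polynomial.X) = 0 := by
      rw [Submodule.mkQ_apply, Submodule.Quotient.mk_eq_zero]; exact h3
    rw [map_sub, sub_eq_zero] at h4
    rw [AlgHom.comp_apply, ← map_mul, hσ, ← map_smul, smul_eq_mul, mul_one]
    exact h4.symm
  · intro b
    have h : Commute (Polynomial.C b) (Polynomial.X : Polynomial B) := (Polynomial.X_mul_C b).symm
    exact h.map σ
  · intro N hN1 hN2
    have hstab : ∀ p : Polynomial B, ∀ x ∈ N, p • x ∈ N := by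
      intro p
      induction p using Polynomial.induction_on' with
      | add p q hp hq => intro x hx; rw [add_smul]; exact N.add_mem (hp x hx) (hq x hx)
      | monomial n a =>
        intro x hx
        have hX : ∀ n : ℕ, (Polynomial.X ^ n : Polynomial B) • x ∈ N := by
          intro n
          induction n with
          | zero => simpa using hx
          | succ n ih => rw [pow_succ', mul_smul]; exact hN2 _ ih
        rw [← Polynomial.C_mul_X_pow_eq_monomial, mul_smul]
        exact hN1 a _ (hX n)
    let N' : Submodule (Polynomial B) V := { N with smul_mem' := fun p x hx => hstab p x hx }
    rcases eq_bot_or_eq_top N' with h | h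
    · left
      ext x
      have : x ∈ N' ↔ x ∈ (⊥ : Submodule (Polynomial B) V) := by rw [h]
      exact this
    · right
      ext x
      have : x ∈ N' ↔ x ∈ (⊤ : Submodule (Polynomial B) V) := by rw [h]
      exact this

theorem core_M2 {k : Type u} {B V : Type v} [CommRing k] [Ring B] [Algebra k B]
    [AddCommGroup V] [Module k V] (ρ : B →ₐ[k] Module.End k V) (t : Module.End k V) (v : V)
    (a b : B) (hv : v ≠ 0) (hcv : (ρ (a * b - b * a) * t) v = v) (ht : ∀ b, Commute (ρ b) t)
    (hirr : ∀ N : AddSubgroup V, (∀ b, ∀ x ∈ N, ρ b x ∈ N) → (∀ x ∈ N, t x ∈ N) → N = ⊥ ∨ N = ⊤)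
    (n : ℕ) (c : Equiv.Perm (Fin n) → k) (hPI : IsPolyId k B (properPoly k n c)) :
    ∃ p : Ideal k, p.IsPrime ∧ ∀ q : FreeAlgebra k ℕ, IsPolyId k B q →
        IsPolyId k (Matrix (Fin 2) (Fin 2) (FractionRing (k ⧸ p))) q := by
  classical
  -- a maximal commuting set in the centralizer of the image of `B`
  let P : Set (Set (Module.End k V)) := {X | (∀ x ∈ X, ∀ y ∈ X, Commute x y) ∧
    ∀ x ∈ X, ∀ b, Commute (ρ b) x}
  obtain ⟨X, htX, hXmax⟩ := zorn_subset_nonempty P (by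
    intro ch hch hchain hne
    refine ⟨⋃₀ ch, ⟨?_, ?_⟩, fun s hs => Set.subset_sUnion_of_mem hs⟩
    · rintro x ⟨s, hs, hxs⟩ y ⟨s', hs', hys⟩
      rcases hchain.total hs hs' with h | h
      · exact (hch hs').1 x (h hxs) y hys
      · exact (hch hs).1 x hxs y (h hys)
    · rintro x ⟨s, hs, hxs⟩ b
      exact (hch hs).2 x hxs b) {t} (by
    refine ⟨?_, ?_⟩
    · rintro x rfl y rfl; exact Commute.refl _
    · rintro x rfl b; exact ht b)
  have hXP : X ∈ P := hXmax.prop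
  have hXc : ∀ z : Module.End k V, (∀ b, Commute (ρ b) z) → (∀ x ∈ X, Commute x z) → z ∈ X := by
    intro z h1 h2
    have hins : insert z X ∈ P := by
      refine ⟨?_, ?_⟩
      · rintro x (rfl | hx) y (rfl | hy)
        · exact Commute.refl _
        · exact (h2 y hy).symm
        · exact h2 x hx
        · exact hXP.1 x hx y hy
      · rintro x (rfl | hx) b
        · exact h1 b
        · exact hXP.2 x hx b
    exact hXmax.le_of_ge hins (Set.subset_insert z X) (Set.mem_insert z X)
  let H : Subalgebra k (Module.End k V) := ρ.range
  let C : Subalgebra k (Module.End k V) := Subalgebra.centralizer k ((H : Set _) ∪ X)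
  have hCX : ∀ z, z ∈ C ↔ z ∈ X := by
    intro z
    rw [Subalgebra.mem_centralizer_iff]
    constructor
    · intro h
      exact hXc z (fun b => h _ (Or.inl ⟨b, rfl⟩)) (fun x hx => h x (Or.inr hx))
    · rintro hz g (⟨b, rfl⟩ | hg)
      · exact hXP.2 z hz b
      · exact hXP.1 g hg z hz
  have hHC : ∀ x ∈ (H : Set (Module.End k V)), ∀ y ∈ (C : Set (Module.End k V)), Commute x y := by
    rintro _ ⟨b, rfl⟩ y hy
    exact hXP.2 y ((hCX y).1 hy) b
  have hCC : ∀ x ∈ (C : Set (Module.End k V)), ∀ y ∈ (C : Set (Module.End k V)), Commute x y :=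
    fun x hx y hy => hXP.1 x ((hCX x).1 hx) y ((hCX y).1 hy)
  let τ : TensorProduct k H C →ₐ[k] Module.End k V :=
    Algebra.TensorProduct.lift H.val C.val (fun x y => hHC x x.2 y y.2)
  let E : Subalgebra k (Module.End k V) := τ.range
  have hHE : ∀ b, ρ b ∈ E := fun b => ⟨(⟨ρ b, ⟨b, rfl⟩⟩ : H) ⊗ₜ 1, mul_one (ρ b)⟩
  have hCE : ∀ x ∈ C, x ∈ E := fun x hx => ⟨1 ⊗ₜ (⟨x, hx⟩ : C), one_mul x⟩
  have hEsum : ∀ e ∈ E, ∃ S : Finset (↥(H : Set (Module.End k V)) × ↥(C : Set (Module.End k V))),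
      e = ∑ x ∈ S, (x.1 : Module.End k V) * (x.2 : Module.End k V) := by
    rintro _ ⟨y, rfl⟩
    obtain ⟨S, hS⟩ := TensorProduct.exists_finset y
    refine ⟨S, ?_⟩
    change τ y = _
    rw [hS, map_sum]
    rfl
  -- simplicity
  have hnt : Nontrivial V := ⟨⟨v, 0, hv⟩⟩
  have hsimple : IsSimpleModule E V := by
    rw [isSimpleModule_iff]
    refine { exists_pair_ne := ⟨⊥, ⊤, bot_ne_top⟩, eq_bot_or_eq_top := fun N => ?_ }
    rcases hirr N.toAddSubgroup (fun b x hx => N.smul_mem ⟨ρ b, hHE b⟩ hx)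
      (fun x hx => N.smul_mem ⟨t, hCE t ((hCX t).2 (htX rfl))⟩ hx) with h | h
    · left
      refine (Submodule.eq_bot_iff N).2 fun x hx => ?_
      have hx' : x ∈ N.toAddSubgroup := hx
      rw [h] at hx'
      exact hx'
    · right
      ext x
      have : x ∈ N.toAddSubgroup := by rw [h]; trivial
      exact ⟨fun _ => trivial, fun _ => this⟩
  have hcomm : ∀ x y : Module.End E V, x * y = y * x := by
    have hmem : ∀ x : Module.End E V, (x.restrictScalars k : Module.End k V) ∈ X := by
      intro x
      apply hXc
      · intro b
        refine LinearMap.ext fun w => ?_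
        exact (map_smul x (⟨ρ b, hHE b⟩ : E) w).symm
      · intro y hy
        refine LinearMap.ext fun w => ?_
        exact (map_smul x (⟨y, hCE y ((hCX y).2 hy)⟩ : E) w).symm
    intro x y
    refine LinearMap.ext fun w => ?_
    exact congrArg (fun f : Module.End k V => f w) (hXP.1 _ (hmem x) _ (hmem y)).eq
  obtain ⟨K, _, _, _, _, hKc, hKd, _⟩ := exists_field_dense (k := k) (R := E) (V := V) hcomm
  by_cases hinf : (Set.range (algebraMap k K)).Infinite
  · -- infinite case
    obtain ⟨w, hw⟩ := exists_indep_pair hKc (⟨ρ a, hHE a⟩ : E) ⟨ρ b, hHE b⟩ (t v) (by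
      intro h0
      apply hv
      rw [← hcv, map_sub, map_mul, map_mul]
      exact h0)
    obtain ⟨p, hp, hpq⟩ := exists_prime_of_field (k := k) (K := K)
    refine ⟨p, hp, fun q hq => hpq q (matrix_of_dense hKc hKd w hw q ?_)⟩
    intro f
    apply Subtype.val_injective
    have := lift_natural E.val f q
    refine this.trans ?_
    exact isPolyId_extend hinf H C hHC hCC q (hq.range ρ) _ (fun i => hEsum _ (f i).2)
  · -- finite case
    have hEg : IsPolyId k E (properPoly k n c) := by
      intro f
      apply Subtype.val_injective
      have := lift_natural E.val f (properPoly k n c)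
      refine this.trans ?_
      refine multilinear_extend (H : Set (Module.End k V)) C n c ?_ H.one_mem hHC hCC _
        (fun i => hEsum _ (f i).2)
      intro g hg
      have h1 := lift_natural H.val (fun i => (⟨g i, hg i⟩ : H)) (properPoly k n c)
      rw [hPI.range ρ, map_zero] at h1
      exact h1.symm
    have hfd : Module.Finite K V := by
      let bas := Module.Basis.ofVectorSpace K V
      by_cases hfi : Finite (Module.Basis.ofVectorSpaceIndex K V)
      · exact Module.Finite.of_basis bas
      · exfalso
        have : Infinite (Module.Basis.ofVectorSpaceIndex K V) := not_finite_iff_infinite.1 hfi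
        let em := (Fin.valEmbedding (n := n + 1)).trans
          (Infinite.natEmbedding (Module.Basis.ofVectorSpaceIndex K V))
        exact staircase hKd n c hEg _ (bas.linearIndependent.comp em em.injective)
    have hsc : SMulCommClass K k V := IsScalarTower.to_smulCommClass' 
    let Ψ : B →ₐ[k] Module.End K V :=
      { toFun := fun x =>
          { toFun := fun w => ρ x w
            map_add' := fun w w' => map_add _ _ _
            map_smul' := fun y w => hKc (⟨ρ x, hHE x⟩ : E) y w }
        map_one' := by ext w; simp
        map_mul' := fun x y => by ext w; simp
        map_zero' := by ext w; simp
        map_add' := fun x y => by ext w; simp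
        commutes' := fun r => by ext w; simp [Module.algebraMap_end_apply] }
    have hΨ : ∀ x w, Ψ x w = ρ x w := fun x w => rfl
    let bas := Module.finBasis K V
    let Θ : Module.End K V ≃ₐ[k] Matrix _ _ K :=
      (LinearMap.toMatrixAlgEquiv bas).restrictScalars k
    let Φ : B →ₐ[k] Matrix _ _ K := Θ.toAlgHom.comp Ψ
    have hΦ : ∀ x, Φ x = 0 → ρ x = 0 := by
      intro x hx
      have : Ψ x = 0 := Θ.injective (by rw [map_zero]; exact hx)
      ext w
      rw [← hΨ, this]; rfl
    have hfin : Finite (algebraMap k K).range := by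
      have := Set.not_infinite.1 hinf
      exact this.to_subtype
    obtain ⟨p, hp, hpq⟩ := matrices_M2 (k := k) hfin (Φ a) (Φ b) (by
      rintro ⟨m, hm⟩
      rw [← map_mul, ← map_mul, ← map_sub, ← map_pow] at hm
      have h1 := hΦ _ hm
      have h2 : ((ρ (a * b - b * a) * t) ^ m) v = v := by
        clear hm h1
        induction m with
        | zero => simp
        | succ m ih => rw [pow_succ, Module.End.mul_apply, hcv, ih]
      rw [(ht (a * b - b * a)).mul_pow, ← map_pow, h1, zero_mul] at h2
      exact hv h2.symm)
    refine ⟨p, hp, fun q hq => hpq q fun w => ?_⟩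
    have e : (fun i : Bool => cond i (Φ a) (Φ b)) = fun i : Bool => Φ (cond i a b) := by
      funext i; cases i <;> rfl
    rw [e, ← lift_natural, lift_natural (FreeAlgebra.lift k fun i : Bool => cond i a b), hq,
      map_zero]

end helpers4

theorem no_commPow_implies_M2_in_variety
    (k : Type u) (A : Type v) [CommRing k] [Ring A] [Algebra k A]
    (hPI : SatisfiesProperId k A)
    (h : ∀ m : ℕ, 1 ≤ m → ¬ IsPolyId k A (commPow k m)) :
    ∃ p : Ideal k, p.IsPrime ∧
      ∀ q : FreeAlgebra k ℕ, IsPolyId k A q →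
        IsPolyId k (Matrix (Fin 2) (Fin 2) (FractionRing (k ⧸ p))) q := by
  obtain ⟨n, -, c, hg⟩ := hPI
  have h' : ∀ m : ℕ, ∃ f : ℕ → A, FreeAlgebra.lift k f (commPow k (m + 1)) ≠ 0 := by
    intro m
    have := h (m + 1) (Nat.succ_pos m)
    rw [IsPolyId] at this
    push Not at this
    exact this
  choose f hf using h'
  let a : ℕ → A := fun m => f m 0
  let b : ℕ → A := fun m => f m 1
  have hnil : ¬ IsNilpotent (a * b - b * a) := by
    rintro ⟨m, hm⟩
    apply hf m
    have h1 := congrFun hm m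
    have h2 : (f m 0 * f m 1 - f m 1 * f m 0) ^ m = 0 := h1
    simp only [commPow, map_pow, map_sub, map_mul, FreeAlgebra.lift_ι_apply]
    rw [pow_succ, h2, zero_mul]
  obtain ⟨V, _, _, ρ, t, v, hv, hcv, ht, hirr⟩ := exists_simple (k := k) _ hnil
  obtain ⟨p, hp, hpq⟩ := core_M2 ρ t v a b hv hcv ht hirr n c (IsPolyId.pi hg)
  exact ⟨p, hp, fun q hq => hpq q hq.pi⟩
end

section
/- Let k be a commutative unital ring and let A be a k-algebra such that [x₁,x₂]^m is a polynomial identity of A for some m ≥ 1. If a₁, …, a_t ∈ A are each integral over k (each satisfies a monic polynomial with coefficients in k), then the k-subalgebra of A generated by a₁, …, a_t is finitely generated as a k-module. -/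
namespace PIFin

section levitzki
variable {R : Type*} [Ring R]

lemma lev_two (hs : ∀ x : R, (∀ z, x * z * x = 0) → x = 0) (u : R)
    (h : ∀ z, u * z * u * z * u = 0) : u = 0 := by
  apply hs
  intro z
  apply hs
  intro w
  have h1 := h z
  have h2 := h (w * u * z)
  have h3 := h (z + w * u * z)
  have e : u * (z + w * u * z) * u * (z + w * u * z) * u
      = u * z * u * z * u + u * (w * u * z) * u * (w * u * z) * u
        + u * z * u * w * (u * z * u) + u * w * (u * z * u * z * u) := by noncomm_ring
  rw [e, h1, h2] at h3
  simpa [mul_assoc] using h3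

lemma lev_step (x y z : R) (n : ℕ) (h : ∀ y : R, (x * y) ^ (n + 1) * x = 0)
    (hT : (z * ((x * y) ^ n * x)) * (z * ((x * y) ^ n * x)) = 0) :
    (x * y) ^ n * x * (z * ((x * y) ^ n * x)) = 0 := by
  set a := x * y with ha
  set T := z * (a ^ n * x) with hTd
  set b := x * (z * a ^ n) with hb
  have hax : ∀ j, a ^ (n + 1 + j) * x = 0 := by
    intro j
    rw [add_comm, pow_add, mul_assoc, h y, mul_zero]
  have hbx : b * x = x * T := by simp only [hb, hTd, mul_assoc]
  have hbax : ∀ j, b * (a ^ (j + 1) * x) = 0 := by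
    intro j
    have : b * (a ^ (j + 1) * x) = x * z * (a ^ (n + 1 + j) * x) := by
      rw [show n + 1 + j = n + (j + 1) by ring, pow_add a n (j + 1)]
      simp only [hb, mul_assoc]
    rw [this, hax, mul_zero]
  have hbT : ∀ j, b * (a ^ j * x * T) = 0 := by
    intro j
    cases j with
    | zero => rw [pow_zero, one_mul, ← mul_assoc, hbx, mul_assoc, hT, mul_zero]
    | succ j => rw [← mul_assoc, hbax, zero_mul]
  have hS : ∀ j, (a + b) ^ (j + 1) * x = a ^ (j + 1) * x + a ^ j * x * T := by
    intro j
    induction j with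
    | zero => simp [add_mul, hbx]
    | succ j ih =>
      rw [pow_succ' (a + b), mul_assoc, ih, add_mul, mul_add, mul_add, hbax, hbT]
      simp only [pow_succ' a, mul_assoc, add_zero]
  have h1 := hS n
  have h2 : a + b = x * (y + z * a ^ n) := by rw [mul_add]
  rw [h2, h, h y] at h1
  simpa using h1.symm

lemma lev (hs : ∀ x : R, (∀ z, x * z * x = 0) → x = 0) (n : ℕ) :
    ∀ x : R, (∀ y : R, (x * y) ^ n * x = 0) → x = 0 := by
  induction n with
  | zero => intro x h; simpa using h 0
  | succ n ih =>
    intro x h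
    apply ih
    intro y
    set u := (x * y) ^ n * x with hu
    have hux : ∀ z, ∀ N, (z * u) ^ N = 0 → (z * u) ^ 3 = 0 := by
      intro z N
      have key : ∀ p, (z * u) ^ (p + 1) * (z * u) ^ (p + 1) = 0 → u * (z * u) ^ (p + 1) = 0 := by
        intro p hp
        have := lev_step x y ((z * u) ^ p * z) n h (by
          rw [← hu]; rw [pow_succ] at hp; simpa only [mul_assoc] using hp)
        rw [← hu] at this
        rw [pow_succ]; simpa only [mul_assoc] using this
      induction N with
      | zero => intro h0; exact pow_eq_zero_of_le (Nat.zero_le _) h0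
      | succ N ihN =>
        intro h0
        by_cases hN : N < 3
        · exact pow_eq_zero_of_le (by omega) h0
        · apply ihN
          obtain ⟨q, rfl⟩ : ∃ q, N = q + 3 := ⟨N - 3, by omega⟩
          have := key (q + 1) (by
            rw [← pow_add]; exact pow_eq_zero_of_le (by omega) h0)
          rw [show q + 3 = (q + 1 + 1) + 1 by ring, pow_succ', mul_assoc, this, mul_zero]
    have hnil : ∀ z, (z * u) ^ 3 = 0 := by
      intro z
      apply hux z (n + 3)
      have e : ∀ j, (z * ((x * y) ^ n * x)) ^ (j + 1) = z * (x * y) ^ n * (((x * (z * (x * y) ^ n))) ^ j * x) := by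
        intro j
        induction j with
        | zero => simp [mul_assoc]
        | succ j ihj => rw [pow_succ', ihj, pow_succ' _ j]; simp only [mul_assoc]
      have e1 : (z * u) ^ (n + 1 + 1) = 0 := by
        rw [hu, e, h, mul_zero]
      exact pow_eq_zero_of_le (by omega) e1
    apply lev_two hs
    intro z
    have h3 := hnil z
    have := lev_step x y (z * u * z) n h (by
      rw [← hu]
      have h4 : (z * u) ^ 4 = 0 := pow_eq_zero_of_le (by omega) h3
      rw [← h4]; noncomm_ring)
    rw [← hu] at this
    simpa only [mul_assoc] using this

lemma prime_comm (hp : ∀ x y : R, (∀ z, x * z * y = 0) → x = 0 ∨ y = 0) (m : ℕ)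
    (h : ∀ x y : R, (x * y - y * x) ^ m = 0) (x y : R) : x * y = y * x := by
  have hs : ∀ x : R, (∀ z, x * z * x = 0) → x = 0 := fun x hx => (hp x x hx).elim id id
  have hred : ∀ x : R, x * x = 0 → x = 0 := by
    intro x hx
    apply lev hs m
    intro y
    have : ∀ j, (x * y - y * x) ^ j * x = (x * y) ^ j * x := by
      intro j
      induction j with
      | zero => simp
      | succ j ih =>
        rw [pow_succ', mul_assoc, ih, pow_succ', sub_mul, mul_assoc y x]
        have : x * ((x * y) ^ j * x) = 0 := by
          cases j with
          | zero => simpa using hx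
          | succ j => rw [pow_succ']; simp only [← mul_assoc, hx, zero_mul]
        rw [this, mul_zero, sub_zero]; simp only [mul_assoc]
    rw [← this, h, zero_mul]
  have hdom : ∀ x y : R, x * y = 0 → x = 0 ∨ y = 0 := by
    intro x y hxy
    have hyx : ∀ z, y * z * x = 0 := by
      intro z
      apply hred
      rw [show y * z * x * (y * z * x) = y * z * (x * y) * (z * x) by noncomm_ring, hxy]
      simp
    exact (hp y x hyx).symm
  have hpow : ∀ j, ∀ c : R, c ^ j = 0 → c = 0 := by
    intro j c
    induction j with
    | zero => intro h0; rw [pow_zero] at h0; rw [← mul_one c, h0, mul_zero]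
    | succ j ih => intro h0; rw [pow_succ] at h0; exact (hdom _ _ h0).elim ih id
  exact sub_eq_zero.mp (hpow m _ (h x y))

end levitzki

section fin
variable {k B : Type*} [CommRing k] [Ring B] [Algebra k B]

/-- two-sided ideal -/
def IsId (I : Submodule k B) : Prop := ∀ b x, x ∈ I → b * x ∈ I ∧ x * b ∈ I

/-- cofinite -/
def Cof (I : Submodule k B) : Prop := ∃ F : Submodule k B, F.FG ∧ F ⊔ I = ⊤

lemma chain_lemma (G : Set B) (hGf : G.Finite) (hG : Algebra.adjoin k G = ⊤)
    (c : Set (Submodule k B)) (hc : IsChain (· ≤ ·) c) (hne : c.Nonempty)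
    (hid : ∀ I ∈ c, IsId I) (hcof : Cof (sSup c)) : ∃ I ∈ c, Cof I := by
  obtain ⟨F, ⟨s, hs⟩, hF⟩ := hcof
  have hdir : DirectedOn (· ≤ ·) c := hc.directedOn
  have hmem : ∀ e : B, ∃ I ∈ c, e ∈ F ⊔ I := by
    intro e
    have : e ∈ F ⊔ sSup c := hF ▸ Submodule.mem_top
    obtain ⟨f, hf, j, hj, rfl⟩ := Submodule.mem_sup.mp this
    obtain ⟨I, hI, hjI⟩ := (Submodule.mem_sSup_of_directed hne hdir).mp hj
    exact ⟨I, hI, Submodule.mem_sup.mpr ⟨f, hf, j, hjI, rfl⟩⟩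
  have hfin : ∀ E : Set B, E.Finite → ∃ I ∈ c, E ⊆ (F ⊔ I : Submodule k B) := by
    intro E hE
    induction E, hE using Set.Finite.induction_on with
    | empty => exact ⟨hne.some, hne.some_mem, Set.empty_subset _⟩
    | @insert e E _ _ ih =>
      obtain ⟨I, hI, h1⟩ := ih
      obtain ⟨J, hJ, h2⟩ := hmem e
      obtain ⟨K, hK, hIK, hJK⟩ := hdir I hI J hJ
      refine ⟨K, hK, Set.insert_subset ?_ ?_⟩
      · exact (sup_le_sup_left hJK F) h2
      · exact h1.trans (sup_le_sup_left hIK F)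
  obtain ⟨I, hI, hE⟩ := hfin (insert 1 (Set.image2 (· * ·) G (s : Set B)))
    ((hGf.image2 _ s.finite_toSet).insert _)
  refine ⟨I, hI, F, ⟨s, hs⟩, ?_⟩
  have h1 : (1 : B) ∈ F ⊔ I := hE (Set.mem_insert _ _)
  have hmulF : ∀ g ∈ G, ∀ f ∈ F, g * f ∈ F ⊔ I := by
    intro g hg f hf
    rw [← hs] at hf
    induction hf using Submodule.span_induction with
    | mem x hx => exact hE (Set.mem_insert_of_mem _ ⟨g, hg, x, hx, rfl⟩)
    | zero => simp
    | add x y _ _ hx hy => rw [mul_add]; exact add_mem hx hy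
    | smul r x _ hx => rw [mul_smul_comm]; exact Submodule.smul_mem _ _ hx
  have hall : ∀ b : B, ∀ v ∈ F ⊔ I, b * v ∈ F ⊔ I := by
    intro b
    have hb : b ∈ Algebra.adjoin k G := hG ▸ Algebra.mem_top
    induction hb using Algebra.adjoin_induction with
    | mem g hg =>
      intro v hv
      obtain ⟨f, hf, j, hj, rfl⟩ := Submodule.mem_sup.mp hv
      rw [mul_add]
      exact add_mem (hmulF g hg f hf) (Submodule.mem_sup_right (hid I hI g j hj).1)
    | algebraMap r =>
      intro v hv
      rw [← Algebra.smul_def]; exact Submodule.smul_mem _ _ hv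
    | add x y _ _ hx hy =>
      intro v hv
      rw [add_mul]; exact add_mem (hx v hv) (hy v hv)
    | mul x y _ _ hx hy =>
      intro v hv
      rw [mul_assoc]; exact hx _ (hy v hv)
  rw [eq_top_iff]
  intro b _
  simpa using hall b 1 h1

/-- The two-sided ideal generated by `x` (as a submodule). -/
def gen (k : Type*) {B : Type*} [CommRing k] [Ring B] [Algebra k B] (x : B) : Submodule k B :=
  ⊤ * Submodule.span k {x} * ⊤

lemma mem_gen (x : B) : x ∈ gen k x := by
  have := Submodule.mul_mem_mul (Submodule.mul_mem_mul (Submodule.mem_top (R := k) (x := (1 : B)))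
    (Submodule.mem_span_singleton_self (R := k) x)) (Submodule.mem_top (R := k) (x := (1 : B)))
  simpa [gen] using this

lemma gen_le {x : B} {P : Submodule k B} (h : ∀ b c, b * x * c ∈ P) : gen k x ≤ P := by
  rw [gen, Submodule.mul_le]
  intro p hp c _
  induction hp using Submodule.mul_induction_on' with
  | mem_mul_mem b _ y hy =>
    obtain ⟨r, rfl⟩ := Submodule.mem_span_singleton.mp hy
    rw [mul_smul_comm, smul_mul_assoc]
    exact P.smul_mem _ (h b c)
  | add p _ q _ hp hq => rw [add_mul]; exact add_mem hp hq

lemma mul_mem_gen (b x c : B) : b * x * c ∈ gen k x :=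
  Submodule.mul_mem_mul (Submodule.mul_mem_mul Submodule.mem_top
    (Submodule.mem_span_singleton_self (R := k) x)) Submodule.mem_top

lemma isId_gen (x : B) : IsId (gen k x) := by
  intro b y hy
  constructor
  · have : gen k x ≤ (gen k x).comap (LinearMap.mulLeft k b) := by
      apply gen_le
      intro p q
      simpa [mul_assoc] using mul_mem_gen (k := k) (b * p) x q
    exact this hy
  · have : gen k x ≤ (gen k x).comap (LinearMap.mulRight k b) := by
      apply gen_le
      intro p q
      simpa [mul_assoc] using mul_mem_gen (k := k) p x (q * b)
    exact this hy

lemma isId_sup {I J : Submodule k B} (hI : IsId I) (hJ : IsId J) : IsId (I ⊔ J) := by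
  intro b y hy
  obtain ⟨i, hi, j, hj, rfl⟩ := Submodule.mem_sup.mp hy
  rw [mul_add, add_mul]
  exact ⟨Submodule.add_mem_sup (hI b i hi).1 (hJ b j hj).1,
    Submodule.add_mem_sup (hI b i hi).2 (hJ b j hj).2⟩

lemma cof_of_ann {I : Submodule k B} (hI : IsId I) (x y : B)
    (hx : Cof (gen k x ⊔ I)) (hy : Cof (gen k y ⊔ I))
    (hxy : ∀ z, x * z * y ∈ I) (hyx : ∀ z, y * z * x ∈ I) : Cof I := by
  obtain ⟨F, hF, hFt⟩ := hx
  obtain ⟨F', hF', hFt'⟩ := hy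
  refine ⟨F ⊔ F' * Submodule.span k {x} * F',
    hF.sup ((hF'.mul (Submodule.fg_span_singleton x)).mul hF'), ?_⟩
  set M := F' * Submodule.span k {x} * F' with hM
  have hleft : ∀ g ∈ gen k y ⊔ I, g * x ∈ I := by
    intro g hg
    have : gen k y ⊔ I ≤ I.comap (LinearMap.mulRight k x) := by
      refine sup_le (gen_le ?_) ?_
      · intro b c
        have := (hI b _ (hyx c)).1
        simpa [mul_assoc] using this
      · intro i hi; exact (hI x i hi).2
    exact this hg
  have hright : ∀ g ∈ gen k y ⊔ I, x * g ∈ I := by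
    intro g hg
    have : gen k y ⊔ I ≤ I.comap (LinearMap.mulLeft k x) := by
      refine sup_le (gen_le ?_) ?_
      · intro b c
        have := (hI c _ (hxy b)).2
        simpa [mul_assoc] using this
      · intro i hi; exact (hI x i hi).1
    exact this hg
  have hgen : gen k x ≤ M ⊔ I := by
    apply gen_le
    intro b c
    have hb : b ∈ F' ⊔ (gen k y ⊔ I) := hFt' ▸ Submodule.mem_top
    have hc : c ∈ F' ⊔ (gen k y ⊔ I) := hFt' ▸ Submodule.mem_top
    obtain ⟨f, hf, g, hg, rfl⟩ := Submodule.mem_sup.mp hb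
    obtain ⟨f', hf', g', hg', rfl⟩ := Submodule.mem_sup.mp hc
    rw [show (f + g) * x * (f' + g') = f * x * f' + (f * (x * g') + g * x * (f' + g')) by
      noncomm_ring]
    refine Submodule.add_mem_sup ?_ (add_mem ?_ ?_)
    · exact Submodule.mul_mem_mul (Submodule.mul_mem_mul hf
        (Submodule.mem_span_singleton_self x)) hf'
    · exact (hI f _ (hright g' hg')).1
    · exact (hI _ _ (hleft g hg)).2
  rw [eq_top_iff, ← hFt, sup_assoc]
  exact sup_le_sup_left (sup_le hgen le_sup_right) F

theorem main (m : ℕ) (hcomm : ∀ x y : B, (x * y - y * x) ^ m = 0) (G : Set B) (hGf : G.Finite)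
    (hG : Algebra.adjoin k G = ⊤) (hintg : ∀ g ∈ G, IsIntegral k g) : Module.Finite k B := by
  by_contra hnf
  let S : Set (Submodule k B) := {I | IsId I ∧ ¬ Cof I}
  have hbot : (⊥ : Submodule k B) ∈ S := by
    refine ⟨fun b x hx => ?_, ?_⟩
    · rw [Submodule.mem_bot] at hx; subst hx; simp
    · rintro ⟨F, hF, hFt⟩
      rw [sup_bot_eq] at hFt
      exact hnf ⟨hFt ▸ hF⟩
  obtain ⟨I, -, hImax⟩ := zorn_le_nonempty₀ S (by
    intro c hcS hc y hy
    refine ⟨sSup c, ⟨?_, ?_⟩, fun z hz => le_sSup hz⟩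
    · intro b x hx
      obtain ⟨J, hJ, hxJ⟩ := (Submodule.mem_sSup_of_directed ⟨y, hy⟩ hc.directedOn).mp hx
      have := (hcS hJ).1 b x hxJ
      exact ⟨le_sSup hJ this.1, le_sSup hJ this.2⟩
    · intro hcof
      obtain ⟨J, hJ, hJc⟩ := chain_lemma G hGf hG c hc ⟨y, hy⟩ (fun J hJ => (hcS hJ).1) hcof
      exact (hcS hJ).2 hJc) ⊥ hbot
  have hI : IsId I := hImax.prop.1
  have hnc : ¬ Cof I := hImax.prop.2
  have hbig : ∀ x, x ∉ I → Cof (gen k x ⊔ I) := by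
    intro x hx
    by_contra hn
    have := hImax.le_of_ge (y := gen k x ⊔ I) ⟨isId_sup (isId_gen x) hI, hn⟩ le_sup_right
    exact hx (this (Submodule.mem_sup_left (mem_gen x)))
  have hsemi : ∀ x, (∀ z, x * z * x ∈ I) → x ∈ I := by
    intro x hx
    by_contra hn
    exact hnc (cof_of_ann hI x x (hbig x hn) (hbig x hn) hx hx)
  have hprime : ∀ x y, (∀ z, x * z * y ∈ I) → x ∈ I ∨ y ∈ I := by
    intro x y hxy
    by_contra! hn
    refine hnc (cof_of_ann hI x y (hbig x hn.1) (hbig y hn.2) hxy ?_)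
    intro z
    apply hsemi
    intro w
    have := (hI (y * z) _ (hI (z * x) _ (hxy w)).2).1
    simpa only [mul_assoc] using this
  let I' : Ideal B :=
    { carrier := I
      add_mem' := fun ha hb => I.add_mem ha hb
      zero_mem' := I.zero_mem
      smul_mem' := fun b x hx => (hI b x hx).1 }
  have hI' : ∀ x, x ∈ I' ↔ x ∈ I := fun x => Iff.rfl
  haveI : I'.IsTwoSided := ⟨fun b hx => (hI b _ hx).2⟩
  let π : B →ₐ[k] (B ⧸ I') := Ideal.Quotient.mkₐ k I'
  have hπ : Function.Surjective π := Ideal.Quotient.mkₐ_surjective k I'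
  have hker : ∀ x, π x = 0 ↔ x ∈ I := fun x => Ideal.Quotient.eq_zero_iff_mem
  have hQ : ∀ x y : B ⧸ I', x * y = y * x := by
    apply prime_comm _ m
    · intro x y
      obtain ⟨x, rfl⟩ := hπ x
      obtain ⟨y, rfl⟩ := hπ y
      rw [← map_mul, ← map_mul, ← map_sub, ← map_pow, hcomm, map_zero]
    · intro x y
      obtain ⟨x, rfl⟩ := hπ x
      obtain ⟨y, rfl⟩ := hπ y
      intro h
      rw [hker, hker]
      apply hprime
      intro z
      rw [← hker, map_mul, map_mul, h]
  have hfinQ : Module.Finite k (B ⧸ I') := by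
    letI : CommRing (B ⧸ I') := { (inferInstance : Ring (B ⧸ I')) with mul_comm := hQ }
    have h1 : Module.Finite k (Algebra.adjoin k (π '' G)) := by
      refine Algebra.finite_adjoin_of_finite_of_isIntegral (hGf.image _) ?_
      rintro _ ⟨g, hg, rfl⟩
      exact (hintg g hg).map π
    have h2 : Algebra.adjoin k (π '' G) = ⊤ := by
      rw [← AlgHom.map_adjoin, hG, Algebra.map_top, AlgHom.range_eq_top]
      exact hπ
    rw [h2] at h1
    exact Module.Finite.equiv (Subalgebra.topEquiv (R := k) (A := B ⧸ I')).toLinearEquiv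
  obtain ⟨s, hs⟩ := hfinQ.fg_top
  classical
  choose σ hσ using hπ
  refine hnc ⟨Submodule.span k (s.image σ : Finset B), ⟨_, rfl⟩, ?_⟩
  rw [eq_top_iff]
  intro b _
  have hb : π b ∈ (Submodule.span k (s.image σ : Set B)).map π.toLinearMap := by
    rw [Submodule.map_span]
    have : π.toLinearMap '' (s.image σ : Finset B) = s := by
      ext q
      simp [hσ]
    rw [this, hs]
    trivial
  obtain ⟨f, hf, hfb⟩ := hb
  refine Submodule.mem_sup.mpr ⟨f, hf, b - f, ?_, by abel⟩
  rw [← hker, map_sub, sub_eq_zero]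
  exact hfb.symm

end fin

end PIFin

theorem adjoin_of_integral_elements_finite
    (k A : Type*) [CommRing k] [Ring A] [Algebra k A]
    (m : ℕ) (hm : 1 ≤ m) (hid : IsPolyId k A (commPow k m))
    (t : ℕ) (a : Fin t → A) (ha : ∀ i, IsIntegral k (a i)) :
    Module.Finite k (Algebra.adjoin k (Set.range a)) := by
  have hc : ∀ x y : A, (x * y - y * x) ^ m = 0 := by
    intro x y
    have := hid (fun i => if i = 0 then x else y)
    simpa [commPow] using this
  refine PIFin.main m (fun x y => ?_)
    (Set.range fun i => (⟨a i, Algebra.subset_adjoin ⟨i, rfl⟩⟩ : Algebra.adjoin k (Set.range a)))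
    (Set.finite_range _) ?_ ?_
  · apply Subtype.ext
    simpa using hc x y
  · rw [← Algebra.adjoin_adjoin_coe_preimage (R := k) (s := Set.range a)]
    congr 1
    ext ⟨x, hx⟩
    simp [Subtype.ext_iff]
  · rintro _ ⟨i, rfl⟩
    exact (isIntegral_algHom_iff (Algebra.adjoin k (Set.range a)).val
      Subtype.val_injective).mp (ha i)
end

section
/- Let k be a commutative unital ring, let n ≥ 2 and m ≥ 1, and let A be a k-algebra such that (st_{2(n−1)}(x₁,…,x_{2n−2}))^m is a polynomial identity of A. Let a₁, …, a_t ∈ A be elements such that every product of at most n−1 factors taken from {a₁,…,a_t} (repetitions allowed, in any order) is nilpotent. Then the non-unital k-subalgebra of A generated by a₁, …, a_t is nilpotent: there exists N such that every product of N elements of this subalgebra equals 0. -/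
/-- ordered product of a finite family -/
def wprod {A : Type*} [Monoid A] {n : ℕ} (x : Fin n → A) : A := (List.ofFn x).prod

/-- value of the standard polynomial -/
def stv {A : Type*} [Ring A] {d : ℕ} (x : Fin d → A) : A :=
  ∑ σ : Equiv.Perm (Fin d), (Equiv.Perm.sign σ : ℤ) • wprod (fun i => x (σ i))

theorem stPoly_eval {k A : Type*} [CommRing k] [Ring A] [Algebra k A] (d m : ℕ) (f : ℕ → A) :
    FreeAlgebra.lift k f ((stPoly k d) ^ m) = (stv (fun i : Fin d => f i)) ^ m := by
  rw [map_pow]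
  congr 1
  simp [stPoly, stv, wprod, map_list_prod, List.ofFn_eq_map, Function.comp_def]

theorem stv_pow_zero {k A : Type*} [CommRing k] [Ring A] [Algebra k A] (d m : ℕ)
    (h : IsPolyId k A ((stPoly k d) ^ m)) (x : Fin d → A) : (stv x) ^ m = 0 := by
  have := h (fun i => if hi : i < d then x ⟨i, hi⟩ else 0)
  rw [stPoly_eval] at this
  simpa using this

theorem wprod_append {A : Type*} [Monoid A] {a b : ℕ} (x : Fin (a + b) → A) :
    wprod x = wprod (fun i => x (Fin.castAdd b i)) * wprod (fun i => x (Fin.natAdd a i)) := by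
  unfold wprod
  rw [← List.prod_append, List.ofFn_add]
  rfl

theorem wprod_succ {A : Type*} [Monoid A] {n : ℕ} (x : Fin (n + 1) → A) :
    wprod x = x 0 * wprod (fun i => x i.succ) := by
  simp [wprod, List.ofFn_succ]

theorem wprod_map {A B : Type*} [Monoid A] [Monoid B] {n : ℕ} (f : A →* B) (x : Fin n → A) :
    f (wprod x) = wprod (fun i => f (x i)) := by
  simp [wprod, map_list_prod, List.map_ofFn, Function.comp_def]

theorem stv_map {A B : Type*} [Ring A] [Ring B] {n : ℕ} (f : A →+* B) (x : Fin n → A) :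
    f (stv x) = stv (fun i => f (x i)) := by
  unfold stv
  rw [map_sum]
  refine Finset.sum_congr rfl fun σ _ => ?_
  rw [map_zsmul]
  congr 1
  exact wprod_map (f : A →* B) _

theorem exists_form (A : Type*) [Ring A] (d m : ℕ) :
    ∃ (D : ℕ) (φ : (Fin D → Fin d) → ℤ) (p : Fin D → Fin d), φ p = 1 ∧
      ∀ y : Fin d → A, (stv y) ^ m = ∑ u, φ u • wprod (fun i => y (u i)) := by
  classical
  induction m with
  | zero =>
    exact ⟨0, fun _ => 1, Fin.elim0, rfl, fun y => by simp [wprod]⟩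
  | succ m ih =>
    obtain ⟨D, φ, p, hp, h⟩ := ih
    let ψ : (Fin d → Fin d) → ℤ := fun u =>
      if hu : Function.Bijective u then (Equiv.Perm.sign (Equiv.ofBijective u hu) : ℤ) else 0
    have hψ : ∀ y : Fin d → A, stv y = ∑ u, ψ u • wprod (fun i => y (u i)) := by
      intro y
      unfold stv
      rw [← Finset.sum_subset (Finset.subset_univ
        (Finset.univ.image (fun σ : Equiv.Perm (Fin d) => (σ : Fin d → Fin d))))]
      · rw [Finset.sum_image]
        · refine Finset.sum_congr rfl fun σ _ => ?_
          have : ψ σ = (Equiv.Perm.sign σ : ℤ) := by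
            simp only [ψ]
            rw [dif_pos σ.bijective]
            congr 2
            ext; rfl
          rw [this]
        · intro σ _ τ _ hh
          exact DFunLike.coe_injective hh
      · intro u _ hu
        have : ¬ Function.Bijective u := by
          intro hb
          apply hu
          simp only [Finset.mem_image, Finset.mem_univ, true_and]
          exact ⟨Equiv.ofBijective u hb, rfl⟩
        simp only [ψ]
        rw [dif_neg this, zero_smul]
    refine ⟨D + d, fun u => φ (fun i => u (Fin.castAdd d i)) * ψ (fun i => u (Fin.natAdd D i)),
      Fin.append p id, ?_, ?_⟩
    · have h1 : (fun i => Fin.append p id (Fin.castAdd d i)) = p := by ext; simp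
      have h2 : (fun i => Fin.append p id (Fin.natAdd D i)) = (id : Fin d → Fin d) := by ext; simp
      beta_reduce
      rw [h1, h2, hp]
      simp only [ψ]
      rw [dif_pos Function.bijective_id]
      have : Equiv.ofBijective (id : Fin d → Fin d) Function.bijective_id = 1 := by ext; rfl
      simp [this]
    · intro y
      rw [pow_succ, h, hψ, Finset.sum_mul_sum, ← Finset.sum_product',
        ← (Fin.appendEquiv D d).sum_comp]
      refine Finset.sum_congr rfl fun u _ => ?_
      rw [wprod_append]
      simp [Fin.appendEquiv, -zsmul_eq_mul]
      rw [smul_smul, mul_comm]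

/-- monic multilinear identity of degree `D` -/
def MonicId {D : ℕ} (c : Equiv.Perm (Fin D) → ℤ) (A : Type*) [Ring A] : Prop :=
  ∀ x : Fin D → A, ∑ w, c w • wprod (fun i => x (w i)) = 0

theorem wprod_sum {A : Type*} [Ring A] {n : ℕ} {J : Type*} [DecidableEq J] (s : Fin n → Finset J)
    (g : Fin n → J → A) :
    wprod (fun i => ∑ j ∈ s i, g i j) =
      ∑ h ∈ Fintype.piFinset s, wprod (fun i => g i (h i)) := by
  have := (MultilinearMap.mkPiAlgebraFin ℤ n A).map_sum_finset g s
  simpa [MultilinearMap.mkPiAlgebraFin_apply, wprod] using this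

theorem sum_sup_sign {D : ℕ} (h : Fin D → Fin D) :
    ∑ T : Finset (Fin D), (if ∀ r, h r ∈ T then (-1 : ℤ) ^ T.card else 0) =
      if Function.Bijective h then (-1) ^ D else 0 := by
  classical
  split_ifs with hb
  · rw [Finset.sum_eq_single Finset.univ]
    · simp
    · intro T _ hT
      rw [if_neg]
      intro hh
      apply hT
      ext z
      obtain ⟨r, rfl⟩ := hb.2 z
      simp [hh r]
    · simp
  · have hs : ¬ Function.Surjective h := fun hs => hb (Finite.surjective_iff_bijective.1 hs)
    unfold Function.Surjective at hs
    push Not at hs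
    obtain ⟨z, hz⟩ := hs
    refine Finset.sum_involution (fun T _ => if z ∈ T then T.erase z else insert z T) ?_ ?_ ?_ ?_
    · intro T _
      by_cases hzT : z ∈ T
      · have : (∀ r, h r ∈ T.erase z) ↔ ∀ r, h r ∈ T := by
          simp [hz]
        simp only [hzT, if_true, this]
        split_ifs
        · have := Finset.card_erase_add_one hzT
          rw [← this, pow_succ]; ring
        · simp
      · have : (∀ r, h r ∈ insert z T) ↔ ∀ r, h r ∈ T := by
          simp [hz]
        simp only [hzT, if_false, this]
        split_ifs
        · rw [Finset.card_insert_of_notMem hzT, pow_succ]; ring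
        · simp
    · intro T _ _ heq
      by_cases hzT : z ∈ T
      · simp only [hzT, if_true] at heq
        have := Finset.notMem_erase z T
        rw [heq] at this
        exact this hzT
      · simp only [hzT, if_false] at heq
        have := Finset.mem_insert_self z T
        rw [heq] at this
        exact hzT this
    · intros; simp
    · intro T _
      by_cases hzT : z ∈ T
      · simp [hzT]
      · simp [hzT]

theorem exists_monicId (A : Type*) [Ring A] (d m : ℕ)
    (hst : ∀ x : Fin d → A, (stv x) ^ m = 0) :
    ∃ (D : ℕ) (c : Equiv.Perm (Fin D) → ℤ), c 1 = 1 ∧ MonicId c A := by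
  classical
  obtain ⟨D, φ, p, hp, h⟩ := exists_form A d m
  refine ⟨D, fun w => φ (fun i => p (w i)), by simpa using hp, ?_⟩
  intro x
  have key : ∀ T : Finset (Fin D),
      ∑ h : Fin D → Fin D, (if ∀ r, h r ∈ T then (1:ℤ) else 0) •
        (φ (fun i => p (h i)) • wprod (fun i => x (h i))) = 0 := by
    intro T
    have h1 := (h (fun j => ∑ i ∈ T.filter (fun i => p i = j), x i)).symm.trans (hst _)
    rw [← h1]
    have h2 : ∀ u : Fin D → Fin d,
        φ u • wprod (fun r => ∑ i ∈ T.filter (fun i => p i = u r), x i) =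
        ∑ h : Fin D → Fin D, if (fun i => p (h i)) = u then
          (if ∀ r, h r ∈ T then (1:ℤ) else 0) •
          (φ (fun i => p (h i)) • wprod (fun i => x (h i))) else 0 := by
      intro u
      rw [wprod_sum (fun r => T.filter (fun i => p i = u r)) (fun _ i => x i), Finset.smul_sum,
        ← Finset.sum_subset (Finset.subset_univ (Fintype.piFinset
          (fun r => T.filter (fun i => p i = u r))))]
      · refine Finset.sum_congr rfl fun h hh => ?_
        simp only [Fintype.mem_piFinset, Finset.mem_filter] at hh
        have e : (fun i => p (h i)) = u := funext fun r => (hh r).2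
        rw [if_pos e, if_pos (fun r => (hh r).1), e, one_smul]
      · intro h _ hh
        by_cases e : (fun i => p (h i)) = u
        · rw [if_pos e, if_neg, zero_smul]
          intro h3
          apply hh
          simp only [Fintype.mem_piFinset, Finset.mem_filter]
          exact fun r => ⟨h3 r, congrFun e r⟩
        · rw [if_neg e]
    rw [Finset.sum_congr rfl (fun u _ => h2 u), Finset.sum_comm]
    simp
  have k2 : ∑ T : Finset (Fin D), (-1 : ℤ) ^ T.card •
      (∑ h : Fin D → Fin D, (if ∀ r, h r ∈ T then (1:ℤ) else 0) •
        (φ (fun i => p (h i)) • wprod (fun i => x (h i)))) = 0 := by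
    rw [Finset.sum_congr rfl (fun T _ => by rw [key T, smul_zero])]
    simp
  simp only [Finset.smul_sum] at k2
  rw [Finset.sum_comm] at k2
  have k3 : ∀ h : Fin D → Fin D, ∑ T : Finset (Fin D), (-1 : ℤ) ^ T.card •
      ((if ∀ r, h r ∈ T then (1:ℤ) else 0) •
        (φ (fun i => p (h i)) • wprod (fun i => x (h i)))) =
      (if Function.Bijective h then (-1 : ℤ) ^ D else 0) •
        (φ (fun i => p (h i)) • wprod (fun i => x (h i))) := by
    intro h
    rw [← sum_sup_sign, Finset.sum_smul]
    refine Finset.sum_congr rfl fun T _ => ?_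
    split_ifs <;> simp
  rw [Finset.sum_congr rfl (fun h _ => k3 h)] at k2
  rw [← Finset.sum_subset (Finset.subset_univ
        (Finset.univ.image (fun σ : Equiv.Perm (Fin D) => (σ : Fin D → Fin D))))] at k2
  · rw [Finset.sum_image] at k2
    · have k4 : (-1 : ℤ) ^ D • ∑ w : Equiv.Perm (Fin D),
          φ (fun i => p (w i)) • wprod (fun i => x (w i)) = 0 := by
        rw [← k2, Finset.smul_sum]
        refine Finset.sum_congr rfl fun σ _ => ?_
        rw [if_pos σ.bijective]
      have k5 := congrArg (fun z => (-1 : ℤ) ^ D • z) k4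
      simp only [smul_smul, smul_zero] at k5
      rw [← mul_pow] at k5
      simpa using k5
    · intro σ _ τ _ hh
      exact DFunLike.coe_injective hh
  · intro u _ hu
    have : ¬ Function.Bijective u := by
      intro hb
      apply hu
      simp only [Finset.mem_image, Finset.mem_univ, true_and]
      exact ⟨Equiv.ofBijective u hb, rfl⟩
    rw [if_neg this, zero_smul]


theorem wprod_eq_zero {A : Type*} [Ring A] : ∀ {n : ℕ} (x : Fin n → A) (i : ℕ) (hi : i + 1 < n),
    x ⟨i, by omega⟩ * x ⟨i + 1, hi⟩ = 0 → wprod x = 0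
  | 0, _, _, hi, _ => by omega
  | 1, _, _, hi, _ => by omega
  | n + 2, x, 0, hi, h => by
    rw [wprod_succ, wprod_succ, ← mul_assoc]
    have : x 0 * x (Fin.succ 0) = 0 := h
    rw [this, zero_mul]
  | n + 2, x, i + 1, hi, h => by
    rw [wprod_succ, wprod_eq_zero (fun j => x j.succ) i (by omega) h, mul_zero]

theorem MonicId.step {D : ℕ} (c : Equiv.Perm (Fin (D + 1)) → ℤ) {A : Type*} [Ring A]
    (y : A) (z : Fin D → A) (hz : ∀ i, z i * y = 0) :
    ∑ w, c w • wprod (fun i => (Fin.cons y z : Fin (D + 1) → A) (w i)) =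
      y * ∑ e : Equiv.Perm (Fin D), c (Equiv.Perm.decomposeFin.symm (0, e)) •
        wprod (fun i => z (e i)) := by
  rw [← Equiv.Perm.decomposeFin.symm.sum_comp, Fintype.sum_prod_type, Fin.sum_univ_succ]
  rw [Finset.mul_sum]
  have h0 : ∀ (p : Fin D) (e : Equiv.Perm (Fin D)),
      wprod (fun i => (Fin.cons y z : Fin (D + 1) → A)
        (Equiv.Perm.decomposeFin.symm (p.succ, e) i)) = 0 := by
    intro p e
    set w := Equiv.Perm.decomposeFin.symm (p.succ, e) with hw
    have hw0 : w 0 = p.succ := by simp [hw]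
    obtain ⟨i, hi⟩ := w.surjective 0
    have hi0 : i ≠ 0 := by
      rintro rfl
      rw [hw0] at hi
      exact Fin.succ_ne_zero _ hi
    obtain ⟨j, rfl⟩ := Fin.exists_succ_eq.2 hi0
    refine wprod_eq_zero _ (j : ℕ) (by omega) ?_
    have e1 : (⟨(j : ℕ) + 1, by omega⟩ : Fin (D + 1)) = j.succ := rfl
    rw [e1, hi]
    have : w ⟨(j : ℕ), by omega⟩ ≠ 0 := by
      intro h
      have := w.injective (h.trans hi.symm)
      have := congrArg Fin.val this
      simp at this
    obtain ⟨q, hq⟩ := Fin.exists_succ_eq.2 this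
    rw [← hq]
    simp [hz]
  simp only [h0, smul_zero, Finset.sum_const_zero, add_zero]
  refine Finset.sum_congr rfl fun e _ => ?_
  rw [wprod_succ, mul_smul_comm]
  simp [-zsmul_eq_mul]

/-- Levitzki-type lemma: no nonzero nil left ideals in prime PI rings. -/
theorem levitzki {C : Type*} [Ring C] (hprime : ∀ x y : C, (∀ r, x * r * y = 0) → x = 0 ∨ y = 0) :
    ∀ (D : ℕ) (c : Equiv.Perm (Fin D) → ℤ), c 1 = 1 →
    ∀ L : Ideal C, (∀ x ∈ L, IsNilpotent x) →
      (∀ x : Fin D → C, (∀ i, x i ∈ L) → ∀ l ∈ L, l * ∑ w, c w • wprod (fun i => x (w i)) = 0) →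
      L = ⊥
  | 0, c, hc, L, hL, h => by
    rw [eq_bot_iff]
    intro l hl
    have := h Fin.elim0 (fun i => i.elim0) l hl
    simpa [wprod, hc, Subsingleton.elim _ (1 : Equiv.Perm (Fin 0))] using this
  | D + 1, c, hc, L, hL, h => by
    by_contra hne
    -- L² ≠ 0
    obtain ⟨x, hx, hx0⟩ := (Submodule.ne_bot_iff L).1 hne
    have : ∃ a ∈ L, ∃ l ∈ L, l * a ≠ 0 := by
      by_contra hcon
      push Not at hcon
      rcases hprime x x (fun r => by
        rw [mul_assoc]; exact hcon _ (L.mul_mem_left r hx) _ hx) with h | h <;> exact hx0 h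
    obtain ⟨a, ha, l0, hl0, hl0a⟩ := this
    have hex : ∃ j, ∀ l ∈ L, l * a ^ j = 0 := by
      obtain ⟨j, hj⟩ := hL a ha
      exact ⟨j, fun l _ => by rw [hj, mul_zero]⟩
    classical
    have hj := Nat.find_spec hex
    have hmin := fun i => Nat.find_min hex (m := i)
    set j := Nat.find hex
    have hj2 : 2 ≤ j := by
      by_contra hlt
      have : j = 0 ∨ j = 1 := by omega
      rcases this with h0 | h0
      · rw [h0] at hj; exact hx0 (by simpa using hj x hx)
      · rw [h0] at hj; exact hl0a (by simpa using hj l0 hl0)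
    obtain ⟨i, hi⟩ : ∃ i, j = i + 2 := ⟨j - 2, by omega⟩
    set b := a ^ (i + 1) with hb
    have hbL : b ∈ L := by rw [hb, pow_succ]; exact L.mul_mem_left _ ha
    have hbb : ∀ l ∈ L, l * b * b = 0 := by
      intro l hl
      rw [mul_assoc, hb, ← pow_add, show i + 1 + (i + 1) = j + i by omega, pow_add, ← mul_assoc,
        hj l hl, zero_mul]
    have hb0 := hmin (i + 1) (by omega)
    push Not at hb0
    obtain ⟨l1, hl1, hl1b⟩ := hb0
    let L' : Ideal C := Submodule.map (LinearMap.toSpanSingleton C C b) L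
    have hL' : ∀ z, z ∈ L' ↔ ∃ l ∈ L, l * b = z := by
      intro z
      simp [L', Submodule.mem_map, LinearMap.toSpanSingleton_apply]
    have hL'L : L' ≤ L := by
      intro z hz
      obtain ⟨l, hl, rfl⟩ := (hL' z).1 hz
      exact L.mul_mem_left _ hbL
    have hbot := levitzki hprime D (fun e => c (Equiv.Perm.decomposeFin.symm (0, e)))
      (by
        rw [← hc]; congr 1
        ext i
        refine Fin.cases ?_ (fun i => ?_) i <;> simp) L'
      (fun z hz => hL z (hL'L hz)) (by
        intro z hz l hl
        have hl := hL'L hl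
        choose z' hz' hzz using fun i => (hL' (z i)).1 (hz i)
        set g := ∑ e : Equiv.Perm (Fin D), c (Equiv.Perm.decomposeFin.symm (0, e)) •
          wprod (fun i => z (e i)) with hg
        have key : ∀ y ∈ L, ∀ l ∈ L, l * (b * y * g) = 0 := by
          intro y hy l hl
          have h1 := h (Fin.cons (b * y) z) (by
            intro i
            refine Fin.cases ?_ (fun i => ?_) i
            · simpa using L.mul_mem_left _ hy
            · simpa using hL'L (hz i)) l hl
          rwa [MonicId.step c (b * y) z (fun i => by
            rw [← hzz i, ← mul_assoc, hbb _ (hz' i), zero_mul])] at h1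
        rcases hprime (l1 * b) (l * g) (fun r => by
          have := key (r * l) (L.mul_mem_left r hl) l1 hl1
          rw [← this]; noncomm_ring) with h2 | h2
        · exact absurd h2 hl1b
        · exact h2)
    have : l1 * b ∈ L' := (hL' _).2 ⟨l1, hl1, rfl⟩
    rw [hbot] at this
    exact hl1b (by simpa using this)


theorem nilpotent_of_nil {B : Type*} [Ring B] {t : ℕ} (a : Fin t → B) (S : Ideal B)
    (hS : ∀ x ∈ S, IsNilpotent x) (ha : ∀ i, a i ∈ S)
    {D : ℕ} (c : Equiv.Perm (Fin D) → ℤ) (hc : c 1 = 1) (hB : MonicId c B) :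
    ∃ N : ℕ, ∀ l : List (Fin t), l.length = N → (l.map a).prod = 0 := by
  by_contra hcon
  push Not at hcon
  let Z : Set (Ideal B) := {I | I.IsTwoSided ∧ ∀ N, ∃ l : List (Fin t), l.length = N ∧
    (l.map a).prod ∉ I}
  obtain ⟨P, -, hP⟩ := zorn_le_nonempty₀ Z (by
    intro ch hch hchain y hy
    have hdir : DirectedOn (· ≤ ·) ch := hchain.directedOn
    have hmem : ∀ z, z ∈ sSup ch ↔ ∃ I ∈ ch, z ∈ I := fun z =>
      Submodule.mem_sSup_of_directed ⟨y, hy⟩ hdir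
    refine ⟨sSup ch, ⟨⟨?_⟩, ?_⟩, fun z hz => le_sSup hz⟩
    · intro x r hx
      obtain ⟨I, hI, hxI⟩ := (hmem x).1 hx
      have := (hch hI).1
      exact (hmem _).2 ⟨I, hI, I.mul_mem_right _ hxI⟩
    · intro N
      by_contra hall
      push Not at hall
      choose I hI hxI using fun f : Fin N → Fin t =>
        (hmem _).1 (hall (List.ofFn f) (by simp))
      have hdir' : Directed (· ≤ ·) (fun J : ch => (J : Ideal B)) :=
        directedOn_iff_directed.1 hdir
      have : Nonempty ch := ⟨⟨y, hy⟩⟩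
      obtain ⟨J, hJ⟩ := hdir'.finite_le (fun f : Fin N → Fin t => (⟨I f, hI f⟩ : ch))
      obtain ⟨l, hl, hlJ⟩ := (hch J.2).2 N
      apply hlJ
      subst hl
      have h1 := hJ (fun i => l.get i) (hxI (fun i => l.get i))
      simpa using h1)
    ⊥ ⟨inferInstance, fun N => by
      obtain ⟨l, hl, h⟩ := hcon N
      exact ⟨l, hl, by simpa using h⟩⟩
  have hPtwo : P.IsTwoSided := hP.prop.1
  have hbig : ∀ J : Ideal B, J.IsTwoSided → P ≤ J → (∃ x ∈ J, x ∉ P) →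
      ∃ N, ∀ l : List (Fin t), l.length = N → (l.map a).prod ∈ J := by
    intro J hJ hPJ ⟨x, hx, hxP⟩
    by_contra hh
    push Not at hh
    exact hxP (hP.le_of_ge (y := J) ⟨hJ, hh⟩ hPJ hx)
  have hprime : ∀ x y : B, (∀ r, x * r * y ∈ P) → x ∈ P ∨ y ∈ P := by
    intro x y hxy
    by_contra hh
    push Not at hh
    let J1 : Ideal B :=
      { carrier := {z | ∀ r, z * r * y ∈ P}
        add_mem' := by
          intro u v hu hv r
          rw [add_mul, add_mul]; exact P.add_mem (hu r) (hv r)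
        zero_mem' := by intro r; simp
        smul_mem' := by
          intro s u hu r
          have := P.mul_mem_left s (hu r)
          simpa [mul_assoc] using this }
    have hJ1 : ∀ z, z ∈ J1 ↔ ∀ r, z * r * y ∈ P := fun z => Iff.rfl
    have hJ1t : J1.IsTwoSided := ⟨by
      intro u s hu
      rw [hJ1] at hu ⊢
      intro r
      simpa [mul_assoc] using hu (s * r)⟩
    let J2 : Ideal B :=
      { carrier := {z | ∀ w ∈ J1, ∀ r, w * r * z ∈ P}
        add_mem' := by
          intro u v hu hv w hw r
          rw [mul_add]; exact P.add_mem (hu w hw r) (hv w hw r)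
        zero_mem' := by intro w hw r; simp
        smul_mem' := by
          intro s u hu w hw r
          have := hu w hw (r * s)
          simpa [mul_assoc] using this }
    have hJ2 : ∀ z, z ∈ J2 ↔ ∀ w ∈ J1, ∀ r, w * r * z ∈ P := fun z => Iff.rfl
    have hJ2t : J2.IsTwoSided := ⟨by
      intro u s hu
      rw [hJ2] at hu ⊢
      intro w hw r
      have := P.mul_mem_right s (hu w hw r)
      simpa [mul_assoc] using this⟩
    obtain ⟨N1, h1⟩ := hbig J1 hJ1t (by
      intro z hz
      rw [hJ1]
      intro r
      rw [mul_assoc]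
      exact P.mul_mem_right _ hz) ⟨x, hxy, hh.1⟩
    obtain ⟨N2, h2⟩ := hbig J2 hJ2t (by
      intro z hz
      rw [hJ2]
      intro w _ r
      exact P.mul_mem_left _ hz) ⟨y, fun w hw r => hw r, hh.2⟩
    obtain ⟨l, hl, hlP⟩ := hP.prop.2 (N1 + N2)
    apply hlP
    have e : (l.map a).prod = ((l.take N1).map a).prod * 1 * ((l.drop N1).map a).prod := by
      rw [mul_one, ← List.prod_append, ← List.map_append, List.take_append_drop]
    rw [e]
    exact h2 _ (by simp [hl]) _ (h1 _ (by simp [hl])) _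
  let q := Ideal.Quotient.mk P
  have hq : Function.Surjective q := Ideal.Quotient.mk_surjective
  have hker : ∀ x, q x = 0 ↔ x ∈ P := fun x => Ideal.Quotient.eq_zero_iff_mem
  have hbot := levitzki (C := B ⧸ P) (by
    intro x y hxy
    obtain ⟨x, rfl⟩ := hq x
    obtain ⟨y, rfl⟩ := hq y
    rw [hker, hker]
    refine hprime x y fun r => ?_
    rw [← hker, map_mul, map_mul]
    exact hxy _) D c hc (S.map q) (by
      intro z hz
      obtain ⟨s, hs, rfl⟩ := (Ideal.mem_map_iff_of_surjective q hq).1 hz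
      exact (hS s hs).map q) (by
      intro x _ l _
      choose y hy using fun i => hq (x i)
      have h1 := congrArg q (hB y)
      rw [map_sum, map_zero] at h1
      have h2 : ∑ w, c w • wprod (fun i => x (w i)) = 0 := by
        rw [← h1]
        refine Finset.sum_congr rfl fun w _ => ?_
        rw [map_zsmul]
        congr 1
        have := wprod_map (q : B →* B ⧸ P) (fun i => y (w i))
        simp only [← hy]
        exact this.symm
      rw [h2, mul_zero])
  obtain ⟨l, hl, hlP⟩ := hP.prop.2 1
  obtain ⟨i, rfl⟩ := List.length_eq_one_iff.1 hl
  apply hlP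
  have : q (a i) ∈ S.map q := Ideal.mem_map_of_mem q (ha i)
  rw [hbot] at this
  rw [← hker]
  simpa using this


/-- operator of the factor of length `p` starting at position `j` of the word `W` -/
def wordOp {R : Type*} [Monoid R] {t : ℕ} (a : Fin t → R) (W : ℕ → Fin t) (j : ℕ) : ℕ → R
  | 0 => 1
  | p + 1 => a (W (j + p)) * wordOp a W j p

theorem wordOp_list {R : Type*} [Monoid R] {t : ℕ} (a : Fin t → R) (W : ℕ → Fin t) (j p : ℕ) :
    ∃ l : List (Fin t), l.length = p ∧ (l.map a).prod = wordOp a W j p := by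
  induction p with
  | zero => exact ⟨[], rfl, rfl⟩
  | succ p ih =>
    obtain ⟨l, hl, h⟩ := ih
    exact ⟨W (j + p) :: l, by simp [hl], by simp [h, wordOp]⟩

theorem wordOp_congr {R : Type*} [Monoid R] {t : ℕ} (a : Fin t → R) (W : ℕ → Fin t) (i j p : ℕ)
    (h : ∀ q < p, W (i + q) = W (j + q)) : wordOp a W i p = wordOp a W j p := by
  induction p with
  | zero => rfl
  | succ p ih =>
    simp only [wordOp]
    rw [ih (fun q hq => h q (by omega)), h p (by omega)]

theorem ufnarovskii {F V : Type*} [Field F] [AddCommGroup V] [Module F V] [FiniteDimensional F V]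
    {t : ℕ} (a : Fin t → Module.End F V) (hdie : ∀ u : V, u ≠ 0 → ∃ i, a i u ≠ 0)
    (v : V) (hv : v ≠ 0) (d : ℕ) (hd : Module.finrank F V ≤ d)
    (ha : ∀ l : List (Fin t), 1 ≤ l.length → l.length ≤ d → IsNilpotent (l.map a).prod) :
    False := by
  classical
  have hg : ∀ u : {u : V // u ≠ 0}, ∃ i, a i u ≠ 0 ∧ ∀ i', a i' u ≠ 0 → i' ≤ i := by
    intro u
    obtain ⟨i, hi⟩ := hdie u u.2
    obtain ⟨j, hj, hmax⟩ := Finset.exists_max_image (Finset.univ.filter fun i => a i u ≠ 0) id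
      ⟨i, by simpa using hi⟩
    exact ⟨j, by simpa using hj, fun i' hi' => hmax i' (by simpa using hi')⟩
  choose g hg1 hg2 using hg
  let U' : ℕ → {u : V // u ≠ 0} := fun n =>
    Nat.rec ⟨v, hv⟩ (fun _ u => ⟨a (g u) u, hg1 u⟩) n
  let U : ℕ → V := fun n => (U' n).1
  let W : ℕ → Fin t := fun n => g (U' n)
  have hU0 : ∀ n, U n ≠ 0 := fun n => (U' n).2
  have hUs : ∀ n, U (n + 1) = a (W n) (U n) := fun n => rfl
  have hW : ∀ n i, a i (U n) ≠ 0 → i ≤ W n := fun n i h => hg2 _ _ h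
  let M := wordOp a W
  have hMs : ∀ j p x, M j (p + 1) x = a (W (j + p)) (M j p x) := fun j p x => rfl
  have hMU : ∀ i p, M i p (U i) = U (i + p) := by
    intro i p
    induction p with
    | zero => rfl
    | succ p ih => rw [hMs, ih, ← add_assoc, hUs]
  have hMmono : ∀ j p p' x, p ≤ p' → M j p x = 0 → M j p' x = 0 := by
    intro j p p' x hpp h
    induction p', hpp using Nat.le_induction with
    | base => exact h
    | succ q _ ih => rw [hMs, ih, map_zero]
  let s : ℕ → Lex (ℕ → Fin t) := fun i => toLex (fun p => W (i + p))
  have hA : ∀ i j, s i < s j → ∃ p, M j p (U i) = 0 := by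
    intro i j hij
    by_contra hh
    push Not at hh
    obtain ⟨p, hp1, hp2⟩ := hij
    have hp1 : ∀ q < p, W (i + q) = W (j + q) := fun q hq => hp1 q hq
    have hp2 : W (i + p) < W (j + p) := hp2
    have h1 : M j p (U i) = U (i + p) := by
      rw [← hMU]
      simp only [M]
      rw [wordOp_congr a W i j p hp1]
    have h2 := hh (p + 1)
    rw [hMs, h1] at h2
    exact absurd (hW _ _ h2) (not_le.2 hp2)
  have hinj : ∀ i j, i < j → j ≤ d → s i ≠ s j := by
    intro i j hij hjd hs
    obtain ⟨e, rfl⟩ : ∃ e, j = i + e := ⟨j - i, by omega⟩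
    have hper : ∀ p, W (i + p) = W (i + p + e) := by
      intro p
      have := congrFun (congrArg ofLex hs) p
      have h2 : W (i + p) = W (i + e + p) := this
      rw [h2]; congr 1; omega
    have hpern : ∀ n p, W (i + p) = W (i + n * e + p) := by
      intro n p
      induction n with
      | zero => simp
      | succ n ih =>
        rw [ih, show i + n * e + p = i + (n * e + p) by ring, hper]
        congr 1; ring
    obtain ⟨l, hl, hl2⟩ := wordOp_list a W i e
    obtain ⟨n, hn⟩ := ha l (by omega) (by omega)
    rw [hl2] at hn
    have : ∀ n, ((M i e) ^ n) (U i) = U (i + n * e) := by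
      intro n
      induction n with
      | zero => simp
      | succ n ih =>
        rw [pow_succ', Module.End.mul_apply, ih]
        have : M i e = M (i + n * e) e := wordOp_congr a W _ _ _ (fun q _ => hpern n q)
        rw [this, hMU]
        congr 1; ring
    have h3 := this n
    simp only [M] at h3
    rw [hn] at h3
    exact hU0 _ h3.symm
  have hinj' : ∀ i j, i ≤ d → j ≤ d → i ≠ j → s i ≠ s j := by
    intro i j hi hj hne
    rcases lt_or_gt_of_ne hne with h | h
    · exact hinj i j h hj
    · exact (hinj j i h hi).symm
  have hli : LinearIndependent F (fun i : Fin (d + 1) => U i) := by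
    rw [Fintype.linearIndependent_iff]
    intro c hc
    by_contra hne
    push Not at hne
    obtain ⟨i0, hi0⟩ := hne
    obtain ⟨j, hj, hmax⟩ := Finset.exists_max_image (Finset.univ.filter fun i => c i ≠ 0)
      (fun i => s i) ⟨i0, by simpa using hi0⟩
    have hj : c j ≠ 0 := by simpa using hj
    have hp : ∀ i : Fin (d + 1), ∃ p, i ≠ j → c i ≠ 0 → M j p (U i) = 0 := by
      intro i
      by_cases hij : i = j
      · exact ⟨0, fun h => absurd hij h⟩
      by_cases hci : c i = 0
      · exact ⟨0, fun _ h => absurd hci h⟩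
      obtain ⟨p, hp⟩ := hA i j (lt_of_le_of_ne (hmax i (by simpa using hci))
        (hinj' i j (by omega) (by omega) (fun h => hij (Fin.ext h))))
      exact ⟨p, fun _ _ => hp⟩
    choose p hp using hp
    have h1 := congrArg (M j (∑ i, p i)) hc
    rw [map_sum, map_zero, Finset.sum_eq_single j] at h1
    · rw [map_smul, hMU] at h1
      rcases smul_eq_zero.1 h1 with h | h
      · exact hj h
      · exact hU0 _ h
    · intro i _ hij
      rw [map_smul]
      by_cases hci : c i = 0
      · rw [hci, zero_smul]
      · rw [hMmono j (p i) _ _ (Finset.single_le_sum (fun _ _ => Nat.zero_le _)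
          (Finset.mem_univ i)) (hp i hij hci), smul_zero]
    · simp
  have := hli.fintype_card_le_finrank
  simp at this
  omega


/-- index type of the second compound matrix -/
abbrev Pr (q : ℕ) := {p : Fin q × Fin q // p.1 < p.2}

/-- second compound matrix -/
def cpd {F : Type*} [Field F] {q : ℕ} (M : Matrix (Fin q) (Fin q) F) : Matrix (Pr q) (Pr q) F :=
  Matrix.of fun p r => M p.1.1 r.1.1 * M p.1.2 r.1.2 - M p.1.1 r.1.2 * M p.1.2 r.1.1

theorem sum_pairs {F : Type*} [Field F] {q : ℕ} (f : Fin q → Fin q → F) (h0 : ∀ a, f a a = 0) :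
    ∑ a, ∑ b, f a b = ∑ p : Pr q, (f p.1.1 p.1.2 + f p.1.2 p.1.1) := by
  classical
  rw [Finset.sum_add_distrib]
  have e1 : ∑ p : Pr q, f p.1.1 p.1.2 = ∑ a, ∑ b, if a < b then f a b else 0 := by
    rw [← Fintype.sum_prod_type' (fun a b => if a < b then f a b else 0), ← Finset.sum_filter,
      Finset.sum_subtype (p := fun p : Fin q × Fin q => p.1 < p.2)]
    simp
  have e2 : ∑ p : Pr q, f p.1.2 p.1.1 = ∑ a, ∑ b, if b < a then f a b else 0 := by
    rw [Finset.sum_comm, ← Fintype.sum_prod_type' (fun b a => if b < a then f a b else 0),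
      ← Finset.sum_filter, Finset.sum_subtype (p := fun p : Fin q × Fin q => p.1 < p.2)]
    simp
  rw [e1, e2, ← Finset.sum_add_distrib]
  refine Finset.sum_congr rfl fun a _ => ?_
  rw [← Finset.sum_add_distrib]
  refine Finset.sum_congr rfl fun b _ => ?_
  rcases lt_trichotomy a b with h | h | h
  · simp [h, h.le]
  · subst h; simp [h0]
  · simp [h, h.le]

theorem cpd_mul {F : Type*} [Field F] {q : ℕ} (M N : Matrix (Fin q) (Fin q) F) :
    cpd (M * N) = cpd M * cpd N := by
  ext ⟨⟨i, j⟩, hij⟩ ⟨⟨k, l⟩, hkl⟩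
  have := sum_pairs (fun a b => M i a * M j b * (N a k * N b l - N a l * N b k))
    (fun a => by ring)
  simp only [cpd, Matrix.mul_apply, Matrix.of_apply]
  rw [Finset.sum_mul_sum, Finset.sum_mul_sum, ← Finset.sum_sub_distrib]
  trans ∑ a, ∑ b, M i a * M j b * (N a k * N b l - N a l * N b k)
  · refine Finset.sum_congr rfl fun a _ => ?_
    rw [← Finset.sum_sub_distrib]
    refine Finset.sum_congr rfl fun b _ => ?_
    ring
  · rw [this]
    refine Finset.sum_congr rfl fun p _ => ?_
    ring

/-- second coefficient of the characteristic polynomial -/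
def e2 {F : Type*} [Field F] {q : ℕ} (M : Matrix (Fin q) (Fin q) F) : F := (cpd M).trace

theorem e2_nilpotent {F : Type*} [Field F] {q : ℕ} (M : Matrix (Fin q) (Fin q) F)
    (h : IsNilpotent M) : e2 M = 0 := by
  obtain ⟨n, hn⟩ := h
  have hp : ∀ n, cpd (M ^ (n + 1)) = (cpd M) ^ (n + 1) := by
    intro n
    induction n with
    | zero => simp
    | succ n ih => rw [pow_succ, cpd_mul, ih, ← pow_succ]
  have h0 : (cpd M) ^ (n + 1) = 0 := by
    rw [← hp, pow_succ, hn, zero_mul]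
    ext; simp [cpd]
  exact (Matrix.isNilpotent_trace_of_isNilpotent ⟨_, h0⟩).eq_zero

/-- polar form of `e2` -/
def e2polar {F : Type*} [Field F] {q : ℕ} (M N : Matrix (Fin q) (Fin q) F) : F :=
  ∑ p : Pr q, (M p.1.1 p.1.1 * N p.1.2 p.1.2 + N p.1.1 p.1.1 * M p.1.2 p.1.2
    - M p.1.1 p.1.2 * N p.1.2 p.1.1 - N p.1.1 p.1.2 * M p.1.2 p.1.1)

theorem e2_add {F : Type*} [Field F] {q : ℕ} (M N : Matrix (Fin q) (Fin q) F) :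
    e2 (M + N) = e2 M + e2 N + e2polar M N := by
  simp only [e2, e2polar, Matrix.trace, Matrix.diag, cpd, Matrix.of_apply, Matrix.add_apply]
  rw [← Finset.sum_add_distrib, ← Finset.sum_add_distrib]
  refine Finset.sum_congr rfl fun p _ => ?_
  ring

theorem e2_smul {F : Type*} [Field F] {q : ℕ} (c : F) (M : Matrix (Fin q) (Fin q) F) :
    e2 (c • M) = c ^ 2 * e2 M := by
  simp only [e2, Matrix.trace, Matrix.diag, cpd, Matrix.of_apply, Matrix.smul_apply, smul_eq_mul]
  rw [Finset.mul_sum]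
  refine Finset.sum_congr rfl fun p _ => ?_
  ring

theorem e2polar_comm {F : Type*} [Field F] {q : ℕ} (M N : Matrix (Fin q) (Fin q) F) :
    e2polar M N = e2polar N M := by
  refine Finset.sum_congr rfl fun p _ => ?_
  ring

theorem e2polar_add {F : Type*} [Field F] {q : ℕ} (M M' N : Matrix (Fin q) (Fin q) F) :
    e2polar (M + M') N = e2polar M N + e2polar M' N := by
  simp only [e2polar]
  rw [← Finset.sum_add_distrib]
  refine Finset.sum_congr rfl fun p _ => ?_
  simp only [Matrix.add_apply]
  ring

theorem e2polar_smul {F : Type*} [Field F] {q : ℕ} (c : F) (M N : Matrix (Fin q) (Fin q) F) :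
    e2polar (c • M) N = c * e2polar M N := by
  simp only [e2polar]
  rw [Finset.mul_sum]
  refine Finset.sum_congr rfl fun p _ => ?_
  simp only [Matrix.smul_apply, smul_eq_mul]
  ring

theorem e2_zero {F : Type*} [Field F] {q : ℕ} : e2 (0 : Matrix (Fin q) (Fin q) F) = 0 :=
  e2_nilpotent 0 IsNilpotent.zero

theorem e2polar_zero {F : Type*} [Field F] {q : ℕ} (N : Matrix (Fin q) (Fin q) F) :
    e2polar 0 N = 0 := by
  have := e2polar_smul 0 0 N
  simpa using this

theorem e2_span {F : Type*} [Field F] {q : ℕ}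
    (Bs : AddSubgroup (Matrix (Fin q) (Fin q) F)) (hspan : Submodule.span F (Bs : Set (Matrix (Fin q) (Fin q) F)) = ⊤)
    (L : Matrix (Fin q) (Fin q) F →ₗ[F] Matrix (Fin q) (Fin q) F)
    (hL : ∀ y ∈ Bs, e2 (L y) = 0) (y : Matrix (Fin q) (Fin q) F) : e2 (L y) = 0 := by
  have hmem : ∀ y, y ∈ Submodule.span F (Bs : Set (Matrix (Fin q) (Fin q) F)) := by
    intro y; rw [hspan]; trivial
  have h1 : ∀ y ∈ Bs, ∀ z ∈ Bs, e2polar (L y) (L z) = 0 := by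
    intro y hy z hz
    have := e2_add (L y) (L z)
    rw [← map_add, hL _ (Bs.add_mem hy hz), hL y hy, hL z hz] at this
    simpa using this.symm
  have h2 : ∀ y, ∀ z ∈ Bs, e2polar (L y) (L z) = 0 := by
    intro y z hz
    induction hmem y using Submodule.span_induction with
    | mem x h => exact h1 x h z hz
    | zero => rw [map_zero, e2polar_zero]
    | add x y _ _ hx hy => rw [map_add, e2polar_add, hx, hy, add_zero]
    | smul c x _ hx => rw [map_smul, e2polar_smul, hx, mul_zero]
  have h3 : ∀ y z, e2polar (L y) (L z) = 0 := by
    intro y z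
    rw [e2polar_comm]
    induction hmem z using Submodule.span_induction with
    | mem x h => rw [e2polar_comm]; exact h2 y x h
    | zero => rw [map_zero, e2polar_zero]
    | add x y _ _ hx hy => rw [map_add, e2polar_add, hx, hy, add_zero]
    | smul c x _ hx => rw [map_smul, e2polar_smul, hx, mul_zero]
  induction hmem y using Submodule.span_induction with
  | mem x h => exact hL x h
  | zero => rw [map_zero, e2_zero]
  | add x y _ _ hx hy => rw [map_add, e2_add, hx, hy, h3]; simp
  | smul c x _ hx => rw [map_smul, e2_smul, hx, mul_zero]

/-- the standard polynomial as a multilinear map -/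
def stMul (F E : Type*) [Field F] [Ring E] [Algebra F E] (n : ℕ) :
    MultilinearMap F (fun _ : Fin n => E) E :=
  ∑ σ : Equiv.Perm (Fin n), (Equiv.Perm.sign σ : ℤ) •
    (MultilinearMap.mkPiAlgebraFin F n E).domDomCongr σ

theorem stMul_apply {F E : Type*} [Field F] [Ring E] [Algebra F E] {n : ℕ} (x : Fin n → E) :
    stMul F E n x = stv x := by
  simp [stMul, stv, wprod, -zsmul_eq_mul]

theorem e2_st {F : Type*} [Field F] {q n : ℕ}
    (Bs : AddSubgroup (Matrix (Fin q) (Fin q) F)) (hspan : Submodule.span F (Bs : Set (Matrix (Fin q) (Fin q) F)) = ⊤)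
    (hst : ∀ x : Fin n → Matrix (Fin q) (Fin q) F, (∀ i, x i ∈ Bs) → IsNilpotent (stv x))
    (x : Fin n → Matrix (Fin q) (Fin q) F) : e2 (stv x) = 0 := by
  classical
  have key : ∀ T : Finset (Fin n), ∀ x : Fin n → Matrix (Fin q) (Fin q) F,
      (∀ i ∉ T, x i ∈ Bs) → e2 (stv x) = 0 := by
    intro T
    induction T using Finset.induction_on with
    | empty => exact fun x hx => e2_nilpotent _ (hst x (fun i => hx i (by simp)))
    | insert j T hj ih =>
      intro x hx
      have := e2_span Bs hspan ((stMul F (Matrix (Fin q) (Fin q) F) n).toLinearMap x j) (by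
        intro y hy
        rw [MultilinearMap.toLinearMap_apply, stMul_apply]
        apply ih
        intro i hi
        by_cases hij : i = j
        · subst hij; simpa using hy
        · rw [Function.update_of_ne hij]
          exact hx i (by simp [hij, hi])) (x j)
      rw [MultilinearMap.toLinearMap_apply, stMul_apply, Function.update_eq_self] at this
      exact this
  exact key Finset.univ x (by simp)

theorem stv_comp_perm {A : Type*} [Ring A] {n : ℕ} (x : Fin n → A) (τ : Equiv.Perm (Fin n)) :
    stv (fun i => x (τ i)) = (Equiv.Perm.sign τ : ℤ) • stv x := by
  unfold stv
  rw [← Equiv.sum_comp (Equiv.mulLeft τ) (fun σ : Equiv.Perm (Fin n) => (Equiv.Perm.sign σ : ℤ) • wprod fun i => x (σ i)),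
    Finset.smul_sum]
  refine Finset.sum_congr rfl fun σ _ => ?_
  rw [smul_smul]
  simp only [Equiv.coe_mulLeft, Equiv.Perm.mul_apply, Equiv.Perm.sign_mul, Units.val_mul]
  rw [← mul_assoc, ← Units.val_mul, Int.units_mul_self, Units.val_one, one_mul]

theorem wprod_single {F J : Type*} [Field F] [Fintype J] [DecidableEq J] :
    ∀ (n : ℕ) (s t : Fin (n + 1) → J), (∀ i : Fin n, t i.castSucc = s i.succ) →
      wprod (fun i => Matrix.single (s i) (t i) (1 : F)) =
        Matrix.single (s 0) (t (Fin.last n)) 1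
  | 0, s, t, _ => by simp [wprod]
  | n + 1, s, t, h => by
    rw [wprod_succ, wprod_single n (fun i => s i.succ) (fun i => t i.succ)
      (fun i => h i.succ)]
    have := h 0
    simp only [Fin.castSucc_zero] at this
    simp only [this, Matrix.single_mul_single_same, mul_one, Fin.succ_last]

theorem stv_single {F J : Type*} [Field F] [Fintype J] [DecidableEq J]
    (n : ℕ) (s t : Fin (n + 1) → J) (h : ∀ i : Fin n, t i.castSucc = s i.succ)
    (hu : ∀ σ : Equiv.Perm (Fin (n + 1)), (∀ i : Fin n, t (σ i.castSucc) = s (σ i.succ)) →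
      StrictMono σ) :
    stv (fun i => Matrix.single (s i) (t i) (1 : F)) =
        Matrix.single (s 0) (t (Fin.last n)) 1 := by
  unfold stv
  rw [Finset.sum_eq_single 1]
  · simpa using wprod_single n s t h
  · intro σ _ hσ
    have : ¬ StrictMono σ := by
      intro hm
      apply hσ
      have h1 : (σ : Fin (n + 1) → Fin (n + 1)) = id :=
        (hm.range_inj strictMono_id).1 (by simp [σ.surjective.range_eq])
      ext i
      simp [h1]
    have h2 : ¬ ∀ i : Fin n, t (σ i.castSucc) = s (σ i.succ) := fun h => this (hu σ h)
    push Not at h2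
    obtain ⟨i, hi⟩ := h2
    rw [wprod_eq_zero _ (i : ℕ) (by omega), smul_zero]
    exact Matrix.single_mul_single_of_ne _ _ _ _ hi _
  · simp

theorem e2_single {F : Type*} [Field F] {q : ℕ} (a b : Fin q) (hab : a < b) (ε : F) :
    e2 (Matrix.single a b 1 + ε • Matrix.single b a 1) = - ε := by
  simp only [e2, Matrix.trace, Matrix.diag, cpd, Matrix.of_apply, Matrix.add_apply,
    Matrix.smul_apply, smul_eq_mul]
  rw [Finset.sum_eq_single ⟨(a, b), hab⟩]
  · simp [Matrix.single_apply, hab.ne, hab.ne']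
  · rintro ⟨⟨i, j⟩, hij⟩ _ hne
    have hij : i < j := hij
    have hne : ¬ (i = a ∧ j = b) := by
      rintro ⟨rfl, rfl⟩; exact hne rfl
    simp only [Matrix.single_apply]
    have h1 : ¬ (a = i ∧ b = i) := by rintro ⟨rfl, h⟩; exact hab.ne' h
    have h2 : ¬ (b = i ∧ a = i) := by rintro ⟨rfl, h⟩; exact hab.ne h
    have h3 : ¬ (a = i ∧ b = j) := by rintro ⟨rfl, rfl⟩; exact hne ⟨rfl, rfl⟩
    have h4 : ¬ (b = i ∧ a = j) := by rintro ⟨rfl, rfl⟩; exact absurd hij hab.asymm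
    simp [h1, h2, h3, h4]
  · simp

theorem matrix_bound {F : Type*} [Field F] {q d : ℕ} (hd : 1 ≤ d)
    (Bs : AddSubgroup (Matrix (Fin q) (Fin q) F)) (hspan : Submodule.span F (Bs : Set (Matrix (Fin q) (Fin q) F)) = ⊤)
    (hst : ∀ x : Fin (2 * d) → Matrix (Fin q) (Fin q) F, (∀ i, x i ∈ Bs) → IsNilpotent (stv x)) :
    q ≤ d := by
  by_contra hq
  push Not at hq
  obtain ⟨n, hn⟩ : ∃ n, 2 * d = n + 1 := ⟨2 * d - 1, by omega⟩
  rw [hn] at hst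
  let V : ℕ → Fin q := fun i => if h : i ≤ d then ⟨i, by omega⟩ else ⟨0, by omega⟩
  have hV : ∀ i j, i ≤ d → j ≤ d → V i = V j → i = j := by
    intro i j hi hj h
    simp only [V, dif_pos hi, dif_pos hj] at h
    simpa using h
  let s1 : Fin (n + 1) → ℕ := fun r => if (r : ℕ) = n then 0 else ((r : ℕ) + 1) / 2
  let t1 : Fin (n + 1) → ℕ := fun r =>
    if (r : ℕ) = n then d else if (r : ℕ) + 1 = n then 0 else ((r : ℕ) + 2) / 2
  let s2 : Fin (n + 1) → ℕ := fun r => if (r : ℕ) = 0 then d else (r : ℕ) / 2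
  let t2 : Fin (n + 1) → ℕ := fun r =>
    if (r : ℕ) = 0 then 0 else if (r : ℕ) = n then 0 else ((r : ℕ) + 1) / 2
  have bs1 : ∀ r, s1 r ≤ d := by intro r; simp only [s1]; split_ifs <;> omega
  have bt1 : ∀ r, t1 r ≤ d := by intro r; simp only [t1]; split_ifs <;> omega
  have bs2 : ∀ r, s2 r ≤ d := by intro r; simp only [s2]; split_ifs <;> omega
  have bt2 : ∀ r, t2 r ≤ d := by intro r; simp only [t2]; split_ifs <;> omega
  let x1 : Fin (n + 1) → Matrix (Fin q) (Fin q) F := fun i =>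
    Matrix.single (V (s1 i)) (V (t1 i)) 1
  let x2 : Fin (n + 1) → Matrix (Fin q) (Fin q) F := fun i =>
    Matrix.single (V (s2 i)) (V (t2 i)) 1
  have E1 : stv x1 = Matrix.single (V 0) (V d) 1 := by
    have := stv_single (F := F) n (fun i => V (s1 i)) (fun i => V (t1 i)) (by
      intro i
      congr 1
      simp only [s1, t1, Fin.val_castSucc, Fin.val_succ]
      split_ifs <;> omega) (by
      intro σ hσ
      have hσ : ∀ (i j : Fin (n + 1)), (j : ℕ) = i + 1 → t1 (σ i) = s1 (σ j) := by
        intro i j hij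
        have h1 := hV _ _ (bt1 _) (bs1 _) (hσ ⟨i, by omega⟩)
        have e : (⟨(i : ℕ), by omega⟩ : Fin n).succ = j := by ext; simp [hij]
        rw [e] at h1
        exact h1
      obtain ⟨i0, hi0⟩ := σ.surjective (Fin.last n)
      have hi0n : (i0 : ℕ) = n := by
        by_contra hne
        have := hσ i0 ⟨i0 + 1, by omega⟩ rfl
        rw [hi0] at this
        simp only [s1, t1, Fin.val_last] at this
        split_ifs at this <;> omega
      obtain ⟨i1, hi1⟩ : ∃ i1 : Fin (n + 1), (i1 : ℕ) + 1 = n := ⟨⟨n - 1, by omega⟩, by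
        simp; omega⟩
      have hσi1 : (σ i1 : ℕ) + 1 = n := by
        have := hσ i1 i0 (by omega)
        rw [hi0] at this
        simp only [s1, t1, Fin.val_last] at this
        split_ifs at this <;> omega
      rw [Fin.strictMono_iff_lt_succ]
      intro i
      have h1 := hσ i.castSucc i.succ (by simp)
      have hne : (σ i.castSucc : ℕ) ≠ σ i.succ := by
        intro h
        have := σ.injective (Fin.ext h)
        simp [Fin.ext_iff] at this
      rw [Fin.lt_def]
      by_cases hc : (σ i.castSucc : ℕ) + 1 = n
      · have h2 : i.castSucc = i1 := σ.injective (Fin.ext (by omega))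
        have h3 : i.succ = i0 := by
          ext
          have := congrArg Fin.val h2
          simp at this
          simp; omega
        rw [h3, hi0]
        simp; omega
      · simp only [s1, t1] at h1
        have := (σ i.castSucc).2
        have := (σ i.succ).2
        split_ifs at h1 <;> omega)
    simp only [x1]
    rw [this]
    congr 1
    · congr 1; simp only [s1]; split_ifs <;> simp
    · simp [t1]
  have E2 : stv x2 = Matrix.single (V d) (V 0) 1 := by
    have := stv_single (F := F) n (fun i => V (s2 i)) (fun i => V (t2 i)) (by
      intro i
      congr 1
      simp only [s2, t2, Fin.val_castSucc, Fin.val_succ]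
      split_ifs <;> first | omega | contradiction) (by
      intro σ hσ
      have hσ : ∀ (i j : Fin (n + 1)), (j : ℕ) = i + 1 → t2 (σ i) = s2 (σ j) := by
        intro i j hij
        have h1 := hV _ _ (bt2 _) (bs2 _) (hσ ⟨i, by omega⟩)
        have e : (⟨(i : ℕ), by omega⟩ : Fin n).succ = j := by ext; simp [hij]
        rw [e] at h1
        exact h1
      obtain ⟨i0, hi0⟩ := σ.surjective 0
      have hi0n : (i0 : ℕ) = 0 := by
        by_contra hne
        have := hσ ⟨i0 - 1, by omega⟩ i0 (by simp; omega)
        rw [hi0] at this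
        simp only [s2, t2, Fin.val_zero] at this
        have := (σ ⟨i0 - 1, by omega⟩).2
        split_ifs at * <;> omega
      obtain ⟨i1, hi1⟩ : ∃ i1 : Fin (n + 1), (i1 : ℕ) = 1 := ⟨⟨1, by omega⟩, rfl⟩
      have hσi1 : (σ i1 : ℕ) = 1 := by
        have := hσ i0 i1 (by omega)
        rw [hi0] at this
        simp only [s2, t2, Fin.val_zero] at this
        split_ifs at this <;> omega
      rw [Fin.strictMono_iff_lt_succ]
      intro i
      have h1 := hσ i.castSucc i.succ (by simp)
      have hne : (σ i.castSucc : ℕ) ≠ σ i.succ := by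
        intro h
        have := σ.injective (Fin.ext h)
        simp [Fin.ext_iff] at this
      rw [Fin.lt_def]
      by_cases hc : (σ i.succ : ℕ) = 1
      · have h2 : i.succ = i1 := σ.injective (Fin.ext (by omega))
        have h3 : i.castSucc = i0 := by
          ext
          have := congrArg Fin.val h2
          simp at this
          simp; omega
        rw [h3, hi0, hc]
        exact Nat.zero_lt_one
      · simp only [s2, t2] at h1
        have := (σ i.castSucc).2
        have := (σ i.succ).2
        split_ifs at h1 <;> omega)
    simp only [x2]
    rw [this]
    congr 1
    congr 1; simp only [t2]; split_ifs <;> simp_all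
  let ε : ℤ := (Equiv.Perm.sign (finRotate (n + 1)) : ℤ)
  have hx2 : (fun i => x2 (finRotate (n + 1) i)) = Function.update x1 (Fin.last n)
      (x2 0) := by
    ext1 i
    refine Fin.lastCases ?_ (fun i => ?_) i
    · simp
    · rw [Function.update_of_ne (Fin.castSucc_lt_last i).ne, finRotate_apply,
        Fin.coeSucc_eq_succ]
      simp only [x1, x2]
      congr 2
      · simp [s1, s2, i.2.ne]
      · simp only [t1, t2, Fin.val_castSucc, Fin.val_succ]
        split_ifs <;> first | omega | contradiction
  have hfin : stv (Function.update x1 (Fin.last n) (x1 (Fin.last n) + x2 0)) =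
      Matrix.single (V 0) (V d) 1 + (ε : F) • Matrix.single (V d) (V 0) 1 := by
    rw [← stMul_apply (F := F), MultilinearMap.map_update_add, Function.update_eq_self, stMul_apply,
      stMul_apply, E1, ← hx2, stv_comp_perm, E2]
    rw [Int.cast_smul_eq_zsmul]
  have h0 := e2_st Bs hspan hst (Function.update x1 (Fin.last n) (x1 (Fin.last n) + x2 0))
  rw [hfin, e2_single _ _ (by simp [V]; omega)] at h0
  have hε : (ε : F) * ε = 1 := by
    rw [← Int.cast_mul]
    simp only [ε]
    rw [← Units.val_mul, Int.units_mul_self]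
    simp
  rw [neg_eq_zero] at h0
  rw [h0] at hε
  simp at hε


theorem multilinear_span {F E G : Type*} [Field F] [AddCommGroup E] [Module F E]
    [AddCommGroup G] [Module F G] {n : ℕ} (f : MultilinearMap F (fun _ : Fin n => E) G)
    (T : Set E) (hT : ∀ x : Fin n → E, (∀ i, x i ∈ T) → f x = 0)
    (x : Fin n → E) (hx : ∀ i, x i ∈ Submodule.span F T) : f x = 0 := by
  classical
  have key : ∀ U : Finset (Fin n), ∀ x : Fin n → E, (∀ i ∈ U, x i ∈ Submodule.span F T) →
      (∀ i ∉ U, x i ∈ T) → f x = 0 := by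
    intro U
    induction U using Finset.induction_on with
    | empty => exact fun x _ hx => hT x (fun i => hx i (by simp))
    | insert j U hj ih =>
      intro x hs hx
      have hle : Submodule.span F T ≤ LinearMap.ker (f.toLinearMap x j) := by
        rw [Submodule.span_le]
        intro y hy
        simp only [SetLike.mem_coe, LinearMap.mem_ker, MultilinearMap.toLinearMap_apply]
        apply ih
        · intro i hi
          have hij : i ≠ j := by rintro rfl; exact hj hi
          rw [Function.update_of_ne hij]
          exact hs i (by simp [hi])
        · intro i hi
          by_cases hij : i = j
          · subst hij; simpa using hy
          · rw [Function.update_of_ne hij]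
            exact hx i (by simp [hij, hi])
      have := hle (hs j (by simp))
      rw [LinearMap.mem_ker, MultilinearMap.toLinearMap_apply, Function.update_eq_self] at this
      exact this
  exact key Finset.univ x (fun i _ => hx i) (by simp)

/-- the multilinear map of a multilinear polynomial -/
def monMul (F E : Type*) [Field F] [Ring E] [Algebra F E] {n : ℕ}
    (c : Equiv.Perm (Fin n) → ℤ) : MultilinearMap F (fun _ : Fin n => E) E :=
  ∑ σ : Equiv.Perm (Fin n), c σ • (MultilinearMap.mkPiAlgebraFin F n E).domDomCongr σ

theorem monMul_apply {F E : Type*} [Field F] [Ring E] [Algebra F E] {n : ℕ}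
    (c : Equiv.Perm (Fin n) → ℤ) (x : Fin n → E) :
    monMul F E c x = ∑ w, c w • wprod (fun i => x (w i)) := by
  simp [monMul, wprod, -zsmul_eq_mul]

/-- existence of a maximal subfield -/
theorem exists_max_subfield.{u} (D : Type u) [DivisionRing D] :
    ∃ (F : Type u) (_ : Field F) (j : F →+* D), ∀ x : D, (∀ y, x * j y = j y * x) →
      x ∈ Set.range j := by
  classical
  obtain ⟨S, hS⟩ := zorn_subset {S : Set D | ∀ x ∈ S, ∀ y ∈ S, x * y = y * x} (by
    intro c hc hch
    refine ⟨⋃₀ c, ?_, fun s hs => Set.subset_sUnion_of_mem hs⟩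
    rintro x ⟨s, hs, hx⟩ y ⟨s', hs', hy⟩
    rcases hch.total hs hs' with h | h
    · exact hc hs' x (h hx) y hy
    · exact hc hs x hx y (h hy))
  have hcen : ∀ x, (∀ y ∈ S, y * x = x * y) → x ∈ S := by
    intro x hx
    have hin : insert x S ∈ {S : Set D | ∀ x ∈ S, ∀ y ∈ S, x * y = y * x} := by
      rintro a (rfl | ha) b (rfl | hb)
      · rfl
      · exact (hx b hb).symm
      · exact hx a ha
      · exact hS.prop a ha b hb
    exact hS.le_of_ge hin (Set.subset_insert x S) (Set.mem_insert x S)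
  let K : Subring D := Subring.centralizer S
  have hK : ∀ x, x ∈ K ↔ x ∈ S := by
    intro x
    rw [Subring.mem_centralizer_iff]
    exact ⟨hcen x, fun hx y hy => hS.prop y hy x hx⟩
  have hF : IsField K := by
    refine ⟨⟨0, 1, zero_ne_one⟩, ?_, ?_⟩
    · intro x y
      exact Subtype.ext (hS.prop _ ((hK _).1 x.2) _ ((hK _).1 y.2))
    · intro x hx
      refine ⟨⟨(x : D)⁻¹, Set.inv_mem_centralizer₀ x.2⟩, Subtype.ext ?_⟩
      exact mul_inv_cancel₀ (fun h => hx (Subtype.ext h))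
  refine ⟨K, hF.toField, K.subtype, ?_⟩
  intro x hx
  refine ⟨⟨x, (hK x).2 (hcen x fun y hy => ?_)⟩, rfl⟩
  exact (hx ⟨y, (hK y).2 hy⟩).symm

/-- density + identity gives finite dimension -/
theorem density_finite {F V : Type*} [Field F] [AddCommGroup V] [Module F V]
    (R' : Subalgebra F (Module.End F V)) [IsSimpleModule R' V]
    (hend : ∀ φ : Module.End R' V, ∃ c : F, ∀ v, φ v = c • v)
    {D : ℕ} (c : Equiv.Perm (Fin D) → ℤ) (hc : c 1 = 1)
    (hM : ∀ x : Fin D → Module.End F V, (∀ i, x i ∈ R') →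
      ∑ w, c w • wprod (fun i => x (w i)) = 0) :
    FiniteDimensional F V ∧ R' = ⊤ := by
  classical
  have dens : ∀ (g : Module.End F V) (s : Finset V), ∃ r ∈ R', ∀ m ∈ s, g m = r m := by
    intro g s
    let g' : Module.End (Module.End R' V) V :=
      { toFun := g
        map_add' := map_add g
        map_smul' := by
          intro φ v
          obtain ⟨c, hc⟩ := hend φ
          simp [hc] }
    obtain ⟨r, hr⟩ := jacobson_density g' s
    exact ⟨r, r.2, fun m hm => hr m hm⟩
  let b := Module.Basis.ofVectorSpace F V
  have hfin : Finite (Module.Basis.ofVectorSpaceIndex F V) := by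
    by_contra hinf
    rw [not_finite_iff_infinite] at hinf
    let e := Infinite.natEmbedding (Module.Basis.ofVectorSpaceIndex F V)
    let v : ℕ → V := fun i => b (e i)
    have hx : ∀ i : ℕ, ∃ r ∈ R', ∀ j ≤ D, r (v j) = if j = i + 1 then v i else 0 := by
      intro i
      obtain ⟨r, hr, h⟩ := dens (b.constr F (fun l => if l = e (i + 1) then v i else 0))
        ((Finset.range (D + 1)).image v)
      refine ⟨r, hr, fun j hj => ?_⟩
      rw [← h (v j) (Finset.mem_image_of_mem _ (by simp; omega))]
      simp only [v, Module.Basis.constr_basis, e.injective.eq_iff]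
    choose x hxR hxv using hx
    have key : ∀ l : List ℕ, (l.map x).prod (v D) = 0 ∨
        ∃ j, j + l.length = D ∧ l = List.range' j l.length ∧ (l.map x).prod (v D) = v j := by
      intro l
      induction l with
      | nil => right; exact ⟨D, by simp⟩
      | cons a l ih =>
        simp only [List.map_cons, List.prod_cons, Module.End.mul_apply]
        rcases ih with h | ⟨j, hj, hl, h⟩
        · left; rw [h, map_zero]
        · rw [h, hxv a j (by omega)]
          split_ifs with hja
          · right
            refine ⟨a, by simp; omega, ?_, rfl⟩
            rw [List.length_cons, List.range'_succ, ← hja, ← hl]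
          · left; rfl
    have h0 := hM (fun i => x i) (fun i => hxR i)
    have h1 := congrArg (fun f : Module.End F V => f (v D)) h0
    simp only [LinearMap.sum_apply, LinearMap.smul_apply, LinearMap.zero_apply] at h1
    have hw : ∀ σ : Equiv.Perm (Fin D), wprod (fun i => x (σ i : ℕ)) =
        ((List.ofFn (fun i => (σ i : ℕ))).map x).prod := by
      intro σ
      simp [wprod, List.map_ofFn, Function.comp_def]
    rw [Finset.sum_eq_single 1] at h1
    · rw [hc, one_smul] at h1
      have : ∀ n ≤ D, ((List.range' (D - n) n).map x).prod (v D) = v (D - n) := by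
        intro n
        induction n with
        | zero => simp
        | succ n ih =>
          intro hn
          rw [List.range'_succ, List.map_cons, List.prod_cons, Module.End.mul_apply,
            show D - (n + 1) + 1 = D - n by omega, ih (by omega), hxv _ _ (by omega),
            if_pos (by omega)]
      have h2 := this D le_rfl
      rw [hw 1] at h1
      have e1 : List.ofFn (fun i => (((1 : Equiv.Perm (Fin D)) i : Fin D) : ℕ)) =
          List.range' (D - D) D := by
        apply List.ext_getElem <;> simp
      rw [e1, h2] at h1
      exact b.ne_zero _ h1
    · intro σ _ hσ
      rw [hw σ]
      rcases key (List.ofFn (fun i => (σ i : ℕ))) with h | ⟨j, hj, hl, -⟩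
      · rw [h, smul_zero]
      · exfalso
        apply hσ
        simp only [List.length_ofFn] at hj hl
        obtain rfl : j = 0 := by omega
        ext i
        have := congrArg (fun l : List ℕ => l[(i : ℕ)]?) hl
        simpa using this
    · simp
  have hfd : FiniteDimensional F V := Module.Finite.of_basis b
  refine ⟨hfd, ?_⟩
  rw [eq_top_iff]
  intro g _
  have := Fintype.ofFinite (Module.Basis.ofVectorSpaceIndex F V)
  obtain ⟨r, hr, h⟩ := dens g (Finset.univ.image b)
  have : g = r := b.ext fun i => h _ (Finset.mem_image_of_mem _ (Finset.mem_univ i))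
  rw [this]; exact hr


theorem ne_top_of_not_nilpotent {B : Type*} [Ring B] (s : B) (hs : ¬ IsNilpotent s) :
    Ideal.span {1 - Polynomial.C s * Polynomial.X} ≠ (⊤ : Ideal (Polynomial B)) := by
  intro h
  have h1 : (1 : Polynomial B) ∈ Ideal.span {1 - Polynomial.C s * Polynomial.X} := by
    rw [h]; trivial
  obtain ⟨u, hu⟩ := Ideal.mem_span_singleton'.1 h1
  have hu' : u = 1 + u * Polynomial.C s * Polynomial.X := by
    rw [mul_sub, mul_one, ← mul_assoc, sub_eq_iff_eq_add] at hu
    exact hu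
  have hco : ∀ n, u.coeff n = s ^ n := by
    intro n
    induction n with
    | zero => rw [hu']; simp
    | succ n ih =>
      rw [hu', Polynomial.coeff_add, Polynomial.coeff_mul_X, Polynomial.coeff_mul_C, ih]
      simp [Polynomial.coeff_one, pow_succ]
  apply hs
  refine ⟨u.natDegree + 1, ?_⟩
  rw [← hco]
  exact Polynomial.coeff_eq_zero_of_natDegree_lt (Nat.lt_succ_self _)

theorem exists_rep_aux.{u} {B V : Type u} [Ring B] [AddCommGroup V] [Module (Polynomial B) V]
    [IsSimpleModule (Polynomial B) V] {D : ℕ} (c : Equiv.Perm (Fin D) → ℤ) (hc : c 1 = 1)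
    (hB : MonicId c B) (s : B) (v0 : V) (hv0 : v0 ≠ 0)
    (hsv : (Polynomial.C s : Polynomial B) • (Polynomial.X : Polynomial B) • v0 = v0) :
    ∃ (F : Type u) (_ : Field F) (_ : Module F V)
      (_ : FiniteDimensional F V) (ρ : B →+* Module.End F V),
      Submodule.span F (Set.range ρ) = ⊤ ∧ ¬ IsNilpotent (ρ s) := by
  classical
  obtain ⟨F, _, j, hj⟩ := exists_max_subfield (Module.End (Polynomial B) V)
  let : Module F V := Module.compHom V j
  have hsm : ∀ (f : F) (v : V), f • v = j f v := fun _ _ => rfl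
  have : SMulCommClass F (Polynomial B) V := ⟨fun f r v => by
    rw [hsm, hsm, map_smul]⟩
  have : SMulCommClass (Polynomial B) F V := SMulCommClass.symm _ _ _
  let τ : Polynomial B →+* Module.End F V := Module.toModuleEnd F V
  have hτ : ∀ r v, τ r v = r • v := fun _ _ => rfl
  let ρ : B →+* Module.End F V := τ.comp Polynomial.C
  have hρ : ∀ b v, ρ b v = (Polynomial.C b : Polynomial B) • v := fun _ _ => rfl
  -- the action of `X` is a scalar
  have hXc : ∀ (r : Polynomial B), r * Polynomial.X = Polynomial.X * r :=
    fun r => (Polynomial.X_mul).symm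
  obtain ⟨f0, hf0⟩ := hj
    { toFun := fun v => (Polynomial.X : Polynomial B) • v
      map_add' := fun v w => smul_add _ _ _
      map_smul' := fun r v => by
        simp only [RingHom.id_apply]
        rw [smul_smul, smul_smul, hXc] } (by
      intro y
      ext v
      simp)
  have hX : ∀ v : V, (Polynomial.X : Polynomial B) • v = f0 • v := by
    intro v
    rw [hsm, hf0]
    rfl
  let R' : Subalgebra F (Module.End F V) := Algebra.adjoin F (Set.range ρ)
  have hspan : Subalgebra.toSubmodule R' = Submodule.span F (Set.range ρ) := by
    apply Algebra.adjoin_eq_span_of_subset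
    have : Submonoid.closure (Set.range ρ) ≤ MonoidHom.mrange (ρ : B →* Module.End F V) := by
      rw [Submonoid.closure_le]
      rintro _ ⟨b, rfl⟩
      exact ⟨b, rfl⟩
    intro x hx
    exact Submodule.subset_span (this hx)
  have hρR : ∀ b, ρ b ∈ R' := fun b => Algebra.subset_adjoin ⟨b, rfl⟩
  have hτX : τ Polynomial.X = algebraMap F (Module.End F V) f0 := by
    ext v
    rw [hτ, hX]
    rfl
  have hτR : ∀ r, τ r ∈ R' := by
    intro r
    induction r using Polynomial.induction_on' with
    | add p q hp hq => rw [map_add]; exact R'.add_mem hp hq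
    | monomial n b =>
      rw [← Polynomial.C_mul_X_pow_eq_monomial, map_mul, map_pow, hτX]
      exact R'.mul_mem (hρR b) (R'.pow_mem (R'.algebraMap_mem f0) n)
  have : IsSimpleModule R' V := by
    rw [isSimpleModule_iff_toSpanSingleton_surjective]
    refine ⟨⟨v0, 0, hv0⟩, ?_⟩
    intro v hv w
    obtain ⟨r, hr⟩ := IsSimpleModule.toSpanSingleton_surjective (Polynomial B) hv w
    exact ⟨⟨τ r, hτR r⟩, hr⟩
  have hend : ∀ φ : Module.End R' V, ∃ c : F, ∀ v, φ v = c • v := by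
    intro φ
    obtain ⟨f, hf⟩ := hj
      { toFun := fun v => φ v
        map_add' := fun v w => map_add φ v w
        map_smul' := fun r v => φ.map_smul ⟨τ r, hτR r⟩ v } (by
        intro y
        ext v
        exact φ.map_smul ⟨algebraMap F (Module.End F V) y, R'.algebraMap_mem y⟩ v)
    refine ⟨f, fun v => ?_⟩
    rw [hsm, hf]
    rfl
  have hM : ∀ x : Fin D → Module.End F V, (∀ i, x i ∈ R') →
      ∑ w, c w • wprod (fun i => x (w i)) = 0 := by
    intro x hx
    rw [← monMul_apply (F := F)]
    apply multilinear_span _ (Set.range ρ)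
    · intro y hy
      choose b hb using hy
      obtain rfl : y = fun i => ρ (b i) := by ext1 i; exact (hb i).symm
      rw [monMul_apply]
      have := congrArg ρ (hB b)
      rw [map_zero, map_sum] at this
      rw [← this]
      refine Finset.sum_congr rfl fun w _ => ?_
      rw [map_zsmul]
      congr 1
      exact (wprod_map (ρ : B →* Module.End F V) _).symm
    · intro i
      rw [← hspan]
      exact hx i
  obtain ⟨hfd, htop⟩ := density_finite R' hend c hc hM
  refine ⟨F, inferInstance, inferInstance, hfd, ρ, ?_, ?_⟩
  · rw [← hspan, htop]; rfl
  · rintro ⟨n, hn⟩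
    have hs1 : f0 • ρ s v0 = v0 := by
      rw [hX, ← hρ, map_smul] at hsv
      exact hsv
    have : ∀ n : ℕ, f0 ^ n • ((ρ s) ^ n) v0 = v0 := by
      intro n
      induction n with
      | zero => simp
      | succ n ih =>
        rw [pow_succ, pow_succ, Module.End.mul_apply, mul_smul, ← map_smul ((ρ s) ^ n), hs1, ih]
    have h := this n
    rw [hn] at h
    simp at h
    exact hv0 h.symm

theorem exists_rep.{u} {B : Type u} [Ring B] {D : ℕ} (c : Equiv.Perm (Fin D) → ℤ) (hc : c 1 = 1)
    (hB : MonicId c B) (s : B) (hs : ¬ IsNilpotent s) :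
    ∃ (F V : Type u) (_ : Field F) (_ : AddCommGroup V) (_ : Module F V)
      (_ : FiniteDimensional F V) (ρ : B →+* Module.End F V),
      Submodule.span F (Set.range ρ) = ⊤ ∧ ¬ IsNilpotent (ρ s) := by
  classical
  obtain ⟨M, hMmax, hMle⟩ := Ideal.exists_le_maximal _ (ne_top_of_not_nilpotent s hs)
  let V := Polynomial B ⧸ M
  have hsimp : IsSimpleModule (Polynomial B) V := isSimpleModule_iff_isCoatom.2 hMmax.out
  let v0 : V := Submodule.Quotient.mk 1
  have hv0 : v0 ≠ 0 := by
    intro h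
    exact hMmax.ne_top ((Ideal.eq_top_iff_one _).2 ((Submodule.Quotient.mk_eq_zero M).1 h))
  have hsv : (Polynomial.C s : Polynomial B) • (Polynomial.X : Polynomial B) • v0 = v0 := by
    have h1 : (Submodule.Quotient.mk (1 - Polynomial.C s * Polynomial.X) : V) = 0 :=
      (Submodule.Quotient.mk_eq_zero M).2 (hMle (Ideal.mem_span_singleton_self _))
    rw [Submodule.Quotient.mk_sub, sub_eq_zero] at h1
    rw [smul_smul, ← Submodule.Quotient.mk_smul, smul_eq_mul, mul_one]
    exact h1.symm
  obtain ⟨F, i1, i2, i3, ρ, h1, h2⟩ := exists_rep_aux c hc hB s v0 hv0 hsv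
  exact ⟨F, V, i1, inferInstance, i2, i3, ρ, h1, h2⟩


theorem finrank_bound {B F V : Type*} [Ring B] [Field F] [AddCommGroup V] [Module F V]
    [FiniteDimensional F V] (ρ : B →+* Module.End F V)
    (hspan : Submodule.span F (Set.range ρ) = ⊤) {d : ℕ} (hd : 1 ≤ d)
    (hst : ∀ x : Fin (2 * d) → B, IsNilpotent (stv x)) : Module.finrank F V ≤ d := by
  classical
  let e := LinearMap.toMatrixAlgEquiv (Module.finBasis F V)
  let f : B →+* Matrix (Fin (Module.finrank F V)) (Fin (Module.finrank F V)) F :=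
    (e : Module.End F V →+* Matrix (Fin (Module.finrank F V)) (Fin (Module.finrank F V)) F).comp ρ
  refine matrix_bound hd f.toAddMonoidHom.range ?_ ?_
  · have h1 : ((f.toAddMonoidHom.range : AddSubgroup _) :
        Set (Matrix (Fin (Module.finrank F V)) (Fin (Module.finrank F V)) F)) =
        e.toLinearMap '' (Set.range ρ) := by
      ext x
      simp only [SetLike.mem_coe, AddMonoidHom.mem_range, Set.mem_image, Set.mem_range,
        exists_exists_eq_and]
      rfl
    rw [h1, Submodule.span_image, hspan, Submodule.map_top, LinearMap.range_eq_top]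
    exact e.surjective
  · intro x hx
    choose b hb using hx
    obtain rfl : x = fun i => f (b i) := by ext1 i; exact (hb i).symm
    rw [← stv_map]
    exact (hst b).map f

theorem adjoin_nil {k A : Type*} [CommRing k] [Ring A] [Algebra k A]
    {d m t : ℕ} (hd : 1 ≤ d) (hst : ∀ x : Fin (2 * d) → A, (stv x) ^ m = 0)
    (a : Fin t → A)
    (ha : ∀ l : List (Fin t), 1 ≤ l.length → l.length ≤ d → IsNilpotent (l.map a).prod) :
    ∃ N : ℕ, ∀ l : List (Fin t), l.length = N → (l.map a).prod = 0 := by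
  classical
  let B := Algebra.adjoin k (Set.range a)
  let aB : Fin t → B := fun i => ⟨a i, Algebra.subset_adjoin ⟨i, rfl⟩⟩
  have hle : ∀ x, x ∈ NonUnitalAlgebra.adjoin k (Set.range a) → x ∈ B := by
    intro x hx
    induction hx using NonUnitalAlgebra.adjoin_induction with
    | mem x h => exact Algebra.subset_adjoin h
    | zero => exact B.zero_mem
    | add x y _ _ h1 h2 => exact B.add_mem h1 h2
    | mul x y _ _ h1 h2 => exact B.mul_mem h1 h2
    | smul r x _ h => exact B.smul_mem h r
  have hstB : ∀ x : Fin (2 * d) → B, (stv x) ^ m = 0 := by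
    intro x
    apply Subtype.ext
    have := stv_map (B.val : B →+* A) x
    have h2 := hst (fun i => (x i : A))
    change ((stv x : B) : A) = stv (fun i => (x i : A)) at this
    rw [← this] at h2
    exact h2
  obtain ⟨D, c, hc, hMB⟩ := exists_monicId B (2 * d) m hstB
  let S : Ideal B :=
    { carrier := {b | (b : A) ∈ NonUnitalAlgebra.adjoin k (Set.range a)}
      add_mem' := fun {x y} hx hy =>
        (NonUnitalAlgebra.adjoin k (Set.range a)).add_mem hx hy
      zero_mem' := zero_mem (NonUnitalAlgebra.adjoin k (Set.range a))
      smul_mem' := by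
        rintro ⟨b, hb⟩ ⟨s, hs'⟩ hs
        change s ∈ NonUnitalAlgebra.adjoin k (Set.range a) at hs
        change b * s ∈ NonUnitalAlgebra.adjoin k (Set.range a)
        clear hs'
        induction hb using Algebra.adjoin_induction generalizing s with
        | mem x h => exact mul_mem (NonUnitalAlgebra.subset_adjoin k h) hs
        | algebraMap r =>
          rw [← Algebra.smul_def]
          exact SMulMemClass.smul_mem r hs
        | add x y _ _ h1 h2 => rw [add_mul]; exact add_mem (h1 s hs) (h2 s hs)
        | mul x y _ _ h1 h2 => rw [mul_assoc]; exact h1 _ (h2 s hs) }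
  have hword : ∀ l : List (Fin t), (((l.map aB).prod : B) : A) = (l.map a).prod := by
    intro l
    have := map_list_prod (B.val) (l.map aB)
    rw [List.map_map] at this
    exact this
  have hnil : ∀ x ∈ S, IsNilpotent x := by
    intro s hs
    by_contra hnot
    obtain ⟨F, V, _, _, _, _, ρ, hspan, hρs⟩ := exists_rep c hc hMB s hnot
    have hbound := finrank_bound ρ hspan hd (fun x => ⟨m, hstB x⟩)
    have hv : ∃ v : V, ρ s v ≠ 0 := by
      by_contra h
      push Not at h
      apply hρs
      have : ρ s = 0 := LinearMap.ext h
      rw [this]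
      exact IsNilpotent.zero
    obtain ⟨v, hv⟩ := hv
    have hv0 : v ≠ 0 := by rintro rfl; simp at hv
    have : Nontrivial V := ⟨v, 0, hv0⟩
    refine ufnarovskii (fun i => ρ (aB i)) ?_ v hv0 d hbound ?_
    · intro u hu
      by_contra hcon
      push Not at hcon
      let K : Submodule F V := ⨅ i, LinearMap.ker (ρ (aB i))
      have hK : ∀ w, w ∈ K ↔ ∀ i, ρ (aB i) w = 0 := by
        intro w; simp [K]
      have hstab : ∀ (x : A) (hx : x ∈ B), ∀ w ∈ K, ρ ⟨x, hx⟩ w ∈ K := by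
        intro x hx
        induction hx using Algebra.adjoin_induction with
        | mem x h =>
          obtain ⟨i, rfl⟩ := h
          intro w hw
          have : ρ (aB i) w = 0 := (hK w).1 hw i
          rw [show ρ ⟨a i, _⟩ w = 0 from this]
          exact K.zero_mem
        | algebraMap r =>
          intro w hw
          rw [hK]
          intro i
          rw [← Module.End.mul_apply, ← map_mul]
          have : aB i * ⟨algebraMap k A r, B.algebraMap_mem r⟩ =
              ⟨algebraMap k A r, B.algebraMap_mem r⟩ * aB i :=
            Subtype.ext (Algebra.commutes r (a i)).symm
          rw [this, map_mul, Module.End.mul_apply, (hK w).1 hw i, map_zero]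
        | add x y hx hy h1 h2 =>
          intro w hw
          have : ρ ⟨x + y, B.add_mem hx hy⟩ = ρ ⟨x, hx⟩ + ρ ⟨y, hy⟩ := by
            rw [← map_add]; rfl
          rw [this]
          exact K.add_mem (h1 w hw) (h2 w hw)
        | mul x y hx hy h1 h2 =>
          intro w hw
          have : ρ ⟨x * y, B.mul_mem hx hy⟩ = ρ ⟨x, hx⟩ * ρ ⟨y, hy⟩ := by
            rw [← map_mul]; rfl
          rw [this]
          exact h1 _ (h2 w hw)
      have hend : ∀ g : Module.End F V, ∀ w ∈ K, g w ∈ K := by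
        intro g w hw
        have hg : g ∈ Submodule.span F (Set.range ρ) := by rw [hspan]; trivial
        induction hg using Submodule.span_induction with
        | mem x h =>
          obtain ⟨b, rfl⟩ := h
          exact hstab b.1 b.2 w hw
        | zero => exact K.zero_mem
        | add x y _ _ h1 h2 => exact K.add_mem h1 h2
        | smul r x _ h => exact K.smul_mem r h
      have hall : ∀ i, ρ (aB i) = 0 := by
        intro i
        ext w
        obtain ⟨g, hg⟩ := IsSimpleModule.toSpanSingleton_surjective (Module.End F V) hu w
        have hg : g u = w := hg
        have := hend g u ((hK u).2 hcon)
        rw [hg] at this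
        exact (hK w).1 this i
      have hS0 : ∀ (x : A) (hx : x ∈ NonUnitalAlgebra.adjoin k (Set.range a)),
          ρ ⟨x, hle x hx⟩ = 0 := by
        intro x hx
        induction hx using NonUnitalAlgebra.adjoin_induction with
        | mem x h =>
          obtain ⟨i, rfl⟩ := h
          exact hall i
        | zero => exact map_zero ρ
        | add x y hx hy h1 h2 =>
          have : ρ ⟨x + y, hle _ (add_mem hx hy)⟩ = ρ ⟨x, hle x hx⟩ + ρ ⟨y, hle y hy⟩ := by
            rw [← map_add]; rfl
          rw [this, h1, h2, add_zero]
        | mul x y hx hy h1 h2 =>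
          have : ρ ⟨x * y, hle _ (mul_mem hx hy)⟩ = ρ ⟨x, hle x hx⟩ * ρ ⟨y, hle y hy⟩ := by
            rw [← map_mul]; rfl
          rw [this, h1, h2, mul_zero]
        | smul r x hx h =>
          have : ρ ⟨r • x, hle _ (SMulMemClass.smul_mem r hx)⟩ =
              ρ (algebraMap k B r) * ρ ⟨x, hle x hx⟩ := by
            rw [← map_mul, ← Algebra.smul_def]; rfl
          rw [this, h, mul_zero]
      apply hv
      have : ρ s = 0 := hS0 s.1 hs
      rw [this, LinearMap.zero_apply]
    · intro l h1 h2
      have h3 : IsNilpotent (l.map aB).prod := by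
        obtain ⟨n, hn⟩ := ha l h1 h2
        refine ⟨n, Subtype.ext ?_⟩
        rw [← hword] at hn
        exact hn
      have h4 := h3.map ρ
      rw [map_list_prod, List.map_map] at h4
      exact h4
  obtain ⟨N, hN⟩ := nilpotent_of_nil aB S hnil
    (fun i => NonUnitalAlgebra.subset_adjoin k ⟨i, rfl⟩) c hc hMB
  refine ⟨N, fun l hl => ?_⟩
  rw [← hword, hN l hl]
  rfl

theorem adjoin_le_span {k A : Type*} [CommRing k] [Ring A] [Algebra k A] {t : ℕ} (a : Fin t → A)
    (x : A) (hx : x ∈ NonUnitalAlgebra.adjoin k (Set.range a)) :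
    x ∈ Submodule.span k {y | ∃ l : List (Fin t), 1 ≤ l.length ∧ y = (l.map a).prod} := by
  induction hx using NonUnitalAlgebra.adjoin_induction with
  | mem x h =>
    obtain ⟨i, rfl⟩ := h
    exact Submodule.subset_span ⟨[i], by simp⟩
  | zero => exact Submodule.zero_mem _
  | add x y _ _ h1 h2 => exact Submodule.add_mem _ h1 h2
  | mul x y _ _ h1 h2 =>
    have := Submodule.mul_mem_mul h1 h2
    rw [Submodule.span_mul_span] at this
    refine Submodule.span_mono ?_ this
    rintro _ ⟨_, ⟨l, hl, rfl⟩, _, ⟨l', hl', rfl⟩, rfl⟩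
    exact ⟨l ++ l', by simp; omega, by simp⟩
  | smul r x _ h => exact Submodule.smul_mem _ r h

theorem prod_mem_span {k A : Type*} [CommRing k] [Ring A] [Algebra k A] {t : ℕ} (a : Fin t → A)
    (l : List A) (hl : ∀ x ∈ l, x ∈ NonUnitalAlgebra.adjoin k (Set.range a)) :
    l.prod ∈ Submodule.span k
      {y | ∃ w : List (Fin t), l.length ≤ w.length ∧ y = (w.map a).prod} := by
  induction l with
  | nil => exact Submodule.subset_span ⟨[], by simp⟩
  | cons x l ih =>
    have h1 := adjoin_le_span a x (hl x (by simp))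
    have h2 := ih (fun y hy => hl y (by simp [hy]))
    have := Submodule.mul_mem_mul h1 h2
    rw [Submodule.span_mul_span] at this
    rw [List.prod_cons]
    refine Submodule.span_mono ?_ this
    rintro _ ⟨_, ⟨l, hl, rfl⟩, _, ⟨l', hl', rfl⟩, rfl⟩
    exact ⟨l ++ l', by simp; omega, by simp⟩


theorem subalgebra_nilpotent_of_short_products_nilpotent
    (k A : Type*) [CommRing k] [Ring A] [Algebra k A]
    (n m : ℕ) (hn : 2 ≤ n) (hm : 1 ≤ m)
    (hid : IsPolyId k A ((stPoly k (2 * (n - 1))) ^ m))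
    (t : ℕ) (a : Fin t → A)
    (ha : ∀ l : List (Fin t), 1 ≤ l.length → l.length ≤ n - 1 →
      IsNilpotent (l.map a).prod) :
    ∃ N : ℕ, ∀ l : List A, l.length = N →
      (∀ x ∈ l, x ∈ NonUnitalAlgebra.adjoin k (Set.range a)) → l.prod = 0 := by
  obtain ⟨N, hN⟩ := adjoin_nil (k := k) (d := n - 1) (m := m) (by omega)
    (stv_pow_zero (k := k) (2 * (n - 1)) m hid) a ha
  refine ⟨N, fun l hl hmem => ?_⟩
  have h1 := prod_mem_span a l hmem
  have h2 : Submodule.span k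
      {y : A | ∃ w : List (Fin t), l.length ≤ w.length ∧ y = (w.map a).prod} ≤ ⊥ := by
    rw [Submodule.span_le]
    rintro _ ⟨w, hw, rfl⟩
    have h3 := hN (w.take N) (by rw [List.length_take]; omega)
    have h4 : (w.map a).prod = ((w.take N).map a).prod * ((w.drop N).map a).prod := by
      rw [← List.prod_append, ← List.map_append, List.take_append_drop]
    rw [h4, h3, zero_mul]
    exact Submodule.zero_mem _
  exact (Submodule.mem_bot k).1 (h2 h1)
end
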